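/- Fix a ∈ [−1,1], μ > 0, γ > 1 and τ ∈ (0,1). Let (v, u, S) be a global solution of the relaxed system with (v − 1, u, S) ∈ C([0,∞); H²(ℝ)) ∩ C¹([0,∞); H¹(ℝ)), 3/4 ≤ v ≤ 5/4 everywhere, satisfying the uniform bound sup_{t ≥ 0}(‖(v−1)(t)‖²_{H²} + ‖u(t)‖²_{H²} + τ‖S(t)‖²_{H²}) + ∫₀^∞(‖v_x(t)‖²_{H¹} + ‖u_x(t)‖²_{H¹} + ‖S(t)‖²_{H²}) dt ≤ C₀ E₀. Then there exists a constant C > 0 depending only on γ and C₀ (in particular independent of τ) such that ∫₀^∞ ‖∂_t v(t)‖²_{H¹} dt ≤ C E₀ and ∫₀^∞ ‖∂_t u(t)‖²_{H¹} dt ≤ C E₀. -/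

import Mathlib

open MeasureTheory Filter Set intervalIntegral

noncomputable section

/-- Squared `H^k(ℝ)` norm: sum of the squared `L²` norms of the derivatives up to order `k`. -/
def HSq (k : ℕ) (f : ℝ → ℝ) : ℝ :=
  ∑ j ∈ Finset.range (k + 1), ∫ x : ℝ, (iteratedDeriv j f x) ^ 2

/-- Classical membership in `H^k(ℝ)`. -/
def MemH (k : ℕ) (f : ℝ → ℝ) : Prop :=
  ContDiff ℝ k f ∧ ∀ j ≤ k, Integrable fun x => (iteratedDeriv j f x) ^ 2

/-- Partial derivative in time. -/
def pt (f : ℝ → ℝ → ℝ) (t x : ℝ) : ℝ := deriv (fun s => f s x) t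

/-- Partial derivative in space. -/
def px (f : ℝ → ℝ → ℝ) (t x : ℝ) : ℝ := deriv (f t) x

/-- Continuity of `t ↦ f t` as an `H^k`-valued map on `I`. -/
def ContH (k : ℕ) (I : Set ℝ) (f : ℝ → ℝ → ℝ) : Prop :=
  ∀ s ∈ I, Tendsto (fun t => HSq k fun x => f t x - f s x) (nhdsWithin s I) (nhds 0)

/-- `f ∈ C⁰(I; H^k) ∩ C¹(I; H^(k-1))`. -/
def RegH (k : ℕ) (I : Set ℝ) (f : ℝ → ℝ → ℝ) : Prop :=
  (∀ t ∈ I, MemH k (f t)) ∧ ContH k I f ∧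
  (∀ x, ∀ t ∈ I, DifferentiableAt ℝ (fun s => f s x) t) ∧
  (∀ t ∈ I, MemH (k - 1) fun x => pt f t x) ∧ ContH (k - 1) I fun t x => pt f t x

/-- The 1-d isentropic compressible Navier–Stokes system with Oldroyd-type constitutive
law, in Lagrangian coordinates, at a point `(t, x)`:
`v_t = u_x`, `u_t + (v^(-γ))_x = S_x`, `τ (S_t - (2 a S / v) u_x) + S = μ u_x / v`. -/
def RelaxedSystem (a μ γ τ : ℝ) (v u S : ℝ → ℝ → ℝ) (t x : ℝ) : Prop :=
  pt v t x = px u t x ∧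
  pt u t x + deriv (fun y => v t y ^ (-γ)) x = px S t x ∧
  τ * (pt S t x - 2 * a * S t x / v t x * px u t x) + S t x = μ * px u t x / v t x

/-- The energy functional `E(t)`. -/
def En (τ : ℝ) (v u S : ℝ → ℝ → ℝ) (t : ℝ) : ℝ :=
  sSup ((fun s => HSq 2 (fun x => v s x - 1) + HSq 2 (u s) + τ * HSq 2 (S s)) '' Icc 0 t)

/-- The dissipation functional `D(t)`. -/
def Dn (v u S : ℝ → ℝ → ℝ) (t : ℝ) : ℝ :=
  HSq 1 (fun x => px v t x) + HSq 1 (fun x => px u t x) + HSq 2 (S t)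

/-- A solution of the relaxed system on `[0,T] × ℝ` in the class
`C⁰([0,T]; H²) ∩ C¹([0,T]; H¹)` with `v > 0` and `2τaS + μ > 0`. -/
def IsSolOn (a μ γ τ T : ℝ) (v u S : ℝ → ℝ → ℝ) : Prop :=
  (∀ t ∈ Icc (0 : ℝ) T, ∀ x : ℝ,
      0 < v t x ∧ 0 < 2 * τ * a * S t x + μ ∧ RelaxedSystem a μ γ τ v u S t x) ∧
  RegH 2 (Icc 0 T) (fun t x => v t x - 1) ∧ RegH 2 (Icc 0 T) u ∧ RegH 2 (Icc 0 T) S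

/-- The integral over `ℝ` of the `p`-th power of `f`, as an extended nonnegative real. -/
def lpow (p : ℕ) (f : ℝ → ℝ) : ENNReal := ∫⁻ x, ENNReal.ofReal (f x ^ p)

/-- The integral over `(0, ∞) × ℝ` of the `p`-th power of `f`. -/
def Lpow (p : ℕ) (f : ℝ → ℝ → ℝ) : ENNReal := ∫⁻ t in Ioi (0 : ℝ), lpow p (f t)

/-- Forward difference quotient with step `h`. -/
def dq (h : ℝ) (f : ℝ → ℝ) (x : ℝ) : ℝ := (f (x + h) - f x) / h

lemma lpow_shift (p : ℕ) (f : ℝ → ℝ) (h : ℝ) : lpow p (fun x => f (x + h)) = lpow p f :=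
  lintegral_add_right_eq_self (fun x => ENNReal.ofReal (f x ^ p)) h

lemma dq_eq_integral {f f' : ℝ → ℝ} (hf : ∀ x, HasDerivAt f (f' x) x) (hc : Continuous f')
    {h : ℝ} (hh : h ≠ 0) (x : ℝ) : dq h f x = ∫ θ in (0 : ℝ)..1, f' (x + h * θ) := by
  have h1 : ∀ θ ∈ uIcc (0 : ℝ) 1, HasDerivAt (fun θ => f (x + h * θ) / h) (f' (x + h * θ)) θ := by
    intro θ _
    have h2 : HasDerivAt (fun θ : ℝ => x + h * θ) h θ := by
      simpa using ((hasDerivAt_id θ).const_mul h).const_add x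
    have := ((hf (x + h * θ)).comp θ h2).div_const h
    simpa [hh] using this
  rw [integral_eq_sub_of_hasDerivAt h1 ((by fun_prop : Continuous _).intervalIntegrable _ _)]
  simp [dq, sub_div]

lemma pow_integral_le_lintegral {g : ℝ → ℝ} (hg : Continuous g) {p : ℕ} (hp : Even p) :
    ENNReal.ofReal ((∫ θ in (0 : ℝ)..1, g θ) ^ p) ≤
      ∫⁻ θ in Ioc (0 : ℝ) 1, ENNReal.ofReal (g θ ^ p) := by
  have : IsProbabilityMeasure (volume.restrict (Ioc (0 : ℝ) 1)) := ⟨by simp⟩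
  have hint : ∀ k : ℝ → ℝ, Continuous k → Integrable k (volume.restrict (Ioc (0 : ℝ) 1)) :=
    fun k hk => (hk.integrableOn_Icc (a := 0) (b := 1)).mono_set Ioc_subset_Icc_self
  rw [← ofReal_integral_eq_lintegral_ofReal (hint (fun θ => g θ ^ p) (hg.pow p))
    (Eventually.of_forall fun x => hp.pow_nonneg _), integral_of_le zero_le_one]
  refine ENNReal.ofReal_le_ofReal ?_
  exact (hp.convexOn_pow (𝕜 := ℝ)).map_integral_le (continuous_pow p).continuousOn isClosed_univ
    (by simp) (hint _ hg) (hint _ (hg.pow p))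

lemma lpow_dq_le {f f' : ℝ → ℝ} (hf : ∀ x, HasDerivAt f (f' x) x) (hc : Continuous f')
    {h : ℝ} (hh : h ≠ 0) {p : ℕ} (hp : Even p) : lpow p (dq h f) ≤ lpow p f' := by
  calc lpow p (dq h f)
      ≤ ∫⁻ x, ∫⁻ θ in Ioc (0 : ℝ) 1, ENNReal.ofReal (f' (x + h * θ) ^ p) := by
        refine lintegral_mono fun x => ?_
        rw [dq_eq_integral hf hc hh]
        exact pow_integral_le_lintegral (g := fun θ => f' (x + h * θ)) (by fun_prop) hp
    _ = ∫⁻ θ in Ioc (0 : ℝ) 1, ∫⁻ x, ENNReal.ofReal (f' (x + h * θ) ^ p) := by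
        refine lintegral_lintegral_swap ?_
        exact (by fun_prop : Continuous (Function.uncurry fun x θ : ℝ => f' (x + h * θ) ^ p)
          ).measurable.ennreal_ofReal.aemeasurable
    _ = ∫⁻ θ in Ioc (0 : ℝ) 1, lpow p f' := by
        refine lintegral_congr fun θ => lpow_shift p f' (h * θ)
    _ = lpow p f' := by simp

lemma lpow_dq_sub_le {f f' f'' : ℝ → ℝ} (hf : ∀ x, HasDerivAt f (f' x) x)
    (hf' : ∀ x, HasDerivAt f' (f'' x) x) (hc' : Continuous f'')
    {h : ℝ} (hh : h ≠ 0) :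
    lpow 2 (fun x => dq h f x - f' x) ≤ ENNReal.ofReal (h ^ 2) * lpow 2 f'' := by
  have hc : Continuous f' := continuous_iff_continuousAt.2 fun x => (hf' x).continuousAt
  calc lpow 2 (fun x => dq h f x - f' x)
      ≤ ∫⁻ x, ∫⁻ θ in Ioc (0 : ℝ) 1, ENNReal.ofReal ((f' (x + h * θ) - f' x) ^ 2) := by
        refine lintegral_mono fun x => ?_
        have : dq h f x - f' x = ∫ θ in (0 : ℝ)..1, (f' (x + h * θ) - f' x) := by
          rw [intervalIntegral.integral_sub ((by fun_prop : Continuous _).intervalIntegrable _ _)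
            (by simp), dq_eq_integral hf hc hh]
          simp
        simp only [this]
        exact pow_integral_le_lintegral (g := fun θ => f' (x + h * θ) - f' x)
          (by fun_prop) even_two
    _ = ∫⁻ θ in Ioc (0 : ℝ) 1, ∫⁻ x, ENNReal.ofReal ((f' (x + h * θ) - f' x) ^ 2) := by
        refine lintegral_lintegral_swap ?_
        exact (by fun_prop : Continuous (Function.uncurry fun x θ : ℝ =>
          (f' (x + h * θ) - f' x) ^ 2)).measurable.ennreal_ofReal.aemeasurable
    _ ≤ ∫⁻ θ in Ioc (0 : ℝ) 1, ENNReal.ofReal (h ^ 2) * lpow 2 f'' := by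
        refine setLIntegral_mono' measurableSet_Ioc fun θ hθ => ?_
        have hpos : h * θ ≠ 0 := mul_ne_zero hh hθ.1.ne'
        calc ∫⁻ x, ENNReal.ofReal ((f' (x + h * θ) - f' x) ^ 2)
            = ∫⁻ x, ENNReal.ofReal ((h * θ) ^ 2) * ENNReal.ofReal (dq (h * θ) f' x ^ 2) := by
              refine lintegral_congr fun x => ?_
              rw [← ENNReal.ofReal_mul (by positivity), dq]
              have := hpos
              congr 1
              generalize h * θ = k at this ⊢
              field_simp
          _ = ENNReal.ofReal ((h * θ) ^ 2) * lpow 2 (dq (h * θ) f') :=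
              lintegral_const_mul' _ _ ENNReal.ofReal_ne_top
          _ ≤ _ := by
              refine mul_le_mul' (ENNReal.ofReal_le_ofReal ?_) (lpow_dq_le hf' hc' hpos even_two)
              have : θ ^ 2 ≤ 1 := by nlinarith [hθ.1, hθ.2]
              nlinarith [sq_nonneg h]
    _ = ENNReal.ofReal (h ^ 2) * lpow 2 f'' := by simp

lemma integrable_sq_of_lpow {f : ℝ → ℝ} (hf : Continuous f) (h : lpow 2 f < ⊤) :
    Integrable fun x => f x ^ 2 :=
  ⟨by fun_prop, by
    rw [hasFiniteIntegral_iff_ofReal (Eventually.of_forall fun x => sq_nonneg _)]; exact h⟩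

lemma memLp_of_lpow {f : ℝ → ℝ} (hf : Continuous f) (h : lpow 2 f < ⊤) : MemLp f 2 :=
  (memLp_two_iff_integrable_sq hf.aestronglyMeasurable).2 (integrable_sq_of_lpow hf h)

lemma ofReal_integral_sq {f : ℝ → ℝ} (hf : Continuous f) (h : lpow 2 f < ⊤) :
    ENNReal.ofReal (∫ x, f x ^ 2) = lpow 2 f :=
  ofReal_integral_eq_lintegral_ofReal (integrable_sq_of_lpow hf h)
    (Eventually.of_forall fun _ => sq_nonneg _)

/-- One-dimensional Sobolev embedding. -/
lemma sq_le_lpow {f f' : ℝ → ℝ} (hf : ∀ x, HasDerivAt f (f' x) x) (hc : Continuous f') (x : ℝ) :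
    ENNReal.ofReal (f x ^ 2) ≤ 2 * lpow 2 f + lpow 2 f' := by
  have hcf : Continuous f := continuous_iff_continuousAt.2 fun x => (hf x).continuousAt
  rcases eq_or_ne (lpow 2 f) ⊤ with h1 | h1
  · simp [h1]
  rcases eq_or_ne (lpow 2 f') ⊤ with h2 | h2
  · simp [h2]
  have i1 := integrable_sq_of_lpow hcf h1.lt_top
  have i2 := integrable_sq_of_lpow hc h2.lt_top
  have key : ∀ y ∈ Icc x (x + 1), f x ^ 2 ≤ f y ^ 2 + ((∫ s, f s ^ 2) + ∫ s, f' s ^ 2) := by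
    intro y hy
    have e : ∫ s in x..y, 2 * f s * f' s = f y ^ 2 - f x ^ 2 := by
      refine integral_eq_sub_of_hasDerivAt (f := fun s => f s ^ 2) (fun s _ => ?_)
        ((by fun_prop : Continuous _).intervalIntegrable _ _)
      simpa using (hf s).fun_pow 2
    have e2 : ∫ s in x..y, -(2 * f s * f' s) ≤ ∫ s in x..y, (f s ^ 2 + f' s ^ 2) :=
      intervalIntegral.integral_mono_on hy.1
        ((by fun_prop : Continuous _).intervalIntegrable _ _)
        ((by fun_prop : Continuous _).intervalIntegrable _ _)
        fun s _ => by nlinarith [sq_nonneg (f s + f' s)]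
    have e3 : ∫ s in x..y, (f s ^ 2 + f' s ^ 2) ≤ ∫ s, (f s ^ 2 + f' s ^ 2) := by
      rw [intervalIntegral.integral_of_le hy.1]
      exact setIntegral_le_integral (i1.add i2) (Eventually.of_forall fun s => by
        show 0 ≤ f s ^ 2 + f' s ^ 2
        positivity)
    rw [integral_add i1 i2] at e3
    rw [intervalIntegral.integral_neg, e] at e2
    linarith
  have avg : ∫ y in x..(x + 1), f x ^ 2 ≤
      ∫ y in x..(x + 1), (f y ^ 2 + ((∫ x, f x ^ 2) + ∫ x, f' x ^ 2)) :=
    intervalIntegral.integral_mono_on (by linarith) (by simp)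
      ((by fun_prop : Continuous _).intervalIntegrable _ _) key
  rw [intervalIntegral.integral_add ((by fun_prop : Continuous _).intervalIntegrable _ _)
    (by simp)] at avg
  simp only [intervalIntegral.integral_const, add_sub_cancel_left, one_smul] at avg
  have e4 : ∫ s in x..(x + 1), f s ^ 2 ≤ ∫ s, f s ^ 2 := by
    rw [intervalIntegral.integral_of_le (by linarith)]
    exact setIntegral_le_integral i1 (Eventually.of_forall fun s => sq_nonneg (f s))
  have p1 : 0 ≤ ∫ x, f x ^ 2 := integral_nonneg fun x => sq_nonneg _
  have p2 : 0 ≤ ∫ x, f' x ^ 2 := integral_nonneg fun x => sq_nonneg _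
  rw [← ofReal_integral_sq hcf h1.lt_top, ← ofReal_integral_sq hc h2.lt_top,
    show (2 : ENNReal) = ENNReal.ofReal 2 by simp, ← ENNReal.ofReal_mul (by norm_num),
    ← ENNReal.ofReal_add (by positivity) p2]
  exact ENNReal.ofReal_le_ofReal (by linarith)

/-- Gagliardo–Nirenberg inequality `‖g‖₄⁴ ≤ 9 ‖f‖_∞² ‖g'‖₂²` for `g = f'`. -/
lemma lpow_four_le {f g g' : ℝ → ℝ} {B : ℝ} (hf : ∀ x, HasDerivAt f (g x) x)
    (hg : ∀ x, HasDerivAt g (g' x) x) (hc : Continuous g') (hB : ∀ x, |f x| ≤ B)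
    (h1 : lpow 2 g < ⊤) (h2 : lpow 2 g' < ⊤) :
    lpow 4 g ≤ ENNReal.ofReal (9 * B ^ 2) * lpow 2 g' := by
  have hcf : Continuous f := continuous_iff_continuousAt.2 fun x => (hf x).continuousAt
  have hcg : Continuous g := continuous_iff_continuousAt.2 fun x => (hg x).continuousAt
  have i1 := integrable_sq_of_lpow hcg h1
  have i2 := integrable_sq_of_lpow hc h2
  have hB0 : 0 ≤ B := (abs_nonneg _).trans (hB 0)
  obtain ⟨G, hG0, hG⟩ : ∃ G : ℝ, 0 ≤ G ∧ ∀ x, g x ^ 2 ≤ G := by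
    have hfin : 2 * lpow 2 g + lpow 2 g' ≠ ⊤ := by
      simp [ENNReal.mul_eq_top, h1.ne, h2.ne]
    refine ⟨(2 * lpow 2 g + lpow 2 g').toReal, ENNReal.toReal_nonneg, fun x => ?_⟩
    exact (ENNReal.ofReal_le_iff_le_toReal hfin).1 (sq_le_lpow hg hc x)
  have hGa : ∀ x, |g x| ≤ G + 1 := fun x => by
    rw [abs_le]; constructor <;> nlinarith [hG x]
  have i4 : Integrable fun x => g x ^ 4 := by
    refine (i1.const_mul G).mono' (by fun_prop) (Eventually.of_forall fun x => ?_)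
    rw [Real.norm_of_nonneg (by positivity)]
    nlinarith [hG x, sq_nonneg (g x)]
  have i3 : Integrable fun x => f x * g x ^ 3 := by
    refine (i1.const_mul (B * (G + 1))).mono' (by fun_prop) (Eventually.of_forall fun x => ?_)
    rw [Real.norm_eq_abs, abs_mul, abs_pow, pow_succ, sq_abs]
    have := mul_le_mul (hB x) (hGa x) (abs_nonneg _) hB0
    nlinarith [sq_nonneg (g x)]
  have i5 : Integrable fun x => f x * (3 * g x ^ 2 * g' x) := by
    refine ((i4.add i2).const_mul (3 * B)).mono' (by fun_prop) (Eventually.of_forall fun x => ?_)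
    rw [Real.norm_eq_abs, abs_mul]
    have a1 : |3 * g x ^ 2 * g' x| ≤ 3 * (g x ^ 4 + g' x ^ 2) := by
      rw [abs_le]
      constructor <;> nlinarith [sq_nonneg (g x ^ 2 + g' x), sq_nonneg (g x ^ 2 - g' x),
        sq_nonneg (g x ^ 2), sq_nonneg (g' x)]
    calc |f x| * |3 * g x ^ 2 * g' x| ≤ B * (3 * (g x ^ 4 + g' x ^ 2)) :=
          mul_le_mul (hB x) a1 (abs_nonneg _) hB0
      _ = _ := by simp; ring
  have hz : ∫ x, (g x * g x ^ 3 + f x * (3 * g x ^ 2 * g' x)) = 0 := by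
    refine integral_eq_zero_of_hasDerivAt_of_integrable (f := fun x => f x * g x ^ 3)
      (fun x => ?_) ?_ i3
    · simpa using (hf x).fun_mul ((hg x).fun_pow 3)
    · exact (i4.congr (Eventually.of_forall fun x => by
        show g x ^ 4 = g x * g x ^ 3; ring)).add i5
  have i6 : Integrable fun x => g x * g x ^ 3 + f x * (3 * g x ^ 2 * g' x) :=
    (i4.congr (Eventually.of_forall fun x => by show g x ^ 4 = g x * g x ^ 3; ring)).add i5
  have i7 : Integrable fun x => (1 / 2) * g x ^ 4 + (9 / 2 * B ^ 2) * g' x ^ 2 :=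
    (i4.const_mul _).add (i2.const_mul _)
  have hle : ∫ x, g x ^ 4 ≤ 9 * B ^ 2 * ∫ x, g' x ^ 2 := by
    have e1 : ∫ x, g x ^ 4 ≤
        ∫ x, ((1 / 2) * g x ^ 4 + (9 / 2 * B ^ 2) * g' x ^ 2 +
          (g x * g x ^ 3 + f x * (3 * g x ^ 2 * g' x))) := by
      refine integral_mono i4 (i7.add i6) fun x => ?_
      have hfB : f x ^ 2 ≤ B ^ 2 := sq_le_sq' (abs_le.1 (hB x)).1 (abs_le.1 (hB x)).2
      simp only
      nlinarith [sq_nonneg (g x ^ 2 + 3 * f x * g' x),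
        mul_le_mul_of_nonneg_right hfB (sq_nonneg (g' x))]
    rw [integral_add i7 i6, hz,
      integral_add (i4.const_mul _) (i2.const_mul _), MeasureTheory.integral_const_mul,
      MeasureTheory.integral_const_mul] at e1
    linarith
  have e0 : lpow 4 g = ENNReal.ofReal (∫ x, g x ^ 4) :=
    (ofReal_integral_eq_lintegral_ofReal i4 (Eventually.of_forall fun x => by positivity)).symm
  rw [e0, ← ofReal_integral_sq hc h2, ← ENNReal.ofReal_mul (by positivity)]
  exact ENNReal.ofReal_le_ofReal hle

lemma dq_tendsto {f : ℝ → ℝ} {d x : ℝ} (hf : HasDerivAt f d x) :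
    Tendsto (fun n : ℕ => dq (1 / ((n : ℝ) + 1)) f x) atTop (nhds d) := by
  have h1 := hasDerivAt_iff_tendsto_slope_zero.1 hf
  have h2 : Tendsto (fun n : ℕ => 1 / ((n : ℝ) + 1)) atTop (nhdsWithin 0 {0}ᶜ) :=
    tendsto_nhdsWithin_iff.2 ⟨tendsto_one_div_add_atTop_nhds_zero_nat,
      Eventually.of_forall fun n => by simp; positivity⟩
  refine (h1.comp h2).congr fun n => ?_
  simp [dq, div_eq_inv_mul]

lemma lpow_le_of_dq {f f' : ℝ → ℝ} (hf : ∀ x, HasDerivAt f (f' x) x) (p : ℕ)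
    {C : ENNReal} (h : ∀ k : ℝ, 0 < k → lpow p (dq k f) ≤ C) : lpow p f' ≤ C := by
  have hcf : Continuous f := continuous_iff_continuousAt.2 fun x => (hf x).continuousAt
  have hm : ∀ n : ℕ, Measurable fun x => ENNReal.ofReal (dq (1 / ((n : ℝ) + 1)) f x ^ p) := fun n =>
    (by unfold dq; fun_prop : Continuous fun x => dq (1 / ((n : ℝ) + 1)) f x ^ p
      ).measurable.ennreal_ofReal
  calc lpow p f'
      = ∫⁻ x, liminf (fun n : ℕ => ENNReal.ofReal (dq (1 / ((n : ℝ) + 1)) f x ^ p)) atTop :=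
        lintegral_congr fun x => ((ENNReal.continuous_ofReal.tendsto _).comp
          ((dq_tendsto (hf x)).pow p)).liminf_eq.symm
    _ ≤ liminf (fun n : ℕ => lpow p (dq (1 / ((n : ℝ) + 1)) f)) atTop := lintegral_liminf_le hm
    _ ≤ liminf (fun _ : ℕ => C) atTop :=
        liminf_le_liminf (Eventually.of_forall fun n => h _ (by positivity))
    _ = C := by simp

lemma measurable_lpow {f : ℝ → ℝ → ℝ} (hf : Measurable (Function.uncurry f)) (p : ℕ) :
    Measurable fun t => lpow p (f t) :=
  Measurable.lintegral_prod_right' (f := fun q : ℝ × ℝ => ENNReal.ofReal (f q.1 q.2 ^ p))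
    (hf.pow_const p).ennreal_ofReal

lemma Lpow_le_of_dq {f f' : ℝ → ℝ → ℝ} (hf : ∀ t x, HasDerivAt (f t) (f' t x) x)
    (hm : Measurable (Function.uncurry f)) (p : ℕ)
    {C : ENNReal} (h : ∀ k : ℝ, 0 < k → Lpow p (fun t => dq k (f t)) ≤ C) : Lpow p f' ≤ C := by
  have hm2 : ∀ k : ℝ, Measurable (Function.uncurry fun t => dq k (f t)) := fun k => by
    have : Measurable fun q : ℝ × ℝ => f q.1 (q.2 + k) :=
      hm.comp (measurable_fst.prodMk (measurable_snd.add_const k))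
    exact (this.sub hm).div_const k
  calc Lpow p f' ≤ ∫⁻ t in Ioi (0 : ℝ),
        liminf (fun n : ℕ => lpow p (dq (1 / ((n : ℝ) + 1)) (f t))) atTop := by
        refine lintegral_mono fun t => ?_
        have hcf : Continuous (f t) := continuous_iff_continuousAt.2 fun x => (hf t x).continuousAt
        calc lpow p (f' t) = ∫⁻ x,
              liminf (fun n : ℕ => ENNReal.ofReal (dq (1 / ((n : ℝ) + 1)) (f t) x ^ p)) atTop :=
              lintegral_congr fun x => ((ENNReal.continuous_ofReal.tendsto _).comp
                ((dq_tendsto (hf t x)).pow p)).liminf_eq.symm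
          _ ≤ _ := lintegral_liminf_le fun n =>
              (by unfold dq; fun_prop : Continuous fun x => dq (1 / ((n : ℝ) + 1)) (f t) x ^ p
                ).measurable.ennreal_ofReal
    _ ≤ liminf (fun n : ℕ => Lpow p (fun t => dq (1 / ((n : ℝ) + 1)) (f t))) atTop :=
        lintegral_liminf_le fun n => measurable_lpow (hm2 _) p
    _ ≤ liminf (fun _ : ℕ => C) atTop :=
        liminf_le_liminf (Eventually.of_forall fun n => h _ (by positivity))
    _ = C := by simp

lemma Lpow_dq_le {f f' : ℝ → ℝ → ℝ} (hf : ∀ t x, HasDerivAt (f t) (f' t x) x)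
    (hc : ∀ t, Continuous (f' t)) {h : ℝ} (hh : h ≠ 0) {p : ℕ} (hp : Even p) :
    Lpow p (fun t => dq h (f t)) ≤ Lpow p f' :=
  lintegral_mono fun t => lpow_dq_le (hf t) (hc t) hh hp

lemma setLIntegral_Ioi_le {F : ℝ → ENNReal} {C : ENNReal} (T₀ : ℝ)
    (h : ∀ T ≥ T₀, ∫⁻ t in Ioc (0 : ℝ) T, F t ≤ C) : ∫⁻ t in Ioi (0 : ℝ), F t ≤ C := by
  have hU : (⋃ n : ℕ, Ioc (0 : ℝ) n) = Ioi 0 := by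
    rw [iUnion_Ioc_eq_Ioi_self_iff]
    exact fun x _ => exists_nat_ge x
  have hmono : Monotone fun n : ℕ => Ioc (0 : ℝ) n := fun m n hmn =>
    Ioc_subset_Ioc_right (by exact_mod_cast hmn)
  rw [← hU, setLIntegral_iUnion_of_directed _ (directed_of_isDirected_le hmono)]
  refine iSup_le fun n => ?_
  refine (lintegral_mono_set ?_).trans (h (max T₀ n) (le_max_left _ _))
  exact Ioc_subset_Ioc_right (le_max_right _ _)

lemma ofReal_intervalIntegral {f : ℝ → ℝ} (hf : Continuous f) (h0 : ∀ t, 0 ≤ f t) {T : ℝ}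
    (hT : 0 ≤ T) :
    ENNReal.ofReal (∫ t in (0 : ℝ)..T, f t) = ∫⁻ t in Ioc (0 : ℝ) T, ENNReal.ofReal (f t) := by
  rw [integral_of_le hT, ofReal_integral_eq_lintegral_ofReal
    ((hf.integrableOn_Icc (a := 0) (b := T)).mono_set Ioc_subset_Icc_self)
    (Eventually.of_forall h0)]

section Dissipation

variable {Y Y' f g : ℝ → ℝ}

lemma add_integral_le_of_deriv_le (hY : Continuous Y) (hf : Continuous f) (hg : Continuous g)
    (hd : ∀ t > 0, HasDerivAt Y (Y' t) t) (hle : ∀ t > 0, Y' t ≤ g t - f t) {T : ℝ} (hT : 0 ≤ T) :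
    Y T + ∫ t in (0 : ℝ)..T, f t ≤ Y 0 + ∫ t in (0 : ℝ)..T, g t := by
  have hp : ∀ k : ℝ → ℝ, Continuous k → ∀ t, HasDerivAt (fun s => ∫ r in (0 : ℝ)..s, k r) (k t) t :=
    fun k hk t => integral_hasDerivAt_right (hk.intervalIntegrable _ _)
      (hk.stronglyMeasurableAtFilter _ _) hk.continuousAt
  have hc : ∀ k : ℝ → ℝ, Continuous k → Continuous fun s => ∫ r in (0 : ℝ)..s, k r :=
    fun k hk => continuous_iff_continuousAt.2 fun t => (hp k hk t).continuousAt
  have hD : ∀ t > 0, HasDerivAt (fun s => Y s + (∫ r in (0 : ℝ)..s, f r) - ∫ r in (0 : ℝ)..s, g r)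
      (Y' t + f t - g t) t := fun t ht => ((hd t ht).add (hp f hf t)).sub (hp g hg t)
  have hanti := antitoneOn_of_deriv_nonpos (convex_Icc 0 T)
    ((hY.add (hc f hf)).sub (hc g hg)).continuousOn
    (fun t ht => by
      rw [interior_Icc] at ht
      exact (hD t ht.1).differentiableAt.differentiableWithinAt)
    (fun t ht => by
      rw [interior_Icc] at ht
      have := (hD t ht.1).deriv
      have h2 := hle t ht.1
      change deriv (fun s => Y s + (∫ r in (0 : ℝ)..s, f r) - ∫ r in (0 : ℝ)..s, g r) t ≤ 0
      rw [this]; linarith)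
  have := hanti (left_mem_Icc.2 hT) (right_mem_Icc.2 hT) hT
  simp only [Pi.add_apply, Pi.sub_apply, integral_same] at this
  linarith

lemma ofReal_add_lintegral_le (hY : Continuous Y) (hf : Continuous f) (hg : Continuous g)
    (hY0 : ∀ t, 0 ≤ Y t) (hf0 : ∀ t, 0 ≤ f t) (hg0 : ∀ t, 0 ≤ g t)
    (hd : ∀ t > 0, HasDerivAt Y (Y' t) t) (hle : ∀ t > 0, Y' t ≤ g t - f t) {T : ℝ} (hT : 0 ≤ T) :
    ENNReal.ofReal (Y T) + ∫⁻ t in Ioc (0 : ℝ) T, ENNReal.ofReal (f t) ≤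
      ENNReal.ofReal (Y 0) + ∫⁻ t in Ioi (0 : ℝ), ENNReal.ofReal (g t) := by
  have h := add_integral_le_of_deriv_le hY hf hg hd hle hT
  have n1 : 0 ≤ ∫ t in (0 : ℝ)..T, f t := integral_nonneg hT fun t _ => hf0 t
  have n2 : 0 ≤ ∫ t in (0 : ℝ)..T, g t := integral_nonneg hT fun t _ => hg0 t
  calc _ = ENNReal.ofReal (Y T + ∫ t in (0 : ℝ)..T, f t) := by
        rw [ENNReal.ofReal_add (hY0 T) n1, ofReal_intervalIntegral hf hf0 hT]
    _ ≤ ENNReal.ofReal (Y 0 + ∫ t in (0 : ℝ)..T, g t) := ENNReal.ofReal_le_ofReal h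
    _ = ENNReal.ofReal (Y 0) + ∫⁻ t in Ioc (0 : ℝ) T, ENNReal.ofReal (g t) := by
        rw [ENNReal.ofReal_add (hY0 0) n2, ofReal_intervalIntegral hg hg0 hT]
    _ ≤ _ := by gcongr; exact Ioc_subset_Ioi_self

end Dissipation

section Dissipation₂

variable {Y Y' f g : ℝ → ℝ → ℝ}

lemma continuous_slice_left {f : ℝ → ℝ → ℝ} (hf : Continuous (Function.uncurry f)) (x : ℝ) :
    Continuous fun t => f t x := hf.comp (continuous_id.prodMk continuous_const)

lemma continuous_slice_right {f : ℝ → ℝ → ℝ} (hf : Continuous (Function.uncurry f)) (t : ℝ) :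
    Continuous (f t) := hf.comp (continuous_const.prodMk continuous_id)

lemma lintegral_swap_ofReal {f : ℝ → ℝ → ℝ} (hf : Continuous (Function.uncurry f)) (s : Set ℝ) :
    ∫⁻ t in s, ∫⁻ x, ENNReal.ofReal (f t x) = ∫⁻ x, ∫⁻ t in s, ENNReal.ofReal (f t x) :=
  lintegral_lintegral_swap hf.measurable.ennreal_ofReal.aemeasurable

/-- A pointwise differential inequality `∂ₜ Y + f ≤ g`, integrated over `(0, ∞) × ℝ`. -/
lemma lintegral₂_le_of_deriv_le (hY : Continuous (Function.uncurry Y))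
    (hf : Continuous (Function.uncurry f)) (hg : Continuous (Function.uncurry g))
    (hY0 : ∀ t x, 0 ≤ Y t x) (hf0 : ∀ t x, 0 ≤ f t x) (hg0 : ∀ t x, 0 ≤ g t x)
    (hd : ∀ t > 0, ∀ x, HasDerivAt (fun s => Y s x) (Y' t x) t)
    (hle : ∀ t > 0, ∀ x, Y' t x ≤ g t x - f t x) :
    (∫⁻ t in Ioi (0 : ℝ), ∫⁻ x, ENNReal.ofReal (f t x) ≤
      (∫⁻ x, ENNReal.ofReal (Y 0 x)) + ∫⁻ t in Ioi (0 : ℝ), ∫⁻ x, ENNReal.ofReal (g t x)) ∧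
    ∀ T ≥ 0, ∫⁻ x, ENNReal.ofReal (Y T x) ≤
      (∫⁻ x, ENNReal.ofReal (Y 0 x)) + ∫⁻ t in Ioi (0 : ℝ), ∫⁻ x, ENNReal.ofReal (g t x) := by
  have key : ∀ T ≥ 0, ∀ x, ENNReal.ofReal (Y T x) + ∫⁻ t in Ioc (0 : ℝ) T, ENNReal.ofReal (f t x) ≤
      ENNReal.ofReal (Y 0 x) + ∫⁻ t in Ioi (0 : ℝ), ENNReal.ofReal (g t x) := fun T hT x =>
    ofReal_add_lintegral_le (continuous_slice_left hY x) (continuous_slice_left hf x)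
      (continuous_slice_left hg x) (hY0 · x) (hf0 · x) (hg0 · x) (fun t ht => hd t ht x)
      (fun t ht => hle t ht x) hT
  have hm : Measurable fun x => ENNReal.ofReal (Y 0 x) :=
    (continuous_slice_right hY 0).measurable.ennreal_ofReal
  rw [lintegral_swap_ofReal hg, ← lintegral_add_left hm]
  refine ⟨setLIntegral_Ioi_le 0 fun T hT => ?_, fun T hT => ?_⟩
  · rw [lintegral_swap_ofReal hf]
    exact lintegral_mono fun x => le_add_self.trans (key T hT x)
  · exact lintegral_mono fun x => le_self_add.trans (key T hT x)

end Dissipation₂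

/-- Slices of `f` are bounded in `L²`, locally uniformly in time. -/
def SliceBdd (f : ℝ → ℝ → ℝ) : Prop := ∀ T : ℝ, ∃ B : NNReal, ∀ t ≤ T, lpow 2 (f t) ≤ B

/-- Jointly continuous functions with slices bounded in `L²`, locally uniformly in time. -/
structure Good (f : ℝ → ℝ → ℝ) : Prop where
  cont : Continuous (Function.uncurry f)
  bdd : SliceBdd f

lemma SliceBdd.of_le {f g k : ℝ → ℝ → ℝ} (hf : SliceBdd f) (hg : SliceBdd g) (C : NNReal)
    (hfm : ∀ t, Measurable (f t)) (h : ∀ t x, k t x ^ 2 ≤ C * (f t x ^ 2 + g t x ^ 2)) :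
    SliceBdd k := by
  intro T
  obtain ⟨B, hB⟩ := hf T
  obtain ⟨D, hD⟩ := hg T
  refine ⟨C * (B + D), fun t ht => ?_⟩
  calc lpow 2 (k t)
      ≤ ∫⁻ x, (C : ENNReal) * (ENNReal.ofReal (f t x ^ 2) + ENNReal.ofReal (g t x ^ 2)) := by
        refine lintegral_mono fun x => ?_
        rw [← ENNReal.ofReal_add (sq_nonneg _) (sq_nonneg _), ← ENNReal.ofReal_coe_nnreal,
          ← ENNReal.ofReal_mul C.coe_nonneg]
        exact ENNReal.ofReal_le_ofReal (h t x)
    _ = C * (lpow 2 (f t) + lpow 2 (g t)) := by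
        rw [lintegral_const_mul' _ _ ENNReal.coe_ne_top, lintegral_add_left
          ((hfm t).pow_const 2).ennreal_ofReal]
        rfl
    _ ≤ _ := by
        push_cast
        gcongr
        exacts [hB t ht, hD t ht]

namespace Good

variable {f g : ℝ → ℝ → ℝ}

lemma slice (hf : Good f) (t : ℝ) : Continuous (f t) := continuous_slice_right hf.cont t

lemma lt_top (hf : Good f) (t : ℝ) : lpow 2 (f t) < ⊤ := by
  obtain ⟨B, hB⟩ := hf.bdd t
  exact (hB t le_rfl).trans_lt ENNReal.coe_lt_top

lemma memLp_slice (hf : Good f) (t : ℝ) : MemLp (f t) 2 := memLp_of_lpow (hf.slice t) (hf.lt_top t)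

lemma of_le {k : ℝ → ℝ → ℝ} (hf : Good f) (hg : Good g) (C : NNReal)
    (hk : Continuous (Function.uncurry k))
    (h : ∀ t x, k t x ^ 2 ≤ C * (f t x ^ 2 + g t x ^ 2)) : Good k :=
  ⟨hk, hf.bdd.of_le hg.bdd C (fun t => (hf.slice t).measurable) h⟩

lemma of_cont_le {k : ℝ → ℝ → ℝ} (hf : Good f) (hk : Continuous (Function.uncurry k)) (C : ℝ)
    (h : ∀ t x, |k t x| ≤ C * |f t x|) : Good k := by
  refine hf.of_le hf (C.toNNReal ^ 2) hk fun t x => ?_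
  have h1 : |k t x| ≤ C.toNNReal * |f t x| :=
    (h t x).trans (mul_le_mul_of_nonneg_right (Real.le_coe_toNNReal C) (abs_nonneg _))
  have h2 : |k t x| ^ 2 ≤ (C.toNNReal * |f t x|) ^ 2 := by gcongr
  rw [sq_abs, mul_pow, sq_abs] at h2
  push_cast
  nlinarith [mul_nonneg (sq_nonneg (C.toNNReal : ℝ)) (sq_nonneg (f t x))]

lemma mul_bdd (hf : Good f) {c : ℝ → ℝ → ℝ} (hc : Continuous (Function.uncurry c)) (C : ℝ)
    (h : ∀ t x, |c t x| ≤ C) : Good fun t x => c t x * f t x :=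
  hf.of_cont_le (hc.mul hf.cont) C fun t x => by
    rw [abs_mul]; exact mul_le_mul_of_nonneg_right (h t x) (abs_nonneg _)

lemma add (hf : Good f) (hg : Good g) : Good fun t x => f t x + g t x :=
  hf.of_le hg 2 (hf.cont.add hg.cont) fun t x => by
    push_cast; nlinarith [sq_nonneg (f t x - g t x)]

lemma sub (hf : Good f) (hg : Good g) : Good fun t x => f t x - g t x :=
  hf.of_le hg 2 (hf.cont.sub hg.cont) fun t x => by
    push_cast; nlinarith [sq_nonneg (f t x + g t x)]

lemma neg (hf : Good f) : Good fun t x => -f t x :=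
  hf.of_cont_le hf.cont.neg 1 fun t x => by simp

lemma shift (hf : Good f) (h : ℝ) : Good fun t x => f t (x + h) :=
  ⟨hf.cont.comp (continuous_fst.prodMk (continuous_snd.add continuous_const)), fun T => by
    obtain ⟨B, hB⟩ := hf.bdd T
    exact ⟨B, fun t ht => (lpow_shift 2 (f t) h).trans_le (hB t ht)⟩⟩

lemma dq (hf : Good f) (h : ℝ) : Good fun t => dq h (f t) :=
  ((hf.shift h).sub hf).of_cont_le
    (((hf.shift h).sub hf).cont.div_const h) |h⁻¹| fun t x => by
      simp only [_root_.dq]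
      rw [div_eq_inv_mul, abs_mul]

end Good

/-- The restriction of Lebesgue measure to `(0, T] × ℝ`. -/
abbrev slab (T : ℝ) : Measure (ℝ × ℝ) := (volume.restrict (Ioc (0 : ℝ) T)).prod volume

lemma lintegral_slab {f : ℝ → ℝ → ℝ} (hf : Measurable (Function.uncurry f)) (T : ℝ) :
    ∫⁻ q, ENNReal.ofReal (Function.uncurry f q) ∂(slab T) =
      ∫⁻ t in Ioc (0 : ℝ) T, ∫⁻ x, ENNReal.ofReal (f t x) :=
  lintegral_prod _ hf.ennreal_ofReal.aemeasurable

lemma Good.lintegral_slab_lt_top {f : ℝ → ℝ → ℝ} (hf : SliceBdd f) (T : ℝ) :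
    ∫⁻ t in Ioc (0 : ℝ) T, lpow 2 (f t) < ⊤ := by
  obtain ⟨B, hB⟩ := hf T
  calc ∫⁻ t in Ioc (0 : ℝ) T, lpow 2 (f t) ≤ ∫⁻ t in Ioc (0 : ℝ) T, (B : ENNReal) :=
        setLIntegral_mono' measurableSet_Ioc fun t ht => hB t ht.2
    _ < ⊤ := by
        rw [setLIntegral_const]
        exact ENNReal.mul_lt_top ENNReal.coe_lt_top (by simp)

lemma Good.memLp {f : ℝ → ℝ → ℝ} (hf : Good f) (T : ℝ) : MemLp (Function.uncurry f) 2 (slab T) := by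
  rw [memLp_two_iff_integrable_sq hf.cont.aestronglyMeasurable]
  refine ⟨(hf.cont.pow 2).aestronglyMeasurable, ?_⟩
  rw [hasFiniteIntegral_iff_ofReal (Eventually.of_forall fun x => sq_nonneg _)]
  have := lintegral_slab (f := fun t x => f t x ^ 2)
    (show Measurable (Function.uncurry fun t x => f t x ^ 2) from (hf.cont.pow 2).measurable) T
  exact (this.trans_lt (lintegral_slab_lt_top hf.bdd T))

/-- Conservation law: integrating `∂ₜ e = e'` over `(0, T) × ℝ`. -/
lemma balance {e e' : ℝ → ℝ → ℝ} (he : Continuous (Function.uncurry e))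
    (he' : Continuous (Function.uncurry e'))
    (hd : ∀ t > 0, ∀ x, HasDerivAt (fun s => e s x) (e' t x) t) {T : ℝ} (hT : 0 ≤ T)
    (h0 : Integrable (e 0)) (h1 : Integrable (e T))
    (hi : Integrable (Function.uncurry e') (slab T)) :
    (∫ x, e T x) - ∫ x, e 0 x = ∫ q, Function.uncurry e' q ∂(slab T) := by
  rw [← integral_sub h1 h0]
  have : ∀ x, e T x - e 0 x = ∫ t in Ioc (0 : ℝ) T, e' t x := fun x => by
    rw [← integral_of_le hT]
    exact (integral_eq_sub_of_hasDerivAt_of_le hT (continuous_slice_left he x).continuousOn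
      (fun t ht => hd t ht.1 x)
      ((continuous_slice_left he' x).intervalIntegrable _ _)).symm
  simp_rw [this]
  rw [← integral_integral_swap hi]
  exact integral_integral (f := e') hi

lemma abs_integral_mul_sub_le {α : Type*} [MeasurableSpace α] {ν : Measure α} {g f fh : α → ℝ}
    (hg : MemLp g 2 ν) (hf : MemLp f 2 ν) (hfh : MemLp fh 2 ν) {h C : ℝ} (hh : 0 < h)
    (hC : ∫ x, (fh x - f x) ^ 2 ∂ν ≤ h ^ 2 * C) :
    |(∫ x, g x * fh x ∂ν) - ∫ x, g x * f x ∂ν| ≤ h * ((∫ x, g x ^ 2 ∂ν) + C) := by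
  have i1 : Integrable (fun x => g x * fh x) ν := hg.integrable_mul hfh
  have i2 : Integrable (fun x => g x * f x) ν := hg.integrable_mul hf
  have i3 : Integrable (fun x => g x ^ 2) ν := hg.integrable_sq
  have i4 : Integrable (fun x => (fh x - f x) ^ 2) ν := (hfh.sub hf).integrable_sq
  rw [← integral_sub i1 i2]
  calc |∫ x, (g x * fh x - g x * f x) ∂ν| ≤ ∫ x, |g x * fh x - g x * f x| ∂ν :=
        abs_integral_le_integral_abs
    _ ≤ ∫ x, (h * g x ^ 2 + h⁻¹ * (fh x - f x) ^ 2) ∂ν := by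
        refine integral_mono (i1.sub i2).abs ((i3.const_mul h).add (i4.const_mul h⁻¹)) fun x => ?_
        have e : h * g x ^ 2 + h⁻¹ * (fh x - f x) ^ 2 =
            h⁻¹ * ((h * g x) ^ 2 + (fh x - f x) ^ 2) := by field_simp
        have e2 : g x * fh x - g x * f x = h⁻¹ * ((h * g x) * (fh x - f x)) := by field_simp
        simp only
        rw [e, e2, abs_mul, abs_of_pos (inv_pos.2 hh)]
        refine mul_le_mul_of_nonneg_left ?_ (inv_pos.2 hh).le
        rw [abs_le]
        constructor <;> nlinarith [sq_nonneg (h * g x + (fh x - f x)),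
          sq_nonneg (h * g x - (fh x - f x)), sq_nonneg (h * g x), sq_nonneg (fh x - f x)]
    _ = h * (∫ x, g x ^ 2 ∂ν) + h⁻¹ * ∫ x, (fh x - f x) ^ 2 ∂ν := by
        rw [integral_add (i3.const_mul h) (i4.const_mul h⁻¹), MeasureTheory.integral_const_mul,
          MeasureTheory.integral_const_mul]
    _ ≤ h * (∫ x, g x ^ 2 ∂ν) + h⁻¹ * (h ^ 2 * C) := by
        have := (inv_pos.2 hh).le
        gcongr
    _ = _ := by field_simp

lemma tendsto_of_abs_sub_le_mul {F : ℝ → ℝ} {L C : ℝ}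
    (h : ∀ k : ℝ, k ≠ 0 → |F k - L| ≤ |k| * C) : Tendsto F (nhdsWithin 0 {0}ᶜ) (nhds L) := by
  rw [tendsto_iff_dist_tendsto_zero]
  have h1 : Tendsto (fun k : ℝ => |k| * C) (nhdsWithin 0 {0}ᶜ) (nhds 0) := by
    have : Tendsto (fun k : ℝ => |k| * C) (nhds 0) (nhds (|0| * C)) :=
      (continuous_abs.mul continuous_const).tendsto 0
    simp only [abs_zero, zero_mul] at this
    exact this.mono_left nhdsWithin_le_nhds
  refine squeeze_zero' (Eventually.of_forall fun _ => dist_nonneg) ?_ h1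
  filter_upwards [self_mem_nhdsWithin] with k hk
  exact h k hk

lemma tendsto_integral_mul_dq {g f f' f'' : ℝ → ℝ} (hg : MemLp g 2) (hfL : MemLp f 2)
    (hfL' : MemLp f' 2) (hf : ∀ x, HasDerivAt f (f' x) x) (hf' : ∀ x, HasDerivAt f' (f'' x) x)
    (hc : Continuous f'') (hb : lpow 2 f'' < ⊤) :
    Tendsto (fun h => ∫ x, g x * dq h f x) (nhdsWithin 0 {0}ᶜ) (nhds (∫ x, g x * f' x)) := by
  refine tendsto_of_abs_sub_le_mul (C := (∫ x, g x ^ 2) + (lpow 2 f'').toReal) fun h hh => ?_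
  have hL : MemLp (dq h f) 2 := by
    have h1 : MemLp (fun x => f (x + h)) 2 :=
      hfL.comp_measurePreserving (measurePreserving_add_right volume h)
    have h2 := (h1.sub hfL).const_mul h⁻¹
    refine (memLp_congr_ae (Eventually.of_forall fun x => ?_)).1 h2
    simp [dq, div_eq_inv_mul]
  refine abs_integral_mul_sub_le hg hfL' hL (abs_pos.2 hh) ?_
  have h1 := lpow_dq_sub_le hf hf' hc hh
  have hcf : Continuous f := continuous_iff_continuousAt.2 fun x => (hf x).continuousAt
  have hcf' : Continuous f' := continuous_iff_continuousAt.2 fun x => (hf' x).continuousAt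
  have hcd : Continuous fun x => dq h f x - f' x := by unfold dq; fun_prop
  have hlt : ENNReal.ofReal (h ^ 2) * lpow 2 f'' < ⊤ := ENNReal.mul_lt_top ENNReal.ofReal_lt_top hb
  rw [← ofReal_integral_sq hcd (h1.trans_lt hlt)] at h1
  rw [ENNReal.ofReal_le_iff_le_toReal hlt.ne] at h1
  rw [sq_abs]
  refine h1.trans_eq ?_
  rw [ENNReal.toReal_mul, ENNReal.toReal_ofReal (sq_nonneg _)]

lemma tendsto_slab_mul_dq {g f f' f'' : ℝ → ℝ → ℝ} (T : ℝ) (hg : Good g) (hfL : Good f)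
    (hfL' : Good f') (hf : ∀ t x, HasDerivAt (f t) (f' t x) x)
    (hf' : ∀ t x, HasDerivAt (f' t) (f'' t x) x)
    (hc : ∀ t, Continuous (f'' t)) (hb : SliceBdd f'') :
    Tendsto (fun h => ∫ q, g q.1 q.2 * dq h (f q.1) q.2 ∂(slab T)) (nhdsWithin 0 {0}ᶜ)
      (nhds (∫ q, g q.1 q.2 * f' q.1 q.2 ∂(slab T))) := by
  refine tendsto_of_abs_sub_le_mul (C := (∫ q, g q.1 q.2 ^ 2 ∂(slab T)) +
    (∫⁻ t in Ioc (0 : ℝ) T, lpow 2 (f'' t)).toReal) fun h hh => ?_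
  have gd := hfL.dq h
  refine abs_integral_mul_sub_le (hg.memLp T) (hfL'.memLp T) (gd.memLp T) (abs_pos.2 hh) ?_
  have hfin := Good.lintegral_slab_lt_top hb T
  rw [sq_abs]
  have gs := gd.sub hfL'
  have e1 : ENNReal.ofReal (∫ q, (dq h (f q.1) q.2 - f' q.1 q.2) ^ 2 ∂(slab T)) ≤
      ENNReal.ofReal (h ^ 2) * ∫⁻ t in Ioc (0 : ℝ) T, lpow 2 (f'' t) := by
    have e0 := ofReal_integral_eq_lintegral_ofReal (gs.memLp T).integrable_sq
      (Eventually.of_forall fun _ => sq_nonneg _)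
    refine e0.trans_le ?_
    have := lintegral_slab (f := fun t x => (dq h (f t) x - f' t x) ^ 2)
      (show Measurable (Function.uncurry fun t x => (dq h (f t) x - f' t x) ^ 2) from
        (gs.cont.pow 2).measurable) T
    refine this.trans_le ?_
    rw [← lintegral_const_mul' _ _ ENNReal.ofReal_ne_top]
    exact lintegral_mono fun t => lpow_dq_sub_le (hf t) (hf' t) (hc t) hh
  rw [ENNReal.ofReal_le_iff_le_toReal (ENNReal.mul_lt_top ENNReal.ofReal_lt_top hfin).ne,
    ENNReal.toReal_mul, ENNReal.toReal_ofReal (sq_nonneg _)] at e1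
  exact e1

/-- Summation by parts for difference quotients. -/
lemma integral_dq_mul {f g : ℝ → ℝ} (hf : MemLp f 2) (hg : MemLp g 2) (h : ℝ) :
    ∫ x, dq h f x * g x = -∫ x, f x * dq (-h) g x := by
  have hs : ∀ {k : ℝ → ℝ} (r : ℝ), MemLp k 2 → MemLp (fun x => k (x + r)) 2 := fun r hk =>
    hk.comp_measurePreserving (measurePreserving_add_right volume r)
  have i1 : Integrable fun x => f (x + h) * g x := (hs h hf).integrable_mul hg
  have i2 : Integrable fun x => f x * g x := hf.integrable_mul hg
  have i3 : Integrable fun x => f x * g (x + -h) := hf.integrable_mul (hs (-h) hg)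
  have e1 : ∫ x, f (x + h) * g x = ∫ x, f x * g (x + -h) := by
    rw [← integral_add_right_eq_self (fun x => f x * g (x + -h)) h]
    simp
  have e2 : ∀ x, dq h f x * g x = h⁻¹ * (f (x + h) * g x - f x * g x) := fun x => by
    simp only [dq, div_eq_inv_mul]; ring
  have e3 : ∀ x, f x * dq (-h) g x = h⁻¹ * (f x * g x - f x * g (x + -h)) := fun x => by
    simp only [dq, div_eq_inv_mul, inv_neg]; ring
  simp_rw [e2, e3]
  rw [MeasureTheory.integral_const_mul, MeasureTheory.integral_const_mul,
    MeasureTheory.integral_sub i1 i2, MeasureTheory.integral_sub i2 i3, e1]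
  ring

lemma integral_mul_deriv_eq_neg {f g f' g' : ℝ → ℝ} (hf : ∀ x, HasDerivAt f (f' x) x)
    (hg : ∀ x, HasDerivAt g (g' x) x) (Lf : MemLp f 2) (Lg : MemLp g 2) (Lf' : MemLp f' 2)
    (Lg' : MemLp g' 2) : ∫ x, f x * g' x = -∫ x, f' x * g x :=
  integral_mul_deriv_eq_deriv_mul_of_integrable (fun x _ => hf x) (fun x _ => hg x)
    (Lf.integrable_mul Lg')
    (Lf'.integrable_mul Lg) (Lf.integrable_mul Lg)

lemma Good.integrable_mul {f g : ℝ → ℝ → ℝ} (hf : Good f) (hg : Good g) (T : ℝ) :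
    Integrable (Function.uncurry fun t x => f t x * g t x) (slab T) :=
  MemLp.integrable_mul (hf.memLp T) (hg.memLp T)

lemma Good.integrable_slice_mul {f g : ℝ → ℝ → ℝ} (hf : Good f) (hg : Good g) (t : ℝ) :
    Integrable fun x => f t x * g t x :=
  (hf.memLp_slice t).integrable_mul (hg.memLp_slice t)

lemma HasDerivAt.dq_time {f f' : ℝ → ℝ → ℝ} {t : ℝ}
    (hf : ∀ x, HasDerivAt (fun s => f s x) (f' t x) t) (h x : ℝ) :
    HasDerivAt (fun s => dq h (f s) x) (dq h (f' t) x) t :=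
  ((hf (x + h)).sub (hf x)).div_const h

section Virial

variable {U Q Ux Qx Ut Qt Uxx Qxx : ℝ → ℝ → ℝ}

/-- A pair `(U, Q)` with `∂ₜ U + ∂ₓ Q = 0`, with enough regularity. -/
structure WavePair (U Q Ux Qx Ut Qt Uxx Qxx : ℝ → ℝ → ℝ) : Prop where
  gU : Good U
  gQ : Good Q
  gUx : Good Ux
  gQx : Good Qx
  gUt : Good Ut
  gQt : Good Qt
  dUx : ∀ t x, HasDerivAt (U t) (Ux t x) x
  dQx : ∀ t x, HasDerivAt (Q t) (Qx t x) x
  dUt : ∀ t > 0, ∀ x, HasDerivAt (fun s => U s x) (Ut t x) t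
  dQt : ∀ t > 0, ∀ x, HasDerivAt (fun s => Q s x) (Qt t x) t
  eq : ∀ t x, Ut t x = -Qx t x
  dUxx : ∀ t x, HasDerivAt (Ux t) (Uxx t x) x
  dQxx : ∀ t x, HasDerivAt (Qx t) (Qxx t x) x
  cUxx : ∀ t, Continuous (Uxx t)
  cQxx : ∀ t, Continuous (Qxx t)
  bUxx : SliceBdd Uxx
  bQxx : SliceBdd Qxx

namespace WavePair

variable (P : WavePair U Q Ux Qx Ut Qt Uxx Qxx)
include P

lemma integral_cross {T : ℝ} (hT : 0 ≤ T) :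
    (∫ x, Ux T x * Q T x) - ∫ x, Ux 0 x * Q 0 x =
      ∫ q, (Qx q.1 q.2 ^ 2 + Ux q.1 q.2 * Qt q.1 q.2) ∂(slab T) := by
  have key : ∀ h : ℝ, (∫ x, Q T x * dq h (U T) x) - ∫ x, Q 0 x * dq h (U 0) x =
      (∫ q, Qx q.1 q.2 * dq (-h) (Q q.1) q.2 ∂(slab T)) +
        ∫ q, Qt q.1 q.2 * dq h (U q.1) q.2 ∂(slab T) := by
    intro h
    have gd := P.gU.dq h
    have gdt := P.gUt.dq h
    have i1 := gdt.integrable_mul P.gQ T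
    have i2 := P.gQt.integrable_mul gd T
    have hb := balance (e := fun t x => Q t x * dq h (U t) x)
      (e' := fun t x => dq h (Ut t) x * Q t x + Qt t x * dq h (U t) x)
      (P.gQ.cont.mul gd.cont) ((gdt.cont.mul P.gQ.cont).add (P.gQt.cont.mul gd.cont))
      (fun t ht x => by
        exact ((P.dQt t ht x).fun_mul (HasDerivAt.dq_time (P.dUt t ht) h x)).congr_deriv
          (by ring)) hT
      (P.gQ.integrable_slice_mul gd 0) (P.gQ.integrable_slice_mul gd T) (i1.add i2)
    rw [hb]
    have e1 : ∫ q, dq h (Ut q.1) q.2 * Q q.1 q.2 ∂(slab T) =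
        ∫ q, Qx q.1 q.2 * dq (-h) (Q q.1) q.2 ∂(slab T) := by
      have l1 := integral_prod _ i1
      have l2 := integral_prod _ (P.gQx.integrable_mul (P.gQ.dq (-h)) T)
      simp only [Function.uncurry_apply_pair] at l1 l2
      refine l1.trans (Eq.trans ?_ l2.symm)
      refine integral_congr_ae (Eventually.of_forall fun t => ?_)
      simp only
      rw [integral_dq_mul (P.gUt.memLp_slice t) (P.gQ.memLp_slice t), ← MeasureTheory.integral_neg]
      simp [P.eq]
    rw [← e1]
    exact MeasureTheory.integral_add i1 i2
  have t1 : ∀ t, Tendsto (fun h => ∫ x, Q t x * dq h (U t) x) (nhdsWithin 0 {0}ᶜ)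
      (nhds (∫ x, Q t x * Ux t x)) := fun t =>
    tendsto_integral_mul_dq (P.gQ.memLp_slice t) (P.gU.memLp_slice t) (P.gUx.memLp_slice t)
      (P.dUx t) (P.dUxx t) (P.cUxx t) (by
        obtain ⟨B, hB⟩ := P.bUxx t
        exact (hB t le_rfl).trans_lt ENNReal.coe_lt_top)
  have t2 := tendsto_slab_mul_dq T P.gQx P.gQ P.gQx P.dQx P.dQxx P.cQxx P.bQxx
  have tn : Tendsto (fun h : ℝ => -h) (nhdsWithin 0 {0}ᶜ) (nhdsWithin 0 {0}ᶜ) := by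
    refine tendsto_nhdsWithin_iff.2 ⟨?_, ?_⟩
    · have : Tendsto (fun h : ℝ => -h) (nhds 0) (nhds (-0)) := continuous_neg.tendsto 0
      rw [neg_zero] at this
      exact this.mono_left nhdsWithin_le_nhds
    · filter_upwards [self_mem_nhdsWithin] with h hh
      simpa using hh
  have t3 := tendsto_slab_mul_dq T P.gQt P.gU P.gUx P.dUx P.dUxx P.cUxx P.bUxx
  have lim1 := (t1 T).sub (t1 0)
  have lim2 := (t2.comp tn).add t3
  have := tendsto_nhds_unique (lim1.congr key) lim2
  simp_rw [mul_comm (Ux _ _)]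
  have e1 := MeasureTheory.integral_add (P.gQx.integrable_mul P.gQx T)
    (P.gQt.integrable_mul P.gUx T)
  rw [this]
  refine e1.symm.trans ?_
  simp only [Function.uncurry, pow_two]

lemma integral_sq_eq {T : ℝ} (hT : 0 ≤ T) :
    (∫ x, U T x ^ 2) - ∫ x, U 0 x ^ 2 = ∫ t in Ioc (0 : ℝ) T, 2 * ∫ x, Ux t x * Q t x := by
  have i1 := P.gU.integrable_mul P.gUt T
  have hb := balance (e := fun t x => U t x ^ 2) (e' := fun t x => 2 * (U t x * Ut t x))
    (by exact P.gU.cont.pow 2) ((P.gU.cont.mul P.gUt.cont).const_smul (2 : ℝ))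
    (fun t ht x => by
      exact ((P.dUt t ht x).fun_pow 2).congr_deriv (by push_cast; ring)) hT
    ((P.gU.memLp_slice 0).integrable_sq) ((P.gU.memLp_slice T).integrable_sq) (i1.const_mul 2)
  rw [hb]
  have l1 := integral_prod _ (i1.const_mul 2)
  refine l1.trans ?_
  refine integral_congr_ae (Eventually.of_forall fun t => ?_)
  simp only [Function.uncurry_apply_pair]
  rw [MeasureTheory.integral_const_mul]
  congr 1
  have := integral_mul_deriv_eq_neg (P.dUx t) (P.dQx t) (P.gU.memLp_slice t) (P.gQ.memLp_slice t)
    (P.gUx.memLp_slice t) (P.gQx.memLp_slice t)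
  simp_rw [P.eq]
  rw [← neg_eq_iff_eq_neg] at this
  rw [← this, ← MeasureTheory.integral_neg]
  simp

/-- Boundedness of `∫ U²` and `∂ₜ∫ U² = 2 ∫ Uₓ Q` prevent `± ∫ Uₓ Q` from staying above `1`. -/
lemma exists_cross_lt {σ Bd : ℝ} (hσ : σ = 1 ∨ σ = -1)
    (hF : ∀ t ≥ 0, ∫ x, U t x ^ 2 ≤ Bd) {T : ℝ} (hT : 0 ≤ T) :
    ∃ T₁ ≥ T, σ * ∫ x, Ux T₁ x * Q T₁ x < 1 := by
  by_contra! hcon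
  have hF0 : ∀ t, 0 ≤ ∫ x, U t x ^ 2 := fun t => integral_nonneg fun x => sq_nonneg _
  have hBd : 0 ≤ Bd := (hF0 0).trans (hF 0 le_rfl)
  set R := T + Bd + 1
  have hR : T ≤ R := by simp only [R]; linarith
  have hint : ∀ r, IntegrableOn (fun t => ∫ x, Ux t x * Q t x) (Ioc 0 r) := fun r =>
    (P.gUx.integrable_mul P.gQ r).integral_prod_left
  have h1 := P.integral_sq_eq hT
  have h2 := P.integral_sq_eq (hT.trans hR)
  have hsplit : ∫ t in Ioc (0 : ℝ) R, 2 * ∫ x, Ux t x * Q t x =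
      (∫ t in Ioc (0 : ℝ) T, 2 * ∫ x, Ux t x * Q t x) +
        ∫ t in Ioc T R, 2 * ∫ x, Ux t x * Q t x := by
    rw [← Ioc_union_Ioc_eq_Ioc hT hR]
    exact setIntegral_union (Ioc_disjoint_Ioc_of_le le_rfl) measurableSet_Ioc
      ((hint T).const_mul 2) (((hint R).mono_set (Ioc_subset_Ioc_left hT)).const_mul 2)
  have hlow : ∫ t in Ioc T R, (2 : ℝ) ≤ ∫ t in Ioc T R, σ * (2 * ∫ x, Ux t x * Q t x) := by
    refine setIntegral_mono_on (by simp)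
      ((((hint R).mono_set (Ioc_subset_Ioc_left hT)).const_mul 2).const_mul σ)
      measurableSet_Ioc fun t ht => ?_
    have := hcon t ht.1.le
    nlinarith
  rw [MeasureTheory.integral_const_mul, setIntegral_const] at hlow
  simp only [measureReal_def, Real.volume_Ioc, smul_eq_mul] at hlow
  rw [ENNReal.toReal_ofReal (by linarith)] at hlow
  have := hF T hT
  have := hF R (hT.trans hR)
  have := hF0 T
  have := hF0 R
  simp only [R] at *
  rcases hσ with rfl | rfl <;> linarith

lemma lintegral_le {σ Bd : ℝ} (hσ : σ = 1 ∨ σ = -1) (hF : ∀ t ≥ 0, ∫ x, U t x ^ 2 ≤ Bd)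
    {A D : ℝ → ℝ → ℝ} (hA : Continuous (Function.uncurry A)) (hD : Continuous (Function.uncurry D))
    (hA0 : ∀ t x, 0 ≤ A t x) (hD0 : ∀ t x, 0 ≤ D t x)
    (h : ∀ t x, A t x - D t x ≤ σ * (Qx t x ^ 2 + Ux t x * Qt t x)) :
    ∫⁻ t in Ioi (0 : ℝ), ∫⁻ x, ENNReal.ofReal (A t x) ≤
      lpow 2 (Ux 0) + lpow 2 (Q 0) + 1 + ∫⁻ t in Ioi (0 : ℝ), ∫⁻ x, ENNReal.ofReal (D t x) := by
  by_cases hfin : ∫⁻ t in Ioi (0 : ℝ), ∫⁻ x, ENNReal.ofReal (D t x) = ⊤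
  · rw [hfin]; simp
  refine setLIntegral_Ioi_le 0 fun T hT => ?_
  obtain ⟨T₁, hT₁, hlt⟩ := P.exists_cross_lt hσ hF hT
  have hT0 : 0 ≤ T₁ := le_trans hT hT₁
  have hDu : ∀ q, 0 ≤ Function.uncurry D q := fun q => hD0 q.1 q.2
  have hDle : ∫⁻ q, ENNReal.ofReal (Function.uncurry D q) ∂(slab T₁) ≤
      ∫⁻ t in Ioi (0 : ℝ), ∫⁻ x, ENNReal.ofReal (D t x) := by
    rw [lintegral_slab hD.measurable]
    exact lintegral_mono_set Ioc_subset_Ioi_self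
  have iD : Integrable (Function.uncurry D) (slab T₁) := by
    refine ⟨hD.aestronglyMeasurable, ?_⟩
    rw [hasFiniteIntegral_iff_ofReal (Eventually.of_forall hDu)]
    exact hDle.trans_lt (lt_top_iff_ne_top.2 hfin)
  have iG : Integrable (fun q : ℝ × ℝ => σ * (Qx q.1 q.2 ^ 2 + Ux q.1 q.2 * Qt q.1 q.2))
      (slab T₁) :=
    ((P.gQx.memLp T₁).integrable_sq.add (P.gUx.integrable_mul P.gQt T₁)).const_mul σ
  have iA : Integrable (Function.uncurry A) (slab T₁) := by
    refine (iD.add iG).mono' hA.aestronglyMeasurable (Eventually.of_forall fun q => ?_)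
    rw [Real.norm_of_nonneg (show 0 ≤ Function.uncurry A q from hA0 q.1 q.2)]
    have := h q.1 q.2
    simp only [Pi.add_apply, Function.uncurry]
    linarith
  have hmain : ∫ q, Function.uncurry A q ∂(slab T₁) ≤
      (∫ q, Function.uncurry D q ∂(slab T₁)) + (1 + ((∫ x, Ux 0 x ^ 2) + ∫ x, Q 0 x ^ 2)) := by
    have e1 : ∫ q, Function.uncurry A q ∂(slab T₁) ≤ (∫ q, Function.uncurry D q ∂(slab T₁)) +
        ∫ q, σ * (Qx q.1 q.2 ^ 2 + Ux q.1 q.2 * Qt q.1 q.2) ∂(slab T₁) := by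
      rw [← MeasureTheory.integral_add iD iG]
      refine integral_mono iA (iD.add iG) fun q => ?_
      have := h q.1 q.2
      simp only [Function.uncurry]
      linarith
    rw [MeasureTheory.integral_const_mul, ← P.integral_cross hT0] at e1
    have e2 : |∫ x, Ux 0 x * Q 0 x| ≤ (∫ x, Ux 0 x ^ 2) + ∫ x, Q 0 x ^ 2 := by
      have i1 := (P.gUx.memLp_slice 0).integrable_sq
      have i2 := (P.gQ.memLp_slice 0).integrable_sq
      rw [← MeasureTheory.integral_add i1 i2]
      refine (MeasureTheory.abs_integral_le_integral_abs).trans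
        (integral_mono (P.gUx.integrable_slice_mul P.gQ 0).abs (i1.add i2) fun x => ?_)
      simp only
      rw [abs_le]
      constructor <;> nlinarith [sq_nonneg (Ux 0 x + Q 0 x), sq_nonneg (Ux 0 x - Q 0 x)]
    have := abs_le.1 e2
    rcases hσ with rfl | rfl <;> linarith
  calc ∫⁻ t in Ioc (0 : ℝ) T, ∫⁻ x, ENNReal.ofReal (A t x)
      ≤ ∫⁻ t in Ioc (0 : ℝ) T₁, ∫⁻ x, ENNReal.ofReal (A t x) :=
        lintegral_mono_set (Ioc_subset_Ioc_right hT₁)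
    _ = ENNReal.ofReal (∫ q, Function.uncurry A q ∂(slab T₁)) := by
        rw [← lintegral_slab hA.measurable, ofReal_integral_eq_lintegral_ofReal iA
          (Eventually.of_forall fun q => hA0 q.1 q.2)]
    _ ≤ ENNReal.ofReal _ := ENNReal.ofReal_le_ofReal hmain
    _ = ENNReal.ofReal (∫ q, Function.uncurry D q ∂(slab T₁)) +
          (1 + (lpow 2 (Ux 0) + lpow 2 (Q 0))) := by
        have n1 : 0 ≤ ∫ x, Ux 0 x ^ 2 := integral_nonneg fun x => sq_nonneg _
        have n2 : 0 ≤ ∫ x, Q 0 x ^ 2 := integral_nonneg fun x => sq_nonneg _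
        rw [ENNReal.ofReal_add (integral_nonneg hDu) (by positivity),
          ENNReal.ofReal_add zero_le_one (by positivity), ENNReal.ofReal_add n1 n2,
          ofReal_integral_sq (P.gUx.slice 0) (P.gUx.lt_top 0),
          ofReal_integral_sq (P.gQ.slice 0) (P.gQ.lt_top 0), ENNReal.ofReal_one]
    _ ≤ _ := by
        rw [ofReal_integral_eq_lintegral_ofReal iD (Eventually.of_forall fun q => hD0 q.1 q.2),
          add_comm, add_comm (1 : ENNReal)]
        gcongr

end WavePair

end Virial

/-- The integral of (the positive part of) `f` over `(0, ∞) × ℝ`. -/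
def LL (f : ℝ → ℝ → ℝ) : ENNReal := ∫⁻ t in Ioi (0 : ℝ), ∫⁻ x, ENNReal.ofReal (f t x)

lemma LL_mono {f g : ℝ → ℝ → ℝ} (h : ∀ t x, f t x ≤ g t x) : LL f ≤ LL g :=
  lintegral_mono fun t => lintegral_mono fun x => ENNReal.ofReal_le_ofReal (h t x)

lemma LL_add_le {f g : ℝ → ℝ → ℝ} (hf : Continuous (Function.uncurry f)) :
    LL (fun t x => f t x + g t x) ≤ LL f + LL g := by
  calc LL (fun t x => f t x + g t x)
      ≤ ∫⁻ t in Ioi (0 : ℝ), ∫⁻ x, (ENNReal.ofReal (f t x) + ENNReal.ofReal (g t x)) :=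
        lintegral_mono fun t => lintegral_mono fun x => ENNReal.ofReal_add_le
    _ = ∫⁻ t in Ioi (0 : ℝ), ((∫⁻ x, ENNReal.ofReal (f t x)) + ∫⁻ x, ENNReal.ofReal (g t x)) := by
        congr 1 with t
        exact lintegral_add_left (continuous_slice_right hf t).measurable.ennreal_ofReal _
    _ = _ := lintegral_add_left
        (Measurable.lintegral_prod_right' (f := fun q => ENNReal.ofReal (f q.1 q.2))
          hf.measurable.ennreal_ofReal) _

lemma LL_const_mul (f : ℝ → ℝ → ℝ) {C : ℝ} (hC : 0 ≤ C) :
    LL (fun t x => C * f t x) = ENNReal.ofReal C * LL f := by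
  simp only [LL, ENNReal.ofReal_mul hC]
  simp_rw [lintegral_const_mul' _ _ ENNReal.ofReal_ne_top]

/-- `f² ≤ C (g² + k²)` for even powers, integrated. -/
lemma Lpow_le_add {f g k : ℝ → ℝ → ℝ} {p : ℕ} (hg : Continuous (Function.uncurry g)) {C : ℝ}
    (hC : 0 ≤ C) (h : ∀ t x, f t x ^ p ≤ C * (g t x ^ p + k t x ^ p)) :
    Lpow p f ≤ ENNReal.ofReal C * (Lpow p g + Lpow p k) := by
  refine (LL_mono h).trans ?_
  rw [LL_const_mul _ hC]
  gcongr
  exact LL_add_le (by exact hg.pow p)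

lemma Continuous.uncurry_dq {f : ℝ → ℝ → ℝ} (hf : Continuous (Function.uncurry f)) (h : ℝ) :
    Continuous (Function.uncurry fun t x => dq h (f t) x) := by
  have : Continuous fun q : ℝ × ℝ => Function.uncurry f (q.1, q.2 + h) :=
    hf.comp (continuous_fst.prodMk (continuous_snd.add continuous_const))
  exact (this.sub hf).div_const h

/-- `L^∞` in time, `H¹` in space bound for `f` with `∂ₜ f = g`. -/
lemma lpow_deriv_le_of_time_deriv {f g fx gx : ℝ → ℝ → ℝ} (hf : Continuous (Function.uncurry f))
    (hg : Continuous (Function.uncurry g)) (dfx : ∀ t x, HasDerivAt (f t) (fx t x) x)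
    (dgx : ∀ t x, HasDerivAt (g t) (gx t x) x) (cfx : ∀ t, Continuous (fx t))
    (cgx : ∀ t, Continuous (gx t))
    (df : ∀ t > 0, ∀ x, HasDerivAt (fun s => f s x) (g t x) t) {T : ℝ} (hT : 0 ≤ T) :
    lpow 2 (fx T) ≤ lpow 2 (fx 0) + (Lpow 2 fx + Lpow 2 gx) := by
  refine lpow_le_of_dq (dfx T) 2 fun k hk => ?_
  have cf := hf.uncurry_dq k
  have cg := hg.uncurry_dq k
  have := (lintegral₂_le_of_deriv_le (Y := fun t x => dq k (f t) x ^ 2) (f := fun _ _ => 0)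
    (g := fun t x => dq k (f t) x ^ 2 + dq k (g t) x ^ 2)
    (Y' := fun t x => 2 * dq k (f t) x * dq k (g t) x)
    (by exact cf.pow 2) continuous_const (by exact (cf.pow 2).add (cg.pow 2))
    (fun _ _ => sq_nonneg _) (fun _ _ => le_rfl) (fun _ _ => by positivity)
    (fun t ht x => ((HasDerivAt.dq_time (df t ht) k x).fun_pow 2).congr_deriv (by push_cast; ring))
    (fun t _ x => by nlinarith [sq_nonneg (dq k (f t) x - dq k (g t) x)])).2 T hT
  refine this.trans ?_
  gcongr
  · exact lpow_dq_le (dfx 0) (cfx 0) hk.ne' even_two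
  · refine (LL_add_le (by exact cf.pow 2)).trans ?_
    gcongr
    · exact Lpow_dq_le dfx cfx hk.ne' even_two
    · exact Lpow_dq_le dgx cgx hk.ne' even_two

/-- Exchange of derivatives: if `∂ₜ Z = Y` with `∂ₓ Z`, `∂ₓ Y` continuous, then `∂ₜ ∂ₓ Z = ∂ₓ Y`. -/
lemma hasDerivAt_time_of_mixed {Z Y Zx Yx : ℝ → ℝ → ℝ} (hZ : Continuous (Function.uncurry Z))
    (hY : Continuous (Function.uncurry Y))
    (hZx : Continuous (Function.uncurry Zx)) (hYx : Continuous (Function.uncurry Yx))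
    (dZ : ∀ t x, HasDerivAt (Z t) (Zx t x) x) (dY : ∀ t x, HasDerivAt (Y t) (Yx t x) x)
    (dt : ∀ t > 0, ∀ x, HasDerivAt (fun s => Z s x) (Y t x) t) {t : ℝ} (ht : 0 < t) (x : ℝ) :
    HasDerivAt (fun s => Zx s x) (Yx t x) t := by
  have key : ∀ s > 0, ∀ x, Zx s x - Zx 0 x = ∫ r in (0 : ℝ)..s, Yx r x := by
    intro s hs
    have cI : Continuous fun x => ∫ r in (0 : ℝ)..s, Yx r x :=
      intervalIntegral.continuous_parametric_intervalIntegral_of_continuous'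
        (f := fun x r => Yx r x)
        (hYx.comp continuous_swap) 0 s
    have cL : Continuous fun x => Zx s x - Zx 0 x :=
      (continuous_slice_right hZx s).sub (continuous_slice_right hZx 0)
    have hint : ∀ y, ∫ x in (0 : ℝ)..y, (Zx s x - Zx 0 x) =
        ∫ x in (0 : ℝ)..y, ∫ r in (0 : ℝ)..s, Yx r x := by
      intro y
      have e1 : ∀ r, ∫ x in (0 : ℝ)..y, Yx r x = Y r y - Y r 0 := fun r =>
        integral_eq_sub_of_hasDerivAt (fun x _ => dY r x)
          ((continuous_slice_right hYx r).intervalIntegrable _ _)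
      have e2 : ∀ r, ∫ x in (0 : ℝ)..y, Zx r x = Z r y - Z r 0 := fun r =>
        integral_eq_sub_of_hasDerivAt (fun x _ => dZ r x)
          ((continuous_slice_right hZx r).intervalIntegrable _ _)
      have e3 : ∀ x, ∫ r in (0 : ℝ)..s, Y r x = Z s x - Z 0 x := fun x =>
        integral_eq_sub_of_hasDerivAt_of_le hs.le (continuous_slice_left hZ x).continuousOn
          (fun r hr => dt r hr.1 x) ((continuous_slice_left hY x).intervalIntegrable _ _)
      have e4 : ∫ x in (0 : ℝ)..y, ∫ r in (0 : ℝ)..s, Yx r x =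
          ∫ r in (0 : ℝ)..s, ∫ x in (0 : ℝ)..y, Yx r x := by
        refine intervalIntegral_intervalIntegral_swap (F := fun x r => Yx r x) ?_
        exact ((hYx.comp continuous_swap).continuousOn.integrableOn_compact
          (isCompact_uIcc.prod isCompact_uIcc)).mono_set
          (prod_mono uIoc_subset_uIcc uIoc_subset_uIcc)
      rw [e4]
      simp_rw [e1]
      rw [intervalIntegral.integral_sub ((continuous_slice_left hY y).intervalIntegrable _ _)
        ((continuous_slice_left hY 0).intervalIntegrable _ _), e3, e3,
        intervalIntegral.integral_sub ((continuous_slice_right hZx s).intervalIntegrable _ _)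
        ((continuous_slice_right hZx 0).intervalIntegrable _ _), e2, e2]
      ring
    intro x
    have d1 := integral_hasDerivAt_right (cL.intervalIntegrable 0 x)
      (cL.stronglyMeasurableAtFilter _ _) cL.continuousAt
    have d2 := integral_hasDerivAt_right (cI.intervalIntegrable 0 x)
      (cI.stronglyMeasurableAtFilter _ _) cI.continuousAt
    exact (d1.congr_of_eventuallyEq (Eventually.of_forall fun y => (hint y).symm)).unique d2
  have cs := continuous_slice_left hYx x
  have d := (integral_hasDerivAt_right (cs.intervalIntegrable 0 t)
    (cs.stronglyMeasurableAtFilter _ _) cs.continuousAt).add_const (Zx 0 x)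
  refine d.congr_of_eventuallyEq ?_
  filter_upwards [lt_mem_nhds ht] with s hs
  have := key s hs x
  linarith

/-- `c` is bounded and its variation in space is controlled by the one of `v` and `S`. -/
structure Coeff (v S c : ℝ → ℝ → ℝ) (C : ℝ) : Prop where
  pos : 0 < C
  cont : Continuous (Function.uncurry c)
  bdd : ∀ t x, |c t x| ≤ C
  dq : ∀ h t x, |dq h (c t) x| ≤ C * (|dq h (v t) x| + |dq h (S t) x|)

lemma Coeff.of_contDiffOn {Ω : Set (ℝ × ℝ)} (hΩ : Convex ℝ Ω) (hΩc : IsCompact Ω)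
    {φ : ℝ × ℝ → ℝ} (hφ : ContDiffOn ℝ 1 φ Ω) {v S : ℝ → ℝ → ℝ}
    (hv : Continuous (Function.uncurry v)) (hS : Continuous (Function.uncurry S))
    (hmem : ∀ t x, (v t x, S t x) ∈ Ω) : ∃ C, Coeff v S (fun t x => φ (v t x, S t x)) C := by
  obtain ⟨K, hK⟩ := hφ.exists_lipschitzOnWith one_ne_zero hΩ hΩc
  obtain ⟨A, hA⟩ := hΩc.exists_bound_of_continuousOn hφ.continuousOn
  refine ⟨max A K + 1, ?_, ?_, ?_, ?_⟩
  · have : (0 : ℝ) ≤ max A K := K.2.trans (le_max_right _ _)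
    linarith
  · exact hφ.continuousOn.comp_continuous (hv.prodMk hS) fun q => hmem q.1 q.2
  · intro t x
    have := hA _ (hmem t x)
    rw [Real.norm_eq_abs] at this
    have := le_max_left A (K : ℝ)
    linarith
  · intro h t x
    have h1 := hK.dist_le_mul _ (hmem t (x + h)) _ (hmem t x)
    rw [Real.dist_eq, Prod.dist_eq, Real.dist_eq, Real.dist_eq] at h1
    have h2 : |φ (v t (x + h), S t (x + h)) - φ (v t x, S t x)| ≤
        (max A K + 1) * (|v t (x + h) - v t x| + |S t (x + h) - S t x|) := by
      refine h1.trans ?_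
      have := le_max_right A (K : ℝ)
      have := K.coe_nonneg
      refine mul_le_mul (by linarith) (max_le ?_ ?_) (by positivity) (by linarith)
      · exact le_add_of_nonneg_right (abs_nonneg _)
      · exact le_add_of_nonneg_left (abs_nonneg _)
    simp only [_root_.dq, abs_div]
    rw [← add_div, mul_div_assoc']
    exact div_le_div_of_nonneg_right h2 (abs_nonneg _)

lemma exists_sub_eq_deriv_mul {f f' : ℝ → ℝ} {a b : ℝ}
    (hd : ∀ r ∈ uIcc a b, HasDerivAt f (f' r) r) :
    ∃ θ ∈ uIcc a b, f b - f a = f' θ * (b - a) := by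
  have hc : ContinuousOn f (uIcc a b) := fun r hr => (hd r hr).continuousAt.continuousWithinAt
  rcases lt_trichotomy a b with hab | rfl | hab
  · rw [uIcc_of_le hab.le] at *
    obtain ⟨θ, hθ, h⟩ := exists_hasDerivAt_eq_slope f f' hab hc
      fun r hr => hd r (Ioo_subset_Icc_self hr)
    refine ⟨θ, Ioo_subset_Icc_self hθ, ?_⟩
    rw [h, div_mul_cancel₀ _ (sub_pos.2 hab).ne']
  · exact ⟨a, by simp, by simp⟩
  · rw [uIcc_of_ge hab.le] at *
    obtain ⟨θ, hθ, h⟩ := exists_hasDerivAt_eq_slope f f' hab hc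
      fun r hr => hd r (Ioo_subset_Icc_self hr)
    refine ⟨θ, Ioo_subset_Icc_self hθ, ?_⟩
    rw [h, div_mul_eq_mul_div, eq_div_iff (sub_pos.2 hab).ne']
    ring

/-- The entropy of the stress variable. -/
lemma exists_stress_entropy {a μ τ B m : ℝ} (hτ : 0 < τ) (hm : 0 < m) (hmμ : m ≤ μ) :
    ∃ k h : ℝ → ℝ, ∃ c > 0, ∃ C > 0, ∀ s, |s| ≤ B → m ≤ μ + 2 * a * τ * s →
      HasDerivAt h (k s) s ∧ ContinuousAt k s ∧ h s + k s * (μ + 2 * a * τ * s) / τ = s ∧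
      0 ≤ h s ∧ h s ≤ C * s ^ 2 ∧ c * s ^ 2 ≤ k s * s ∧ |k s| ≤ C * |s| := by
  set M : ℝ → ℝ := fun s => μ + 2 * a * τ * s with hM
  set I : Set ℝ := {s | |s| ≤ B ∧ m ≤ M s} with hI
  have hMc : Continuous M := by fun_prop
  have hIc : IsCompact I := by
    refine Metric.isCompact_of_isClosed_isBounded ?_ ?_
    · exact (isClosed_le continuous_abs continuous_const).inter (isClosed_le continuous_const hMc)
    · refine (Metric.isBounded_Icc (-B) B).subset fun s hs => abs_le.1 hs.1
  have hseg : ∀ s ∈ I, ∀ r ∈ uIcc 0 s, r ∈ I := by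
    intro s hs r hr
    obtain ⟨h1, h2⟩ := hs
    have hs2 := abs_le.1 h1
    simp only [hM] at h2
    have hB : 0 ≤ B := (abs_nonneg s).trans h1
    rcases le_total 0 s with h0 | h0
    · rw [uIcc_of_le h0] at hr
      refine ⟨abs_le.2 ⟨by linarith [hr.1], by linarith [hr.2]⟩, ?_⟩
      simp only [hM]
      rcases le_total 0 (2 * a * τ) with h3 | h3 <;> nlinarith [hr.1, hr.2]
    · rw [uIcc_of_ge h0] at hr
      refine ⟨abs_le.2 ⟨by linarith [hr.1], by linarith [hr.2]⟩, ?_⟩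
      simp only [hM]
      rcases le_total 0 (2 * a * τ) with h3 | h3 <;> nlinarith [hr.1, hr.2]
  have hMpos : ∀ s ∈ I, 0 < M s := fun s hs => hm.trans_le hs.2
  set ξ : ℝ → ℝ := fun s => ∫ r in (0 : ℝ)..s, τ / M r with hξ
  have dξ : ∀ s ∈ I, HasDerivAt ξ (τ / M s) s := by
    intro s hs
    refine integral_hasDerivAt_right ?_ ?_ ?_
    · refine ContinuousOn.intervalIntegrable ?_
      exact continuousOn_const.div hMc.continuousOn fun r hr => (hMpos r (hseg s hs r hr)).ne'
    · exact (measurable_const.div hMc.measurable).stronglyMeasurable.stronglyMeasurableAtFilter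
    · exact continuousAt_const.div hMc.continuousAt (hMpos s hs).ne'
  set lam := 2 * a + 1
  set k : ℝ → ℝ := fun s => ∫ y in (0 : ℝ)..ξ s, Real.exp (-lam * y) with hk
  set k' : ℝ → ℝ := fun s => Real.exp (-lam * ξ s) * (τ / M s) with hk'
  have ce : Continuous fun y : ℝ => Real.exp (-lam * y) := by fun_prop
  have dk : ∀ s ∈ I, HasDerivAt k (k' s) s := fun s hs =>
    (integral_hasDerivAt_right (ce.intervalIntegrable 0 (ξ s))
      (ce.stronglyMeasurableAtFilter _ _) ce.continuousAt).comp s (dξ s hs)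
  have hlam : ∀ s, lam * k s = 1 - Real.exp (-lam * ξ s) := by
    intro s
    have : ∀ y, HasDerivAt (fun y => -Real.exp (-lam * y)) (lam * Real.exp (-lam * y)) y := by
      intro y
      exact (((hasDerivAt_id y).const_mul (-lam)).exp.neg).congr_deriv (by simp; ring)
    simp only [hk]
    rw [← intervalIntegral.integral_const_mul, integral_eq_sub_of_hasDerivAt (fun y _ => this y)
      ((ce.const_smul lam).intervalIntegrable _ _)]
    simp; ring
  set h : ℝ → ℝ := fun s => s - k s * M s / τ with hh
  have dh : ∀ s ∈ I, HasDerivAt h (k s) s := by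
    intro s hs
    have dM : HasDerivAt M (2 * a * τ) s :=
      (((hasDerivAt_id s).const_mul (2 * a * τ)).const_add μ).congr_deriv (by simp)
    refine ((hasDerivAt_id s).sub (((dk s hs).mul dM).div_const τ)).congr_deriv ?_
    have h1 := hlam s
    have h2 := hMpos s hs
    simp only [hk', lam] at h1 ⊢
    generalize Real.exp (-(2 * a + 1) * ξ s) = e at h1 ⊢
    field_simp
    linarith
  have ck' : ContinuousOn k' I := fun s hs =>
    (((continuous_const.mul continuous_id).rexp.continuousAt.comp
      (dξ s hs).continuousAt).mul
      (continuousAt_const.div hMc.continuousAt (hMpos s hs).ne')).continuousWithinAt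
  have k'pos : ∀ s ∈ I, 0 < k' s := fun s hs =>
    mul_pos (Real.exp_pos _) (div_pos hτ (hMpos s hs))
  obtain ⟨C, hC⟩ := hIc.exists_bound_of_continuousOn ck'
  obtain ⟨D, hD⟩ := hIc.exists_bound_of_continuousOn (ck'.inv₀ fun s hs => (k'pos s hs).ne')
  have k0 : k 0 = 0 := by simp [hk, hξ]
  have h0 : h 0 = 0 := by simp [hh, k0]
  have kb : ∀ s ∈ I, ∃ θ ∈ uIcc 0 s, k s = k' θ * s := fun s hs => by
    obtain ⟨θ, hθ, e⟩ := exists_sub_eq_deriv_mul fun r hr => dk r (hseg s hs r hr)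
    exact ⟨θ, hθ, by simpa [k0] using e⟩
  have hb : ∀ s ∈ I, ∃ θ ∈ uIcc 0 s, h s = k θ * s := fun s hs => by
    obtain ⟨θ, hθ, e⟩ := exists_sub_eq_deriv_mul fun r hr => dh r (hseg s hs r hr)
    exact ⟨θ, hθ, by simpa [h0] using e⟩
  have k'le : ∀ s ∈ I, k' s ≤ |C| + 1 := fun s hs => by
    have := (le_abs_self _).trans (hC s hs)
    linarith [le_abs_self C]
  have k'ge : ∀ s ∈ I, (|D| + 1)⁻¹ ≤ k' s := fun s hs => by
    have h1 : ‖(k' s)⁻¹‖ ≤ D := hD s hs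
    rw [Real.norm_eq_abs, abs_of_pos (inv_pos.2 (k'pos s hs))] at h1
    refine inv_le_of_inv_le₀ (k'pos s hs) ?_
    linarith [le_abs_self D]
  refine ⟨k, h, (|D| + 1)⁻¹, by positivity, |C| + 1, by positivity, fun s hs1 hs2 => ?_⟩
  have hs : s ∈ I := ⟨hs1, hs2⟩
  refine ⟨dh s hs, (dk s hs).continuousAt, by simp [hh, hM], ?_⟩
  obtain ⟨θ, hθ, eh⟩ := hb s hs
  have hθI := hseg s hs θ hθ
  obtain ⟨η, hη, ek⟩ := kb θ hθI
  have hηI := hseg θ hθI η hη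
  obtain ⟨ζ, hζ, ek2⟩ := kb s hs
  have hζI := hseg s hs ζ hζ
  have p1 := k'pos η hηI
  have p2 := k'pos ζ hζI
  have q1 : 0 ≤ θ * s ∧ θ * s ≤ s ^ 2 := by
    rcases le_total 0 s with h0 | h0
    · rw [uIcc_of_le h0] at hθ
      constructor <;> nlinarith [hθ.1, hθ.2]
    · rw [uIcc_of_ge h0] at hθ
      constructor <;> nlinarith [hθ.1, hθ.2]
  rw [eh, ek, ek2]
  refine ⟨by nlinarith, ?_, ?_, ?_⟩
  · rw [mul_assoc]
    exact mul_le_mul (k'le η hηI) q1.2 q1.1 (by positivity)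
  · rw [mul_assoc, ← pow_two]
    exact mul_le_mul_of_nonneg_right (k'ge ζ hζI) (sq_nonneg s)
  · rw [abs_mul, abs_of_pos p2]
    exact mul_le_mul_of_nonneg_right (k'le ζ hζI) (abs_nonneg s)

/-- The entropy of the specific volume. -/
lemma exists_volume_entropy {γ : ℝ} (hγ : 1 < γ) :
    ∃ Φ : ℝ → ℝ, ∃ C : ℝ, ∀ v ∈ Icc (3 / 4 : ℝ) (5 / 4),
      HasDerivAt Φ (1 - v ^ (-γ)) v ∧ 0 ≤ Φ v ∧ Φ v ≤ C * (v - 1) ^ 2 := by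
  set Φ : ℝ → ℝ := fun v => v + v ^ (1 - γ) / (γ - 1) - (1 + 1 / (γ - 1)) with hΦ
  set p : ℝ → ℝ := fun v => 1 - v ^ (-γ) with hp
  set p' : ℝ → ℝ := fun v => γ * v ^ (-γ - 1) with hp'
  have hγ1 : γ - 1 ≠ 0 := by linarith
  have dΦ : ∀ v > 0, HasDerivAt Φ (p v) v := fun v hv => by
    refine (((hasDerivAt_id v).add ((Real.hasDerivAt_rpow_const (p := 1 - γ)
      (Or.inl hv.ne')).div_const (γ - 1))).sub_const _).congr_deriv ?_
    simp only [hp]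
    rw [show 1 - γ - 1 = -γ by ring]
    field_simp
    ring
  have dp : ∀ v > 0, HasDerivAt p (p' v) v := fun v hv =>
    ((Real.hasDerivAt_rpow_const (p := -γ) (Or.inl hv.ne')).const_sub 1).congr_deriv (by
      simp only [hp']; ring)
  have hseg : ∀ v ∈ Icc (3 / 4 : ℝ) (5 / 4), ∀ r ∈ uIcc 1 v, r ∈ Icc (3 / 4 : ℝ) (5 / 4) := by
    intro v hv r hr
    exact (uIcc_subset_Icc (by norm_num) hv) hr
  have hpos : ∀ v ∈ Icc (3 / 4 : ℝ) (5 / 4), 0 < v := fun v hv => by linarith [hv.1]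
  have cp' : ContinuousOn p' (Icc (3 / 4 : ℝ) (5 / 4)) := fun v hv =>
    (continuousAt_const.mul (Real.continuousAt_rpow_const _ _
      (Or.inl (hpos v hv).ne'))).continuousWithinAt
  obtain ⟨C, hC⟩ := isCompact_Icc.exists_bound_of_continuousOn cp'
  have p1 : p 1 = 0 := by simp [hp]
  have Φ1 : Φ 1 = 0 := by simp [hΦ]
  refine ⟨Φ, |C|, fun v hv => ⟨dΦ v (hpos v hv), ?_⟩⟩
  obtain ⟨θ, hθ, e1⟩ := exists_sub_eq_deriv_mul fun r hr => dΦ r (hpos r (hseg v hv r hr))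
  have hθI := hseg v hv θ hθ
  obtain ⟨η, hη, e2⟩ := exists_sub_eq_deriv_mul fun r hr => dp r (hpos r (hseg θ hθI r hr))
  have hηI := hseg θ hθI η hη
  rw [Φ1, sub_zero] at e1
  rw [p1, sub_zero] at e2
  rw [e1, e2]
  have q0 : 0 < p' η := mul_pos (by linarith) (Real.rpow_pos_of_pos (hpos η hηI) _)
  have q1 : 0 ≤ (θ - 1) * (v - 1) ∧ (θ - 1) * (v - 1) ≤ (v - 1) ^ 2 := by
    rcases le_total 1 v with h0 | h0
    · rw [uIcc_of_le h0] at hθ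
      constructor <;> nlinarith [hθ.1, hθ.2]
    · rw [uIcc_of_ge h0] at hθ
      constructor <;> nlinarith [hθ.1, hθ.2]
  rw [mul_assoc]
  refine ⟨mul_nonneg q0.le q1.1, mul_le_mul ?_ q1.2 q1.1 (abs_nonneg C)⟩
  exact ((le_abs_self _).trans (hC η hηI)).trans (le_abs_self C)

lemma Lpow_shift (p : ℕ) (f : ℝ → ℝ → ℝ) (h : ℝ) :
    Lpow p (fun t x => f t (x + h)) = Lpow p f := by
  simp only [Lpow, lpow_shift]

lemma dq_mul (h : ℝ) (c f : ℝ → ℝ) (x : ℝ) :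
    dq h (fun y => c y * f y) x = c x * dq h f x + dq h c x * f (x + h) := by
  simp only [dq, div_eq_mul_inv]; ring

lemma dq_add (h : ℝ) (f g : ℝ → ℝ) (x : ℝ) :
    dq h (fun y => f y + g y) x = dq h f x + dq h g x := by
  simp only [dq, div_eq_mul_inv]; ring

lemma HasDerivAt.dq_space {f f' : ℝ → ℝ} (hf : ∀ x, HasDerivAt f (f' x) x) (h x : ℝ) :
    HasDerivAt (dq h f) (dq h f' x) x :=
  (((hf (x + h)).comp_add_const x h).sub (hf x)).div_const h

lemma Coeff.mono {v S c : ℝ → ℝ → ℝ} {C D : ℝ} (h : Coeff v S c C) (hCD : C ≤ D) :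
    Coeff v S c D where
  pos := h.pos.trans_le hCD
  cont := h.cont
  bdd t x := (h.bdd t x).trans hCD
  dq k t x := (h.dq k t x).trans (mul_le_mul_of_nonneg_right hCD (by positivity))

/-- Expansion of the difference quotient of a linear combination with variable coefficients. -/
lemma Coeff.dq_combination {v S α β z w : ℝ → ℝ → ℝ} {C : ℝ} (hα : Coeff v S α C)
    (hβ : Coeff v S β C) (h t x : ℝ) :
    ∃ r, _root_.dq h (fun y => α t y * z t y + β t y * w t y) x = α t x * _root_.dq h (z t) x + r ∧
      r ^ 2 ≤ 8 * C ^ 2 * (_root_.dq h (w t) x ^ 2 + (_root_.dq h (v t) x ^ 4 +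
        (_root_.dq h (S t) x ^ 4 + (z t (x + h) ^ 4 + w t (x + h) ^ 4)))) := by
  have hC := hα.pos
  refine ⟨β t x * _root_.dq h (w t) x + (_root_.dq h (α t) x * z t (x + h) +
    _root_.dq h (β t) x * w t (x + h)), by rw [dq_add, dq_mul, dq_mul]; ring, ?_⟩
  have b1 := hβ.bdd t x
  have b2 := hα.dq h t x
  have b3 := hβ.dq h t x
  set p := _root_.dq h (w t) x
  set q := _root_.dq h (v t) x
  set s := _root_.dq h (S t) x
  set y := z t (x + h)
  set w' := w t (x + h)
  set A := _root_.dq h (α t) x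
  set B := _root_.dq h (β t) x
  have e1 : |β t x * p + (A * y + B * w')| ≤ C * (|p| + (|q| + |s|) * (|y| + |w'|)) := by
    calc |β t x * p + (A * y + B * w')| ≤ |β t x * p| + (|A * y| + |B * w'|) :=
          (abs_add_le _ _).trans (by gcongr; exact abs_add_le _ _)
      _ = |β t x| * |p| + (|A| * |y| + |B| * |w'|) := by simp only [abs_mul]
      _ ≤ C * |p| + (C * (|q| + |s|) * |y| + C * (|q| + |s|) * |w'|) := by gcongr
      _ = _ := by ring
  have e2 : (β t x * p + (A * y + B * w')) ^ 2 ≤ (C * (|p| + (|q| + |s|) * (|y| + |w'|))) ^ 2 := by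
    rw [← sq_abs]; gcongr
  refine e2.trans ?_
  rw [← sq_abs p, ← Even.pow_abs (by decide : Even 4) q, ← Even.pow_abs (by decide : Even 4) s,
    ← Even.pow_abs (by decide : Even 4) y, ← Even.pow_abs (by decide : Even 4) w']
  generalize |p| = p, |q| = q, |s| = s, |y| = y, |w'| = w
  rw [mul_pow, mul_comm (8 : ℝ), mul_assoc]
  refine mul_le_mul_of_nonneg_left ?_ (sq_nonneg C)
  have f1 : (p + (q + s) * (y + w)) ^ 2 ≤ 2 * p ^ 2 + 2 * ((q + s) * (y + w)) ^ 2 := by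
    nlinarith [sq_nonneg (p - (q + s) * (y + w))]
  have f2 : 2 * ((q + s) * (y + w)) ^ 2 ≤ (q + s) ^ 4 + (y + w) ^ 4 := by
    nlinarith [sq_nonneg ((q + s) ^ 2 - (y + w) ^ 2)]
  have f3 : ∀ m n : ℝ, (m + n) ^ 4 ≤ 8 * (m ^ 4 + n ^ 4) := fun m n => by
    nlinarith [sq_nonneg (m ^ 2 - n ^ 2), sq_nonneg (m - n), mul_nonneg (sq_nonneg (m - n))
      (add_nonneg (add_nonneg (sq_nonneg m) (sq_nonneg n)) (sq_nonneg (m + n)))]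
  linarith [f3 q s, f3 y w, sq_nonneg p]

lemma lpow_four_lt_top {f f' : ℝ → ℝ} (hf : ∀ x, HasDerivAt f (f' x) x) (hc : Continuous f')
    (h1 : lpow 2 f < ⊤) (h2 : lpow 2 f' < ⊤) : lpow 4 f < ⊤ := by
  have h3 : 2 * lpow 2 f + lpow 2 f' < ⊤ :=
    ENNReal.add_lt_top.2 ⟨ENNReal.mul_lt_top (by simp) h1, h2⟩
  calc lpow 4 f ≤ ∫⁻ x, (2 * lpow 2 f + lpow 2 f') * ENNReal.ofReal (f x ^ 2) := by
        refine lintegral_mono fun x => ?_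
        rw [show f x ^ 4 = f x ^ 2 * f x ^ 2 by ring, ENNReal.ofReal_mul (sq_nonneg _)]
        gcongr
        exact sq_le_lpow hf hc x
    _ = (2 * lpow 2 f + lpow 2 f') * lpow 2 f := lintegral_const_mul' _ _ h3.ne
    _ < ⊤ := ENNReal.mul_lt_top h3 h1

lemma LL_sq_mul_sq_le {f g g' : ℝ → ℝ → ℝ} (hg : ∀ t x, HasDerivAt (g t) (g' t x) x)
    (hc : ∀ t, Continuous (g' t)) (hm : Continuous (Function.uncurry g))
    {X : ENNReal} (hX0 : X ≠ 0) (hX : X < ⊤) (hf : ∀ t > 0, lpow 2 (f t) ≤ X) :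
    LL (fun t x => f t x ^ 2 * g t x ^ 2) ≤ X * (2 * Lpow 2 g + Lpow 2 g') := by
  calc LL (fun t x => f t x ^ 2 * g t x ^ 2)
      ≤ ∫⁻ t in Ioi (0 : ℝ), X * (2 * lpow 2 (g t) + lpow 2 (g' t)) := by
        refine setLIntegral_mono' measurableSet_Ioi fun t ht => ?_
        by_cases htop : 2 * lpow 2 (g t) + lpow 2 (g' t) = ⊤
        · rw [htop]
          rw [ENNReal.mul_top hX0]; exact le_top
        calc ∫⁻ x, ENNReal.ofReal (f t x ^ 2 * g t x ^ 2)
            ≤ ∫⁻ x, (2 * lpow 2 (g t) + lpow 2 (g' t)) * ENNReal.ofReal (f t x ^ 2) := by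
              refine lintegral_mono fun x => ?_
              rw [mul_comm, ENNReal.ofReal_mul (sq_nonneg _)]
              gcongr
              exact sq_le_lpow (hg t) (hc t) x
          _ = (2 * lpow 2 (g t) + lpow 2 (g' t)) * lpow 2 (f t) := lintegral_const_mul' _ _ htop
          _ ≤ _ := by rw [mul_comm]; gcongr; exact hf t ht
    _ = X * (2 * Lpow 2 g + Lpow 2 g') := by
        rw [lintegral_const_mul' _ _ hX.ne, lintegral_add_left
          ((measurable_lpow hm.measurable 2).const_mul 2), lintegral_const_mul' _ _ (by simp)]
        rfl

/-- Abstract form of the system: `z` satisfies a damped equation forced by `w = ∂ₜ u`,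
the gradients of `v` and `S` are combinations of `z` and `w`, and `(u, Q)` is a wave-like pair. -/
structure Reduced (v u S vx ux Sx w vxx uxx Sxx wx z Q αv βv αs βs ζv ζs c e K :
    ℝ → ℝ → ℝ) (τ C c₀ : ℝ) : Prop where
  τpos : 0 < τ
  c₀pos : 0 < c₀
  cαv : Coeff v S αv C
  cβv : Coeff v S βv C
  cαs : Coeff v S αs C
  cβs : Coeff v S βs C
  cζv : Coeff v S ζv C
  cζs : Coeff v S ζs C
  cc : Coeff v S c C
  ce : Coeff v S e C
  cK : Coeff v S K C
  c_ge : ∀ t x, c₀ ≤ c t x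
  K_ge : ∀ t x, c₀ ≤ K t x
  ζs_ge : ∀ t x, c₀ ≤ ζs t x
  cv : Continuous (Function.uncurry v)
  gu : Good u
  gS : Good S
  gvx : Good vx
  gux : Good ux
  gSx : Good Sx
  gw : Good w
  gQ : Good Q
  dv : ∀ t x, HasDerivAt (v t) (vx t x) x
  du : ∀ t x, HasDerivAt (u t) (ux t x) x
  dS : ∀ t x, HasDerivAt (S t) (Sx t x) x
  dvx : ∀ t x, HasDerivAt (vx t) (vxx t x) x
  dux : ∀ t x, HasDerivAt (ux t) (uxx t x) x
  dSx : ∀ t x, HasDerivAt (Sx t) (Sxx t x) x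
  dw : ∀ t x, HasDerivAt (w t) (wx t x) x
  dQ : ∀ t x, HasDerivAt (Q t) (-w t x) x
  cvxx : ∀ t, Continuous (vxx t)
  cuxx : ∀ t, Continuous (uxx t)
  cSxx : ∀ t, Continuous (Sxx t)
  cwx : ∀ t, Continuous (wx t)
  bvxx : SliceBdd vxx
  buxx : SliceBdd uxx
  bSxx : SliceBdd Sxx
  bwx : SliceBdd wx
  tv : ∀ t > 0, ∀ x, HasDerivAt (fun s => v s x) (ux t x) t
  tu : ∀ t > 0, ∀ x, HasDerivAt (fun s => u s x) (w t x) t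
  tQ : ∀ t > 0, ∀ x, HasDerivAt (fun s => Q s x) (-K t x * ux t x + S t x / τ) t
  tz : ∀ t > 0, ∀ x, HasDerivAt (fun s => z s x) (-(c t x * z t x + e t x * w t x)) t
  vx_eq : ∀ t x, vx t x = αv t x * z t x + βv t x * w t x
  Sx_eq : ∀ t x, Sx t x = αs t x * z t x + βs t x * w t x
  z_eq : ∀ t x, z t x = ζv t x * vx t x + ζs t x * Sx t x
  Q_le : ∀ t x, |Q t x| ≤ C
  u_le : ∃ Bd, ∀ t ≥ 0, ∫ x, u t x ^ 2 ≤ Bd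
  S_lt : Lpow 2 S < ⊤

namespace Reduced

variable {v u S vx ux Sx w vxx uxx Sxx wx z Q αv βv αs βs ζv ζs c e K :
    ℝ → ℝ → ℝ} {τ C c₀ : ℝ}
  (R : Reduced v u S vx ux Sx w vxx uxx Sxx wx z Q αv βv αs βs ζv ζs c e K τ C c₀)
include R

lemma Cpos : 0 < C := R.cc.pos

lemma cz : Continuous (Function.uncurry z) := by
  have := (R.cζv.cont.mul R.gvx.cont).add (R.cζs.cont.mul R.gSx.cont)
  refine this.congr fun q => ?_
  simp only [Function.uncurry, Pi.add_apply, Pi.mul_apply, R.z_eq]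

lemma pow_combination_le {α β f g : ℝ} {p : ℕ} (hα : |α| ≤ C) (hβ : |β| ≤ C) (hp : Even p) :
    (α * f + β * g) ^ p ≤ (2 * C) ^ p * (f ^ p + g ^ p) := by
  have hC := R.Cpos
  have h1 : |α * f + β * g| ≤ (2 * C) * max |f| |g| := by
    calc |α * f + β * g| ≤ |α| * |f| + |β| * |g| := by
          rw [← abs_mul, ← abs_mul]; exact abs_add_le _ _
      _ ≤ C * max |f| |g| + C * max |f| |g| := by gcongr <;> simp
      _ = _ := by ring
  calc (α * f + β * g) ^ p = |α * f + β * g| ^ p := (hp.pow_abs _).symm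
    _ ≤ ((2 * C) * max |f| |g|) ^ p := by gcongr
    _ = (2 * C) ^ p * (max |f| |g|) ^ p := mul_pow _ _ _
    _ ≤ (2 * C) ^ p * (f ^ p + g ^ p) := by
        gcongr
        rcases max_cases |f| |g| with h | h
        · rw [h.1, hp.pow_abs]; exact le_add_of_nonneg_right (hp.pow_nonneg g)
        · rw [h.1, hp.pow_abs]; exact le_add_of_nonneg_left (hp.pow_nonneg f)

lemma Lpow_combination_lt {α β f g k : ℝ → ℝ → ℝ} {p : ℕ} (hp : Even p)
    (hα : ∀ t x, |α t x| ≤ C) (hβ : ∀ t x, |β t x| ≤ C) (hf : Continuous (Function.uncurry f))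
    (h : ∀ t x, k t x = α t x * f t x + β t x * g t x) (h1 : Lpow p f < ⊤) (h2 : Lpow p g < ⊤) :
    Lpow p k < ⊤ := by
  have hC := R.Cpos
  refine (Lpow_le_add hf (C := (2 * C) ^ p) (by positivity) fun t x => ?_).trans_lt
    (ENNReal.mul_lt_top ENNReal.ofReal_lt_top (ENNReal.add_lt_top.2 ⟨h1, h2⟩))
  rw [h]
  exact R.pow_combination_le (hα t x) (hβ t x) hp

lemma lpow_combination_lt {α β f g k : ℝ → ℝ} {p : ℕ} (hp : Even p)
    (hα : ∀ x, |α x| ≤ C) (hβ : ∀ x, |β x| ≤ C) (hf : Measurable f)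
    (h : ∀ x, k x = α x * f x + β x * g x) (h1 : lpow p f < ⊤) (h2 : lpow p g < ⊤) :
    lpow p k < ⊤ := by
  have hC := R.Cpos
  calc lpow p k ≤ ∫⁻ x, ENNReal.ofReal ((2 * C) ^ p) *
        (ENNReal.ofReal (f x ^ p) + ENNReal.ofReal (g x ^ p)) := by
        refine lintegral_mono fun x => ?_
        rw [← ENNReal.ofReal_add (hp.pow_nonneg _) (hp.pow_nonneg _),
          ← ENNReal.ofReal_mul (by positivity), h]
        exact ENNReal.ofReal_le_ofReal (R.pow_combination_le (hα x) (hβ x) hp)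
    _ = ENNReal.ofReal ((2 * C) ^ p) * (lpow p f + lpow p g) := by
        rw [lintegral_const_mul' _ _ ENNReal.ofReal_ne_top,
          lintegral_add_left (hf.pow_const p).ennreal_ofReal]
        rfl
    _ < ⊤ := ENNReal.mul_lt_top ENNReal.ofReal_lt_top (ENNReal.add_lt_top.2 ⟨h1, h2⟩)

lemma z_zero_lt {p : ℕ} (hp : Even p) (h1 : lpow p (vx 0) < ⊤) (h2 : lpow p (Sx 0) < ⊤) :
    lpow p (z 0) < ⊤ :=
  R.lpow_combination_lt hp (R.cζv.bdd 0) (R.cζs.bdd 0) (R.gvx.slice 0).measurable (R.z_eq 0) h1 h2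

lemma vxx_lt (t : ℝ) : lpow 2 (vxx t) < ⊤ := by
  obtain ⟨B, hB⟩ := R.bvxx t
  exact (hB t le_rfl).trans_lt ENNReal.coe_lt_top

lemma Sxx_lt (t : ℝ) : lpow 2 (Sxx t) < ⊤ := by
  obtain ⟨B, hB⟩ := R.bSxx t
  exact (hB t le_rfl).trans_lt ENNReal.coe_lt_top

lemma wx_lt (t : ℝ) : lpow 2 (wx t) < ⊤ := by
  obtain ⟨B, hB⟩ := R.bwx t
  exact (hB t le_rfl).trans_lt ENNReal.coe_lt_top

lemma uxx_lt (t : ℝ) : lpow 2 (uxx t) < ⊤ := by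
  obtain ⟨B, hB⟩ := R.buxx t
  exact (hB t le_rfl).trans_lt ENNReal.coe_lt_top

lemma vx4_lt (t : ℝ) : lpow 4 (vx t) < ⊤ :=
  lpow_four_lt_top (R.dvx t) (R.cvxx t) (R.gvx.lt_top t) (R.vxx_lt t)

lemma Sx4_lt (t : ℝ) : lpow 4 (Sx t) < ⊤ :=
  lpow_four_lt_top (R.dSx t) (R.cSxx t) (R.gSx.lt_top t) (R.Sxx_lt t)

lemma z_sq (hw : Lpow 2 w < ⊤) :
    Lpow 2 z < ⊤ ∧ ∃ X < ⊤, ∀ t ≥ 0, lpow 2 (z t) ≤ X := by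
  have hC := R.Cpos
  have h0 := R.c₀pos
  have cz := R.cz
  have key := lintegral₂_le_of_deriv_le (Y := fun t x => z t x ^ 2)
    (f := fun t x => c₀ * z t x ^ 2) (g := fun t x => C ^ 2 / c₀ * w t x ^ 2)
    (Y' := fun t x => -(2 * z t x * (c t x * z t x + e t x * w t x)))
    (by exact cz.pow 2) (by exact continuous_const.mul (cz.pow 2))
    (by exact continuous_const.mul (R.gw.cont.pow 2))
    (fun _ _ => sq_nonneg _) (fun _ _ => by positivity) (fun _ _ => by positivity)
    (fun t ht x => ((R.tz t ht x).fun_pow 2).congr_deriv (by push_cast; ring))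
    (fun t _ x => by
      have e1 := R.c_ge t x
      have e2 := sq_le_sq.2 ((R.ce.bdd t x).trans (le_abs_self C))
      have e3 : -(2 * z t x * (e t x * w t x)) ≤ c₀ * z t x ^ 2 + e t x ^ 2 / c₀ * w t x ^ 2 := by
        have : c₀ * z t x ^ 2 + e t x ^ 2 / c₀ * w t x ^ 2 + 2 * z t x * (e t x * w t x) =
          (c₀ * z t x + e t x * w t x) ^ 2 / c₀ := by field_simp; ring
        have : 0 ≤ (c₀ * z t x + e t x * w t x) ^ 2 / c₀ := by positivity
        linarith
      have e4 : e t x ^ 2 / c₀ * w t x ^ 2 ≤ C ^ 2 / c₀ * w t x ^ 2 := by gcongr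
      nlinarith [mul_le_mul_of_nonneg_right e1 (sq_nonneg (z t x))])
  have hg : LL (fun t x => C ^ 2 / c₀ * w t x ^ 2) < ⊤ := by
    rw [LL_const_mul _ (by positivity)]
    exact ENNReal.mul_lt_top ENNReal.ofReal_lt_top hw
  have hz0 := R.z_zero_lt even_two (R.gvx.lt_top 0) (R.gSx.lt_top 0)
  have hfin := ENNReal.add_lt_top.2 ⟨hz0, hg⟩
  refine ⟨?_, _, hfin, key.2⟩
  have h1 : LL (fun t x => c₀ * z t x ^ 2) < ⊤ := key.1.trans_lt hfin
  rw [LL_const_mul _ h0.le] at h1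
  exact ENNReal.lt_top_of_mul_ne_top_right h1.ne (ENNReal.ofReal_pos.2 h0).ne'

lemma w_four (hwx : Lpow 2 wx < ⊤) : Lpow 4 w < ⊤ := by
  have h : ∀ t, lpow 4 (w t) ≤ ENNReal.ofReal (9 * C ^ 2) * lpow 2 (wx t) := fun t => by
    have e1 : ∀ p, Even p → ∀ f : ℝ → ℝ, lpow p (fun x => -f x) = lpow p f := fun p hp f => by
      simp only [lpow, hp.neg_pow]
    have := lpow_four_le (R.dQ t) (fun x => (R.dw t x).neg) (R.cwx t).neg (R.Q_le t)
      ((e1 2 even_two _).trans_lt (R.gw.lt_top t)) ((e1 2 even_two _).trans_lt (R.wx_lt t))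
    rwa [e1 4 (by decide), show lpow 2 (fun x => -wx t x) = lpow 2 (wx t) from e1 2 even_two _]
      at this
  refine (lintegral_mono h).trans_lt ?_
  rw [lintegral_const_mul' _ _ ENNReal.ofReal_ne_top]
  exact ENNReal.mul_lt_top ENNReal.ofReal_lt_top hwx

lemma z_four (hw : Lpow 4 w < ⊤) : Lpow 4 z < ⊤ := by
  have hC := R.Cpos
  have h0 := R.c₀pos
  have cz := R.cz
  have key := lintegral₂_le_of_deriv_le (Y := fun t x => z t x ^ 4)
    (f := fun t x => c₀ * z t x ^ 4) (g := fun t x => C ^ 4 / c₀ ^ 3 * w t x ^ 4)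
    (Y' := fun t x => -(4 * z t x ^ 3 * (c t x * z t x + e t x * w t x)))
    (by exact cz.pow 4) (by exact continuous_const.mul (cz.pow 4))
    (by exact continuous_const.mul (R.gw.cont.pow 4))
    (fun _ _ => by positivity) (fun _ _ => by positivity) (fun _ _ => by positivity)
    (fun t ht x => ((R.tz t ht x).fun_pow 4).congr_deriv (by push_cast; ring))
    (fun t _ x => by
      have e1 := R.c_ge t x
      have e2 : e t x ^ 4 ≤ C ^ 4 := by
        have := R.ce.bdd t x
        rw [← Even.pow_abs (by decide : Even 4)]; gcongr
      have young : ∀ y w : ℝ, 4 * (-(y ^ 3 * w)) ≤ 3 * y ^ 4 + w ^ 4 := fun y w => by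
        nlinarith [mul_nonneg (sq_nonneg (y + w)) (add_nonneg (mul_nonneg zero_le_two (sq_nonneg y))
          (sq_nonneg (y - w)))]
      have e3 : -(4 * z t x ^ 3 * (e t x * w t x)) ≤
          3 * c₀ * z t x ^ 4 + e t x ^ 4 / c₀ ^ 3 * w t x ^ 4 := by
        have h := mul_le_mul_of_nonneg_left (young (z t x) (e t x * w t x / c₀)) h0.le
        have r1 : c₀ * (4 * (-(z t x ^ 3 * (e t x * w t x / c₀)))) =
          -(4 * z t x ^ 3 * (e t x * w t x)) := by field_simp
        have r2 : c₀ * (3 * z t x ^ 4 + (e t x * w t x / c₀) ^ 4) =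
          3 * c₀ * z t x ^ 4 + e t x ^ 4 / c₀ ^ 3 * w t x ^ 4 := by field_simp
        rwa [r1, r2] at h
      have e4 : e t x ^ 4 / c₀ ^ 3 * w t x ^ 4 ≤ C ^ 4 / c₀ ^ 3 * w t x ^ 4 := by gcongr
      have e5 := mul_le_mul_of_nonneg_right e1 (show 0 ≤ z t x ^ 4 by positivity)
      nlinarith)
  have hg : LL (fun t x => C ^ 4 / c₀ ^ 3 * w t x ^ 4) < ⊤ := by
    rw [LL_const_mul _ (by positivity)]
    exact ENNReal.mul_lt_top ENNReal.ofReal_lt_top hw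
  have hz0 := R.z_zero_lt (by decide : Even 4) (R.vx4_lt 0) (R.Sx4_lt 0)
  have hfin := ENNReal.add_lt_top.2 ⟨hz0, hg⟩
  have h1 : LL (fun t x => c₀ * z t x ^ 4) < ⊤ := key.1.trans_lt hfin
  rw [LL_const_mul _ h0.le] at h1
  exact ENNReal.lt_top_of_mul_ne_top_right h1.ne (ENNReal.ofReal_pos.2 h0).ne'

end Reduced

lemma LL_combination_le {f g h k : ℝ → ℝ → ℝ} {a b d : ℝ} (ha : 0 ≤ a) (hb : 0 ≤ b) (hd : 0 ≤ d)
    (hf : Continuous (Function.uncurry f)) (hg : Continuous (Function.uncurry g))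
    (hh : Continuous (Function.uncurry h)) :
    LL (fun t x => a * f t x + (b * g t x + (b * h t x + d * k t x))) ≤
      ENNReal.ofReal a * LL f + (ENNReal.ofReal b * LL g +
        (ENNReal.ofReal b * LL h + ENNReal.ofReal d * LL k)) := by
  rw [← LL_const_mul f ha, ← LL_const_mul g hb, ← LL_const_mul h hb, ← LL_const_mul k hd]
  refine (LL_add_le (by exact continuous_const.mul hf)).trans ?_
  gcongr
  refine (LL_add_le (by exact continuous_const.mul hg)).trans ?_
  gcongr
  exact LL_add_le (by exact continuous_const.mul hh)

lemma SliceBdd.dq {f : ℝ → ℝ → ℝ} (hf : SliceBdd f) (hc : ∀ t, Continuous (f t)) (h : ℝ) :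
    SliceBdd fun t => dq h (f t) := by
  have hs : SliceBdd fun t x => f t (x + h) := fun T => by
    obtain ⟨B, hB⟩ := hf T
    exact ⟨B, fun t ht => (lpow_shift 2 (f t) h).le.trans (hB t ht)⟩
  refine hs.of_le hf (2 * (1 / h ^ 2)).toNNReal
    (fun t => ((hc t).comp (continuous_id.add continuous_const)).measurable) fun t x => ?_
  rw [Real.coe_toNNReal _ (by positivity)]
  simp only [_root_.dq, div_pow]
  rw [mul_comm (2 : ℝ), mul_assoc, one_div, div_eq_inv_mul]
  gcongr
  nlinarith [sq_nonneg (f t (x + h) + f t x)]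

namespace Reduced

variable {v u S vx ux Sx w vxx uxx Sxx wx z Q αv βv αs βs ζv ζs c e K :
    ℝ → ℝ → ℝ} {τ C c₀ : ℝ}
  (R : Reduced v u S vx ux Sx w vxx uxx Sxx wx z Q αv βv αs βs ζv ζs c e K τ C c₀)
include R

lemma wavePair : WavePair u Q ux (fun t x => -w t x) w
    (fun t x => -K t x * ux t x + S t x / τ) uxx (fun t x => -wx t x) where
  gU := R.gu
  gQ := R.gQ
  gUx := R.gux
  gQx := R.gw.neg
  gUt := R.gw
  gQt := by
    have h1 := (R.gux.mul_bdd R.cK.cont C R.cK.bdd).neg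
    have h2 := R.gS.mul_bdd (c := fun _ _ => 1 / τ) continuous_const |1 / τ| fun _ _ => le_rfl
    have h3 := h1.add h2
    refine ⟨h3.cont.congr fun q => ?_, ?_⟩
    · simp only [Function.uncurry]; ring
    · convert h3.bdd using 3; ring
  dUx := R.du
  dQx := R.dQ
  dUt := R.tu
  dQt := R.tQ
  eq _ _ := (neg_neg _).symm
  dUxx := R.dux
  dQxx t x := (R.dw t x).neg
  cUxx := R.cuxx
  cQxx t := (R.cwx t).neg
  bUxx := R.buxx
  bQxx T := by
    obtain ⟨B, hB⟩ := R.bwx T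
    exact ⟨B, fun t ht => by simpa only [lpow, even_two.neg_pow] using hB t ht⟩

lemma wavePair_dq (k : ℝ) : WavePair (fun t => dq k (u t)) (fun t => dq k (Q t))
    (fun t => dq k (ux t)) (fun t => dq k fun x => -w t x) (fun t => dq k (w t))
    (fun t => dq k fun x => -K t x * ux t x + S t x / τ) (fun t => dq k (uxx t))
    (fun t => dq k fun x => -wx t x) := by
  have P := R.wavePair
  exact
  { gU := P.gU.dq k
    gQ := P.gQ.dq k
    gUx := P.gUx.dq k
    gQx := P.gQx.dq k
    gUt := P.gUt.dq k
    gQt := P.gQt.dq k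
    dUx := fun t x => (HasDerivAt.dq_space (P.dUx t) k x)
    dQx := fun t x => (HasDerivAt.dq_space (P.dQx t) k x)
    dUt := fun t ht x => (HasDerivAt.dq_time (P.dUt t ht) k x)
    dQt := fun t ht x => HasDerivAt.dq_time
      (f' := fun t x => -K t x * ux t x + S t x / τ) (P.dQt t ht) k x
    eq := fun t x => by simp only [dq]; ring
    dUxx := fun t x => (HasDerivAt.dq_space (P.dUxx t) k x)
    dQxx := fun t x => (HasDerivAt.dq_space (P.dQxx t) k x)
    cUxx := fun t => (((P.cUxx t).comp (continuous_id.add continuous_const)).sub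
      (P.cUxx t)).div_const k
    cQxx := fun t => (((P.cQxx t).comp (continuous_id.add continuous_const)).sub
      (P.cQxx t)).div_const k
    bUxx := P.bUxx.dq P.cUxx k
    bQxx := P.bQxx.dq P.cQxx k }

lemma w_lt (hux : Lpow 2 ux < ⊤) : Lpow 2 w < ⊤ := by
  have hC := R.Cpos
  obtain ⟨Bd, hBd⟩ := R.u_le
  have cux := R.gux.cont
  have cS := R.gS.cont
  have cw := R.gw.cont
  refine (R.wavePair.lintegral_le (σ := 1) (Or.inl rfl) hBd (A := fun t x => w t x ^ 2)
    (D := fun t x => (C + 1) * ux t x ^ 2 + 1 / τ ^ 2 * S t x ^ 2) (by exact cw.pow 2)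
    (by exact (continuous_const.mul (cux.pow 2)).add (continuous_const.mul (cS.pow 2)))
    (fun _ _ => sq_nonneg _) (fun _ _ => by positivity) fun t x => ?_).trans_lt ?_
  · have h1 := (abs_le.1 (R.cK.bdd t x)).2
    have h2 := mul_le_mul_of_nonneg_right h1 (sq_nonneg (ux t x))
    have h3 : 1 / τ ^ 2 * S t x ^ 2 = (S t x / τ) ^ 2 := by ring
    rw [h3]
    nlinarith [sq_nonneg (ux t x + S t x / τ), sq_nonneg (ux t x), sq_nonneg (S t x / τ)]
  · refine ENNReal.add_lt_top.2 ⟨ENNReal.add_lt_top.2 ⟨ENNReal.add_lt_top.2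
      ⟨R.gux.lt_top 0, R.gQ.lt_top 0⟩, by simp⟩, ?_⟩
    refine (LL_add_le (by exact continuous_const.mul (cux.pow 2))).trans_lt ?_
    rw [LL_const_mul _ (by positivity), LL_const_mul _ (by positivity)]
    exact ENNReal.add_lt_top.2 ⟨ENNReal.mul_lt_top ENNReal.ofReal_lt_top hux,
      ENNReal.mul_lt_top ENNReal.ofReal_lt_top R.S_lt⟩

lemma ux_lt (hw : Lpow 2 w < ⊤) : Lpow 2 ux < ⊤ := by
  have h0 := R.c₀pos
  obtain ⟨Bd, hBd⟩ := R.u_le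
  have cux := R.gux.cont
  have cS := R.gS.cont
  have cw := R.gw.cont
  have key := (R.wavePair.lintegral_le (σ := -1) (Or.inr rfl) hBd
    (A := fun t x => c₀ / 2 * ux t x ^ 2)
    (D := fun t x => w t x ^ 2 + 1 / (c₀ * τ ^ 2) * S t x ^ 2)
    (by exact continuous_const.mul (cux.pow 2))
    (by exact (cw.pow 2).add (continuous_const.mul (cS.pow 2)))
    (fun _ _ => by positivity) (fun _ _ => by positivity) fun t x => ?_).trans_lt
    (c := ⊤) ?_
  · change LL _ < ⊤ at key
    rw [LL_const_mul _ (by positivity)] at key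
    exact ENNReal.lt_top_of_mul_ne_top_right key.ne (ENNReal.ofReal_pos.2 (half_pos h0)).ne'
  · have h1 := R.K_ge t x
    have h2 := mul_le_mul_of_nonneg_right h1 (sq_nonneg (ux t x))
    have h3 : 1 / (c₀ * τ ^ 2) * S t x ^ 2 = (S t x / τ) ^ 2 / c₀ := by field_simp
    have h4 : 0 ≤ (c₀ * ux t x - S t x / τ) ^ 2 / c₀ := by positivity
    have h5 : (c₀ * ux t x - S t x / τ) ^ 2 / c₀ = c₀ * ux t x ^ 2 - 2 * (ux t x * (S t x / τ)) +
      (S t x / τ) ^ 2 / c₀ := by field_simp; ring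
    have h6 : 0 ≤ (S t x / τ) ^ 2 / c₀ := by positivity
    rw [h3]
    nlinarith
  · refine ENNReal.add_lt_top.2 ⟨ENNReal.add_lt_top.2 ⟨ENNReal.add_lt_top.2
      ⟨R.gux.lt_top 0, R.gQ.lt_top 0⟩, by simp⟩, ?_⟩
    refine (LL_add_le (by exact cw.pow 2)).trans_lt ?_
    rw [LL_const_mul _ (by positivity)]
    exact ENNReal.add_lt_top.2 ⟨hw, ENNReal.mul_lt_top ENNReal.ofReal_lt_top R.S_lt⟩

lemma lpow_u_dq_le {k Bd : ℝ} (hk : 0 < k) (hBd : ∀ t ≥ 0, ∫ x, u t x ^ 2 ≤ Bd) {t : ℝ}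
    (ht : 0 ≤ t) : ∫ x, dq k (u t) x ^ 2 ≤ 4 / k ^ 2 * Bd := by
  have i1 := integrable_sq_of_lpow (R.gu.slice t) (R.gu.lt_top t)
  have i2 := i1.comp_add_right k
  calc ∫ x, dq k (u t) x ^ 2 ≤ ∫ x, 2 / k ^ 2 * (u t (x + k) ^ 2 + u t x ^ 2) := by
        refine integral_mono (integrable_sq_of_lpow ((R.gu.dq k).slice t) ((R.gu.dq k).lt_top t))
          ((i2.add i1).const_mul _) fun x => ?_
        simp only [dq, div_pow]
        rw [div_mul_eq_mul_div]
        gcongr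
        nlinarith [sq_nonneg (u t (x + k) + u t x)]
    _ = 2 / k ^ 2 * ((∫ x, u t x ^ 2) + ∫ x, u t x ^ 2) := by
        rw [MeasureTheory.integral_const_mul, MeasureTheory.integral_add i2 i1,
          integral_add_right_eq_self fun x => u t x ^ 2]
    _ ≤ 2 / k ^ 2 * (Bd + Bd) := by gcongr <;> exact hBd t ht
    _ = _ := by ring

lemma sq_dq_K_mul_le (k t x : ℝ) : (dq k (K t) x * ux t (x + k)) ^ 2 ≤
    2 * C ^ 2 * (dq k (v t) x ^ 2 * ux t (x + k) ^ 2 + dq k (S t) x ^ 2 * ux t (x + k) ^ 2) := by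
  have hC := R.Cpos
  have h1 := R.cK.dq k t x
  have h2 : dq k (K t) x ^ 2 ≤ (C * (|dq k (v t) x| + |dq k (S t) x|)) ^ 2 := by
    rw [← sq_abs]; gcongr
  have h3 : (C * (|dq k (v t) x| + |dq k (S t) x|)) ^ 2 ≤
      2 * C ^ 2 * (dq k (v t) x ^ 2 + dq k (S t) x ^ 2) := by
    rw [← sq_abs (dq k (v t) x), ← sq_abs (dq k (S t) x), mul_pow, mul_comm (2 : ℝ), mul_assoc]
    gcongr
    nlinarith [sq_nonneg (|dq k (v t) x| - |dq k (S t) x|)]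
  rw [mul_pow, ← add_mul, ← mul_assoc]
  exact mul_le_mul_of_nonneg_right (h2.trans h3) (sq_nonneg _)

omit R in
lemma dq_Qt (k t x : ℝ) : dq k (fun x => -K t x * ux t x + S t x / τ) x =
    -K t x * dq k (ux t) x - dq k (K t) x * ux t (x + k) + dq k (S t) x / τ := by
  simp only [dq, div_eq_mul_inv]; ring

lemma dq_initial_lt : ∀ k > 0, lpow 2 (dq k (ux 0)) + lpow 2 (dq k (Q 0)) + 1 ≤
    lpow 2 (uxx 0) + lpow 2 (w 0) + 1 := fun k hk => by
  have h := lpow_dq_le (R.dQ 0) (R.gw.slice 0).neg hk.ne' even_two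
  have e : lpow 2 (fun x => -w 0 x) = lpow 2 (w 0) := by simp only [lpow, even_two.neg_pow]
  gcongr
  · exact lpow_dq_le (R.dux 0) (R.cuxx 0) hk.ne' even_two
  · exact h.trans e.le

lemma wx_lt_of_uxx {X : ENNReal} (hX : X < ⊤) (hv : ∀ t > 0, lpow 2 (vx t) ≤ X)
    (hS : ∀ t > 0, lpow 2 (Sx t) ≤ X) (hSx : Lpow 2 Sx < ⊤) (hux : Lpow 2 ux < ⊤)
    (huxx : Lpow 2 uxx < ⊤) : Lpow 2 wx < ⊤ := by
  have hC := R.Cpos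
  obtain ⟨Bd, hBd⟩ := R.u_le
  have hX1 : X + 1 < ⊤ := ENNReal.add_lt_top.2 ⟨hX, by simp⟩
  set G : ENNReal := (X + 1) * (2 * Lpow 2 ux + Lpow 2 uxx) with hG
  have hGlt : G < ⊤ := ENNReal.mul_lt_top hX1 (ENNReal.add_lt_top.2
    ⟨ENNReal.mul_lt_top (by simp) hux, huxx⟩)
  have bound := fun (k : ℝ) (hk : 0 < k) => by
    have cuxk : Continuous (Function.uncurry fun t x => ux t (x + k)) := (R.gux.shift k).cont
    have cdu := R.gux.cont.uncurry_dq k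
    have cdv := R.cv.uncurry_dq k
    have cdS := R.gS.cont.uncurry_dq k
    have cdw := R.gw.cont.uncurry_dq k
    have e1 : Lpow 2 (fun t x => ux t (x + k)) = Lpow 2 ux := Lpow_shift 2 ux k
    have e2 : Lpow 2 (fun t x => uxx t (x + k)) = Lpow 2 uxx := Lpow_shift 2 uxx k
    have prod := fun (f fx : ℝ → ℝ → ℝ) (df : ∀ t x, HasDerivAt (f t) (fx t x) x)
        (cf : ∀ t, Continuous (fx t)) (hf : ∀ t > 0, lpow 2 (fx t) ≤ X) => by
      have := LL_sq_mul_sq_le (f := fun t => dq k (f t)) (g := fun t x => ux t (x + k))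
        (g' := fun t x => uxx t (x + k)) (fun t x => (R.dux t (x + k)).comp_add_const x k)
        (fun t => (R.cuxx t).comp (continuous_id.add continuous_const)) cuxk
        (X := X + 1) (by simp) hX1
        (fun t ht => ((lpow_dq_le (df t) (cf t) hk.ne' even_two).trans (hf t ht)).trans
          le_self_add)
      rwa [e1, e2] at this
    have pv := prod v vx R.dv R.gvx.slice hv
    have pS := prod S Sx R.dS R.gSx.slice hS
    have key := (R.wavePair_dq k).lintegral_le (σ := 1) (Or.inl rfl)
      (fun t ht => R.lpow_u_dq_le hk hBd ht)
      (A := fun t x => dq k (w t) x ^ 2)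
      (D := fun t x => (C + 2) * dq k (ux t) x ^ 2 + (2 * C ^ 2 * (dq k (v t) x ^ 2 *
        ux t (x + k) ^ 2) + (2 * C ^ 2 * (dq k (S t) x ^ 2 * ux t (x + k) ^ 2) +
        1 / τ ^ 2 * dq k (S t) x ^ 2))) (by exact cdw.pow 2)
      (by
        exact (continuous_const.mul (cdu.pow 2)).add ((continuous_const.mul
          ((cdv.pow 2).mul (cuxk.pow 2))).add ((continuous_const.mul
          ((cdS.pow 2).mul (cuxk.pow 2))).add (continuous_const.mul (cdS.pow 2)))))
      (fun _ _ => sq_nonneg _) (fun _ _ => by positivity)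
      (fun t x => by
        have h1 := (abs_le.1 (R.cK.bdd t x)).2
        have h2 := mul_le_mul_of_nonneg_right h1 (sq_nonneg (dq k (ux t) x))
        have h3 : 1 / τ ^ 2 * dq k (S t) x ^ 2 = (dq k (S t) x / τ) ^ 2 := by ring
        have h4 := R.sq_dq_K_mul_le k t x
        have h5 : dq k (fun x => -w t x) x = -dq k (w t) x := by simp only [dq]; ring
        rw [h3, dq_Qt, h5]
        nlinarith [sq_nonneg (dq k (ux t) x + dq k (S t) x / τ),
          sq_nonneg (dq k (ux t) x - dq k (K t) x * ux t (x + k)),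
          sq_nonneg (dq k (ux t) x), sq_nonneg (dq k (S t) x / τ),
          sq_nonneg (dq k (K t) x * ux t (x + k))])
    calc Lpow 2 (fun t => dq k (w t)) ≤ _ := key
      _ ≤ (lpow 2 (uxx 0) + lpow 2 (w 0) + 1) + (ENNReal.ofReal (C + 2) * Lpow 2 uxx +
          (ENNReal.ofReal (2 * C ^ 2) * G + (ENNReal.ofReal (2 * C ^ 2) * G +
            ENNReal.ofReal (1 / τ ^ 2) * Lpow 2 Sx))) := by
          refine add_le_add (R.dq_initial_lt k hk) ?_
          refine (LL_combination_le (by positivity) (by positivity) (by positivity)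
            (by exact cdu.pow 2) (by exact (cdv.pow 2).mul (cuxk.pow 2))
            (by exact (cdS.pow 2).mul (cuxk.pow 2))).trans ?_
          gcongr
          · exact Lpow_dq_le R.dux R.cuxx hk.ne' even_two
          · exact Lpow_dq_le R.dS R.gSx.slice hk.ne' even_two
  refine (Lpow_le_of_dq R.dw R.gw.cont.measurable 2 bound).trans_lt ?_
  have hm : ∀ (r : ℝ) {Y : ENNReal}, Y < ⊤ → ENNReal.ofReal r * Y < ⊤ := fun r Y hY =>
    ENNReal.mul_lt_top ENNReal.ofReal_lt_top hY
  simp only [ENNReal.add_lt_top]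
  exact ⟨⟨⟨R.uxx_lt 0, R.gw.lt_top 0⟩, by simp⟩, hm _ huxx, hm _ hGlt, hm _ hGlt, hm _ hSx⟩

lemma uxx_lt_of_wx {X : ENNReal} (hX : X < ⊤) (hu : ∀ t > 0, lpow 2 (ux t) ≤ X)
    (hvx : Lpow 2 vx < ⊤) (hvxx : Lpow 2 vxx < ⊤) (hSx : Lpow 2 Sx < ⊤) (hSxx : Lpow 2 Sxx < ⊤)
    (hwx : Lpow 2 wx < ⊤) : Lpow 2 uxx < ⊤ := by
  have hC := R.Cpos
  have h0 := R.c₀pos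
  obtain ⟨Bd, hBd⟩ := R.u_le
  have hX1 : X + 1 < ⊤ := ENNReal.add_lt_top.2 ⟨hX, by simp⟩
  have bound := fun (k : ℝ) (hk : 0 < k) => by
    have cuxk : Continuous (Function.uncurry fun t x => ux t (x + k)) := (R.gux.shift k).cont
    have cdu := R.gux.cont.uncurry_dq k
    have cdv := R.cv.uncurry_dq k
    have cdS := R.gS.cont.uncurry_dq k
    have cdw := R.gw.cont.uncurry_dq k
    have prod := fun (f fx fxx : ℝ → ℝ → ℝ) (df : ∀ t x, HasDerivAt (f t) (fx t x) x)
        (cf : ∀ t, Continuous (fx t)) (dfx : ∀ t x, HasDerivAt (fx t) (fxx t x) x)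
        (cfx : ∀ t, Continuous (fxx t)) (cdf : Continuous (Function.uncurry fun t => dq k (f t))) =>
      show LL (fun t x => dq k (f t) x ^ 2 * ux t (x + k) ^ 2) ≤
          (X + 1) * (2 * Lpow 2 fx + Lpow 2 fxx) by
        have := LL_sq_mul_sq_le (f := fun t x => ux t (x + k)) (g := fun t => dq k (f t))
          (g' := fun t => dq k (fx t)) (fun t x => HasDerivAt.dq_space (df t) k x)
          (fun t => (((cf t).comp (continuous_id.add continuous_const)).sub (cf t)).div_const k)
          cdf (X := X + 1) (by simp) hX1
          (fun t ht => ((lpow_shift 2 (ux t) k).le.trans (hu t ht)).trans le_self_add)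
        simp only [mul_comm (ux _ _ ^ 2)] at this
        refine this.trans ?_
        gcongr
        · exact Lpow_dq_le df cf hk.ne' even_two
        · exact Lpow_dq_le dfx cfx hk.ne' even_two
    have pv := prod v vx vxx R.dv R.gvx.slice R.dvx R.cvxx cdv
    have pS := prod S Sx Sxx R.dS R.gSx.slice R.dSx R.cSxx cdS
    have key := (R.wavePair_dq k).lintegral_le (σ := -1) (Or.inr rfl)
      (fun t ht => R.lpow_u_dq_le hk hBd ht)
      (A := fun t x => c₀ / 2 * dq k (ux t) x ^ 2)
      (D := fun t x => 1 * dq k (w t) x ^ 2 + (2 * C ^ 2 / c₀ * (dq k (v t) x ^ 2 *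
        ux t (x + k) ^ 2) + (2 * C ^ 2 / c₀ * (dq k (S t) x ^ 2 * ux t (x + k) ^ 2) +
        1 / (c₀ * τ ^ 2) * dq k (S t) x ^ 2))) (by exact continuous_const.mul (cdu.pow 2))
      (by
        exact (continuous_const.mul (cdw.pow 2)).add ((continuous_const.mul
          ((cdv.pow 2).mul (cuxk.pow 2))).add ((continuous_const.mul
          ((cdS.pow 2).mul (cuxk.pow 2))).add (continuous_const.mul (cdS.pow 2)))))
      (fun _ _ => by positivity) (fun _ _ => by positivity)
      (fun t x => by
        have h2 := mul_le_mul_of_nonneg_right (R.K_ge t x) (sq_nonneg (dq k (ux t) x))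
        have h4 := R.sq_dq_K_mul_le k t x
        have h5 : dq k (fun x => -w t x) x = -dq k (w t) x := by simp only [dq]; ring
        rw [dq_Qt, h5]
        set p := dq k (ux t) x
        set q := dq k (K t) x * ux t (x + k)
        set s := dq k (S t) x
        have h6 : 0 ≤ (c₀ * p + (q - s / τ)) ^ 2 / c₀ := by positivity
        have h7 : (c₀ * p + (q - s / τ)) ^ 2 / c₀ = c₀ * p ^ 2 + 2 * (p * (q - s / τ)) +
          (q - s / τ) ^ 2 / c₀ := by field_simp; ring
        have h8 : (q - s / τ) ^ 2 / c₀ ≤ (2 * (2 * C ^ 2 * (dq k (v t) x ^ 2 *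
            ux t (x + k) ^ 2 + s ^ 2 * ux t (x + k) ^ 2)) + 2 * (s / τ) ^ 2) / c₀ := by
          gcongr
          nlinarith [sq_nonneg (q + s / τ)]
        have h9 : (2 * (2 * C ^ 2 * (dq k (v t) x ^ 2 *
            ux t (x + k) ^ 2 + s ^ 2 * ux t (x + k) ^ 2)) + 2 * (s / τ) ^ 2) / c₀ =
            2 * (2 * C ^ 2 / c₀ * (dq k (v t) x ^ 2 * ux t (x + k) ^ 2) +
              (2 * C ^ 2 / c₀ * (s ^ 2 * ux t (x + k) ^ 2) + 1 / (c₀ * τ ^ 2) * s ^ 2)) := by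
          have := R.τpos.ne'
          field_simp
          ring
        nlinarith)
    calc ENNReal.ofReal (c₀ / 2) * Lpow 2 (fun t => dq k (ux t)) =
          LL (fun t x => c₀ / 2 * dq k (ux t) x ^ 2) := (LL_const_mul _ (by positivity)).symm
      _ ≤ _ := key
      _ ≤ (lpow 2 (uxx 0) + lpow 2 (w 0) + 1) + (ENNReal.ofReal 1 * Lpow 2 wx +
          (ENNReal.ofReal (2 * C ^ 2 / c₀) * ((X + 1) * (2 * Lpow 2 vx + Lpow 2 vxx)) +
          (ENNReal.ofReal (2 * C ^ 2 / c₀) * ((X + 1) * (2 * Lpow 2 Sx + Lpow 2 Sxx)) +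
            ENNReal.ofReal (1 / (c₀ * τ ^ 2)) * Lpow 2 Sx))) := by
          refine add_le_add (R.dq_initial_lt k hk) ?_
          refine (LL_combination_le (by positivity) (by positivity) (by positivity)
            (by exact cdw.pow 2) (by exact (cdv.pow 2).mul (cuxk.pow 2))
            (by exact (cdS.pow 2).mul (cuxk.pow 2))).trans ?_
          gcongr
          · exact Lpow_dq_le R.dw R.cwx hk.ne' even_two
          · exact Lpow_dq_le R.dS R.gSx.slice hk.ne' even_two
  have hm : ∀ {Y Z : ENNReal}, Y < ⊤ → Z < ⊤ → Y * Z < ⊤ := ENNReal.mul_lt_top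
  have hr : ∀ r : ℝ, ENNReal.ofReal r < ⊤ := fun _ => ENNReal.ofReal_lt_top
  have hpos : ENNReal.ofReal (c₀ / 2) ≠ 0 := (ENNReal.ofReal_pos.2 (half_pos h0)).ne'
  refine (Lpow_le_of_dq R.dux R.gux.cont.measurable 2 fun k hk =>
    (ENNReal.le_div_iff_mul_le (Or.inl hpos) (Or.inl (hr _).ne)).2
      ((mul_comm _ _).le.trans (bound k hk))).trans_lt ?_
  refine ENNReal.div_lt_top (LT.lt.ne ?_) hpos
  simp only [ENNReal.add_lt_top]
  have h2 : (2 : ENNReal) < ⊤ := by simp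
  exact ⟨⟨⟨R.uxx_lt 0, R.gw.lt_top 0⟩, by simp⟩, hm (hr _) hwx,
    hm (hr _) (hm hX1 (ENNReal.add_lt_top.2 ⟨hm h2 hvx, hvxx⟩)),
    hm (hr _) (hm hX1 (ENNReal.add_lt_top.2 ⟨hm h2 hSx, hSxx⟩)), hm (hr _) hSx⟩

end Reduced

lemma lintegral_ofReal_add_le {f g : ℝ → ℝ} (hf : Measurable f) :
    ∫⁻ x, ENNReal.ofReal (f x + g x) ≤
      (∫⁻ x, ENNReal.ofReal (f x)) + ∫⁻ x, ENNReal.ofReal (g x) := by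
  rw [← lintegral_add_left hf.ennreal_ofReal]
  exact lintegral_mono fun x => ENNReal.ofReal_add_le

lemma continuous_dq {f : ℝ → ℝ} (hf : Continuous f) (h : ℝ) : Continuous (dq h f) :=
  ((hf.comp (continuous_id.add continuous_const)).sub hf).div_const h

namespace Reduced

variable {v u S vx ux Sx w vxx uxx Sxx wx z Q αv βv αs βs ζv ζs c e K :
    ℝ → ℝ → ℝ} {τ C c₀ : ℝ}
  (R : Reduced v u S vx ux Sx w vxx uxx Sxx wx z Q αv βv αs βs ζv ζs c e K τ C c₀)
include R

/-- The remainder in the expansion of `dq h (α f + β g)`. -/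
def rem (v S f g : ℝ → ℝ → ℝ) (h t x : ℝ) : ℝ :=
  dq h (g t) x ^ 2 + (dq h (v t) x ^ 4 + (dq h (S t) x ^ 4 + (f t (x + h) ^ 4 + g t (x + h) ^ 4)))

omit R in
lemma rem_nonneg (v S f g : ℝ → ℝ → ℝ) (h t x : ℝ) : 0 ≤ rem v S f g h t x := by
  simp only [rem]; positivity

lemma continuous_rem {f g : ℝ → ℝ → ℝ} (hf : Continuous (Function.uncurry f))
    (hg : Continuous (Function.uncurry g)) (h : ℝ) :
    Continuous (Function.uncurry (rem v S f g h)) := by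
  have hs : ∀ {f : ℝ → ℝ → ℝ}, Continuous (Function.uncurry f) →
      Continuous (Function.uncurry fun t x => f t (x + h)) := fun hf =>
    hf.comp (continuous_fst.prodMk (continuous_snd.add continuous_const))
  exact ((hg.uncurry_dq h).pow 2).add (((R.cv.uncurry_dq h).pow 4).add
    (((R.gS.cont.uncurry_dq h).pow 4).add (((hs hf).pow 4).add ((hs hg).pow 4))))

lemma LL_rem_le {f g gx : ℝ → ℝ → ℝ} (hf : Continuous (Function.uncurry f))
    (hg : Continuous (Function.uncurry g)) (dg : ∀ t x, HasDerivAt (g t) (gx t x) x)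
    (cg : ∀ t, Continuous (gx t)) {h : ℝ} (hh : h ≠ 0) :
    LL (rem v S f g h) ≤ Lpow 2 gx + (Lpow 4 vx + (Lpow 4 Sx + (Lpow 4 f + Lpow 4 g))) := by
  have e4 : Even 4 := by decide
  refine (LL_add_le (by exact (hg.uncurry_dq h).pow 2)).trans ?_
  refine add_le_add (Lpow_dq_le dg cg hh even_two) ?_
  refine (LL_add_le (by exact (R.cv.uncurry_dq h).pow 4)).trans ?_
  refine add_le_add (Lpow_dq_le R.dv R.gvx.slice hh e4) ?_
  refine (LL_add_le (by exact (R.gS.cont.uncurry_dq h).pow 4)).trans ?_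
  refine add_le_add (Lpow_dq_le R.dS R.gSx.slice hh e4) ?_
  refine (LL_add_le (by
    exact (hf.comp (continuous_fst.prodMk (continuous_snd.add continuous_const))).pow 4)).trans ?_
  exact add_le_add (Lpow_shift 4 f h).le (Lpow_shift 4 g h).le

lemma lintegral_rem_le {f g gx : ℝ → ℝ → ℝ} (t : ℝ) (hf : Continuous (f t))
    (hg : Continuous (g t)) (dg : ∀ x, HasDerivAt (g t) (gx t x) x)
    (cg : Continuous (gx t)) {h : ℝ} (hh : h ≠ 0) :
    ∫⁻ x, ENNReal.ofReal (rem v S f g h t x) ≤ lpow 2 (gx t) + (lpow 4 (vx t) +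
      (lpow 4 (Sx t) + (lpow 4 (f t) + lpow 4 (g t)))) := by
  have e4 : Even 4 := by decide
  have cv := continuous_slice_right R.cv t
  refine (lintegral_ofReal_add_le (by exact ((continuous_dq hg h).pow 2).measurable)).trans ?_
  refine add_le_add (lpow_dq_le dg cg hh even_two) ?_
  refine (lintegral_ofReal_add_le (by exact ((continuous_dq cv h).pow 4).measurable)).trans ?_
  refine add_le_add (lpow_dq_le (R.dv t) (R.gvx.slice t) hh e4) ?_
  refine (lintegral_ofReal_add_le
    (by exact ((continuous_dq (R.gS.slice t) h).pow 4).measurable)).trans ?_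
  refine add_le_add (lpow_dq_le (R.dS t) (R.gSx.slice t) hh e4) ?_
  refine (lintegral_ofReal_add_le (by
    exact ((hf.comp (continuous_id.add continuous_const)).pow 4).measurable)).trans ?_
  exact add_le_add (lpow_shift 4 (f t) h).le (lpow_shift 4 (g t) h).le

lemma dq_combination_sq_le {α β f g y : ℝ → ℝ → ℝ} (hα : Coeff v S α C) (hβ : Coeff v S β C)
    (hy : ∀ t x, y t x = α t x * f t x + β t x * g t x) (h t x : ℝ) :
    dq h (y t) x ^ 2 ≤ 16 * C ^ 2 * (dq h (f t) x ^ 2 + rem v S f g h t x) := by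
  have hC := R.Cpos
  obtain ⟨r, hr, hr2⟩ := hα.dq_combination hβ h t x (z := f) (w := g)
  rw [show y t = fun x => α t x * f t x + β t x * g t x from funext (hy t), hr]
  have h1 : (α t x * dq h (f t) x) ^ 2 ≤ C ^ 2 * dq h (f t) x ^ 2 := by
    rw [mul_pow]; gcongr ?_ * _
    exact sq_le_sq.2 ((hα.bdd t x).trans (le_abs_self C))
  change r ^ 2 ≤ 8 * C ^ 2 * rem v S f g h t x at hr2
  have h2 := mul_nonneg (sq_nonneg C) (sq_nonneg (dq h (f t) x))
  nlinarith [sq_nonneg (α t x * dq h (f t) x - r)]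

lemma lpow_dq_combination_le {α β f g y fx gx : ℝ → ℝ → ℝ} (hα : Coeff v S α C)
    (hβ : Coeff v S β C) (hy : ∀ t x, y t x = α t x * f t x + β t x * g t x) (t : ℝ)
    (hf : Continuous (f t)) (hg : Continuous (g t)) (df : ∀ x, HasDerivAt (f t) (fx t x) x)
    (cf : Continuous (fx t)) (dg : ∀ x, HasDerivAt (g t) (gx t x) x) (cg : Continuous (gx t))
    {h : ℝ} (hh : h ≠ 0) :
    lpow 2 (dq h (y t)) ≤ ENNReal.ofReal (16 * C ^ 2) * (lpow 2 (fx t) + (lpow 2 (gx t) +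
      (lpow 4 (vx t) + (lpow 4 (Sx t) + (lpow 4 (f t) + lpow 4 (g t)))))) := by
  calc lpow 2 (dq h (y t)) ≤ ∫⁻ x, ENNReal.ofReal (16 * C ^ 2) *
        ENNReal.ofReal (dq h (f t) x ^ 2 + rem v S f g h t x) := by
        refine lintegral_mono fun x => ?_
        rw [← ENNReal.ofReal_mul (by positivity)]
        exact ENNReal.ofReal_le_ofReal (R.dq_combination_sq_le hα hβ hy h t x)
    _ ≤ _ := by
        rw [lintegral_const_mul' _ _ ENNReal.ofReal_ne_top]
        gcongr
        refine (lintegral_ofReal_add_le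
          (by exact ((continuous_dq hf h).pow 2).measurable)).trans ?_
        exact add_le_add (lpow_dq_le df cf hh even_two) (R.lintegral_rem_le t hf hg dg cg hh)

lemma Lpow_dq_combination_le {α β f g y gx : ℝ → ℝ → ℝ} (hα : Coeff v S α C)
    (hβ : Coeff v S β C) (hy : ∀ t x, y t x = α t x * f t x + β t x * g t x)
    (hf : Continuous (Function.uncurry f)) (hg : Continuous (Function.uncurry g))
    (dg : ∀ t x, HasDerivAt (g t) (gx t x) x) (cg : ∀ t, Continuous (gx t))
    {h : ℝ} (hh : h ≠ 0) :
    Lpow 2 (fun t => dq h (y t)) ≤ ENNReal.ofReal (16 * C ^ 2) * (Lpow 2 (fun t => dq h (f t)) +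
      (Lpow 2 gx + (Lpow 4 vx + (Lpow 4 Sx + (Lpow 4 f + Lpow 4 g))))) := by
  calc Lpow 2 (fun t => dq h (y t))
      ≤ LL fun t x => 16 * C ^ 2 * (dq h (f t) x ^ 2 + rem v S f g h t x) :=
        LL_mono fun t x => R.dq_combination_sq_le hα hβ hy h t x
    _ ≤ _ := by
        rw [LL_const_mul _ (by positivity)]
        gcongr
        exact (LL_add_le (by exact (hf.uncurry_dq h).pow 2)).trans
          (add_le_add le_rfl (R.LL_rem_le hf hg dg cg hh))

lemma exists_dq_z_le (h_wx : Lpow 2 wx < ⊤) (hz4 : Lpow 4 z < ⊤) (hw4 : Lpow 4 w < ⊤)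
    (hv4 : Lpow 4 vx < ⊤) (hS4 : Lpow 4 Sx < ⊤) :
    ∃ X < ⊤, ∀ k > 0, Lpow 2 (fun t => dq k (z t)) ≤ X := by
  have hC := R.Cpos
  have h0 := R.c₀pos
  have cz := R.cz
  have hm : ∀ {Y Z : ENNReal}, Y < ⊤ → Z < ⊤ → Y * Z < ⊤ := ENNReal.mul_lt_top
  have hr : ∀ r : ℝ, ENNReal.ofReal r < ⊤ := fun _ => ENNReal.ofReal_lt_top
  have hpos : ENNReal.ofReal c₀ ≠ 0 := (ENNReal.ofReal_pos.2 h0).ne'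
  refine ⟨(ENNReal.ofReal (16 * C ^ 2) * (lpow 2 (vxx 0) + (lpow 2 (Sxx 0) +
    (lpow 4 (vx 0) + (lpow 4 (Sx 0) + (lpow 4 (vx 0) + lpow 4 (Sx 0)))))) +
    ENNReal.ofReal (8 * C ^ 2 / c₀) * (Lpow 2 wx + (Lpow 4 vx + (Lpow 4 Sx +
    (Lpow 4 z + Lpow 4 w))))) / ENNReal.ofReal c₀, ?_, fun k hk => ?_⟩
  · refine ENNReal.div_lt_top (LT.lt.ne ?_) hpos
    refine ENNReal.add_lt_top.2 ⟨hm (hr _) ?_, hm (hr _) ?_⟩ <;> simp only [ENNReal.add_lt_top]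
    · exact ⟨R.vxx_lt 0, R.Sxx_lt 0, R.vx4_lt 0, R.Sx4_lt 0, R.vx4_lt 0, R.Sx4_lt 0⟩
    · exact ⟨h_wx, hv4, hS4, hz4, hw4⟩
  have cdz := cz.uncurry_dq k
  have crem := R.continuous_rem cz R.gw.cont k
  have key := (lintegral₂_le_of_deriv_le (Y := fun t x => dq k (z t) x ^ 2)
    (f := fun t x => c₀ * dq k (z t) x ^ 2) (g := fun t x => 8 * C ^ 2 / c₀ * rem v S z w k t x)
    (Y' := fun t x => 2 * dq k (z t) x * dq k (fun x => -(c t x * z t x + e t x * w t x)) x)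
    (by exact cdz.pow 2) (by exact continuous_const.mul (cdz.pow 2))
    (by exact continuous_const.mul crem)
    (fun _ _ => sq_nonneg _) (fun _ _ => by positivity)
    (fun _ _ => mul_nonneg (by positivity) (rem_nonneg ..))
    (fun t ht x => ((HasDerivAt.dq_time (f' := fun t x => -(c t x * z t x + e t x * w t x))
      (R.tz t ht) k x).fun_pow 2).congr_deriv (by push_cast; ring))
    (fun t _ x => by
      obtain ⟨r, hr, hr2⟩ := R.cc.dq_combination R.ce k t x (z := z) (w := w)
      have e1 : dq k (fun x => -(c t x * z t x + e t x * w t x)) x =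
          -dq k (fun x => c t x * z t x + e t x * w t x) x := by simp only [dq]; ring
      rw [e1, hr]
      change r ^ 2 ≤ 8 * C ^ 2 * rem v S z w k t x at hr2
      set p := dq k (z t) x
      have e2 := mul_le_mul_of_nonneg_right (R.c_ge t x) (sq_nonneg p)
      have e3 : 0 ≤ (c₀ * p + r) ^ 2 / c₀ := by positivity
      have e4 : (c₀ * p + r) ^ 2 / c₀ = c₀ * p ^ 2 + 2 * (p * r) + r ^ 2 / c₀ := by
        field_simp; ring
      have e5 : r ^ 2 / c₀ ≤ 8 * C ^ 2 * rem v S z w k t x / c₀ := by gcongr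
      have e6 : 8 * C ^ 2 * rem v S z w k t x / c₀ = 8 * C ^ 2 / c₀ * rem v S z w k t x := by ring
      nlinarith)).1
  refine (ENNReal.le_div_iff_mul_le (Or.inl hpos) (Or.inl (hr _).ne)).2 ?_
  calc Lpow 2 (fun t => dq k (z t)) * ENNReal.ofReal c₀
      = LL fun t x => c₀ * dq k (z t) x ^ 2 := by rw [LL_const_mul _ h0.le, mul_comm]; rfl
    _ ≤ _ := key
    _ ≤ _ := by
      refine add_le_add (R.lpow_dq_combination_le R.cζv R.cζs R.z_eq 0 (R.gvx.slice 0)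
        (R.gSx.slice 0) (R.dvx 0) (R.cvxx 0) (R.dSx 0) (R.cSxx 0) hk.ne') ?_
      change LL _ ≤ _
      rw [LL_const_mul _ (by positivity)]
      gcongr
      exact R.LL_rem_le cz R.gw.cont R.dw R.cwx hk.ne'

lemma exists_lpow_Sx_le (h_vx : ∃ X < ⊤, ∀ t ≥ 0, lpow 2 (vx t) ≤ X)
    (hz : ∃ X < ⊤, ∀ t ≥ 0, lpow 2 (z t) ≤ X) : ∃ X < ⊤, ∀ t ≥ 0, lpow 2 (Sx t) ≤ X := by
  have hC := R.Cpos
  have h0 := R.c₀pos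
  obtain ⟨X, hX, hX'⟩ := h_vx
  obtain ⟨Y, hY, hY'⟩ := hz
  refine ⟨ENNReal.ofReal (2 * (1 + C ^ 2) / c₀ ^ 2) * (Y + X), ENNReal.mul_lt_top
    ENNReal.ofReal_lt_top (ENNReal.add_lt_top.2 ⟨hY, hX⟩), fun t ht => ?_⟩
  have key : ∀ x, Sx t x ^ 2 ≤ 2 * (1 + C ^ 2) / c₀ ^ 2 * (z t x ^ 2 + vx t x ^ 2) := fun x => by
    have h1 : ζs t x * Sx t x = z t x - ζv t x * vx t x := by rw [R.z_eq]; ring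
    have h2 : c₀ ^ 2 * Sx t x ^ 2 ≤ (ζs t x * Sx t x) ^ 2 := by
      rw [mul_pow]; have := R.ζs_ge t x; gcongr
    have h3 : ζv t x ^ 2 ≤ C ^ 2 := sq_le_sq.2 ((R.cζv.bdd t x).trans (le_abs_self C))
    have h4 := mul_le_mul_of_nonneg_right h3 (sq_nonneg (vx t x))
    rw [div_mul_eq_mul_div, le_div_iff₀ (by positivity)]
    rw [h1] at h2
    nlinarith [sq_nonneg (z t x + ζv t x * vx t x), mul_nonneg (sq_nonneg C) (sq_nonneg (z t x)),
      sq_nonneg (vx t x)]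
  calc lpow 2 (Sx t) ≤ ∫⁻ x, ENNReal.ofReal (2 * (1 + C ^ 2) / c₀ ^ 2) *
        ENNReal.ofReal (z t x ^ 2 + vx t x ^ 2) := by
        refine lintegral_mono fun x => ?_
        rw [← ENNReal.ofReal_mul (by positivity)]
        exact ENNReal.ofReal_le_ofReal (key x)
    _ ≤ _ := by
        rw [lintegral_const_mul' _ _ ENNReal.ofReal_ne_top]
        gcongr
        exact (lintegral_ofReal_add_le
          (by exact ((continuous_slice_right R.cz t).pow 2).measurable)).trans
          (add_le_add (hY' t ht) (hX' t ht))

/-- Square integrability of the velocity gradient yields that of the acceleration. -/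
theorem acceleration_lt (h1 : Lpow 2 ux < ⊤) (h2 : Lpow 2 uxx < ⊤) :
    Lpow 2 w < ⊤ ∧ Lpow 2 wx < ⊤ := by
  have hw := R.w_lt h1
  obtain ⟨hz, hz'⟩ := R.z_sq hw
  have hvx : Lpow 2 vx < ⊤ :=
    R.Lpow_combination_lt even_two R.cαv.bdd R.cβv.bdd R.cz R.vx_eq hz hw
  have hSx : Lpow 2 Sx < ⊤ :=
    R.Lpow_combination_lt even_two R.cαs.bdd R.cβs.bdd R.cz R.Sx_eq hz hw
  have sv : ∀ t ≥ 0, lpow 2 (vx t) ≤ lpow 2 (vx 0) + (Lpow 2 vx + Lpow 2 uxx) := fun t ht =>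
    lpow_deriv_le_of_time_deriv R.cv R.gux.cont R.dv R.dux R.gvx.slice R.cuxx R.tv ht
  have sv_lt : lpow 2 (vx 0) + (Lpow 2 vx + Lpow 2 uxx) < ⊤ :=
    ENNReal.add_lt_top.2 ⟨R.gvx.lt_top 0, ENNReal.add_lt_top.2 ⟨hvx, h2⟩⟩
  obtain ⟨X, hX, hX'⟩ := R.exists_lpow_Sx_le ⟨_, sv_lt, sv⟩ hz'
  exact ⟨hw, R.wx_lt_of_uxx (X := max X (lpow 2 (vx 0) + (Lpow 2 vx + Lpow 2 uxx)))
    (max_lt hX sv_lt) (fun t ht => (sv t ht.le).trans (le_max_right _ _))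
    (fun t ht => (hX' t ht.le).trans (le_max_left _ _)) hSx h1 h2⟩

/-- Square integrability of the acceleration yields that of all the gradients. -/
theorem gradients_lt (hw : Lpow 2 w < ⊤) (h_wx : Lpow 2 wx < ⊤) :
    Lpow 2 vx < ⊤ ∧ Lpow 2 vxx < ⊤ ∧ Lpow 2 ux < ⊤ ∧ Lpow 2 uxx < ⊤ ∧
      Lpow 2 Sx < ⊤ ∧ Lpow 2 Sxx < ⊤ := by
  have e4 : Even 4 := by decide
  obtain ⟨hz, hz'⟩ := R.z_sq hw
  have hw4 := R.w_four h_wx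
  have hz4 := R.z_four hw4
  have comb := fun {p : ℕ} (hp : Even p) (hz : Lpow p z < ⊤) (hw : Lpow p w < ⊤) =>
    And.intro (R.Lpow_combination_lt hp R.cαv.bdd R.cβv.bdd R.cz R.vx_eq hz hw)
      (R.Lpow_combination_lt hp R.cαs.bdd R.cβs.bdd R.cz R.Sx_eq hz hw)
  obtain ⟨hvx, hSx⟩ := comb even_two hz hw
  obtain ⟨hv4, hS4⟩ := comb e4 hz4 hw4
  obtain ⟨X, hX, hX'⟩ := R.exists_dq_z_le h_wx hz4 hw4 hv4 hS4
  have fin : ENNReal.ofReal (16 * C ^ 2) * (X + (Lpow 2 wx + (Lpow 4 vx + (Lpow 4 Sx +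
      (Lpow 4 z + Lpow 4 w))))) < ⊤ := by
    refine ENNReal.mul_lt_top ENNReal.ofReal_lt_top ?_
    simp only [ENNReal.add_lt_top]
    exact ⟨hX, h_wx, hv4, hS4, hz4, hw4⟩
  have grad := fun {y yx α β : ℝ → ℝ → ℝ} (hα : Coeff v S α C) (hβ : Coeff v S β C)
      (hy : ∀ t x, y t x = α t x * z t x + β t x * w t x) (dy : ∀ t x, HasDerivAt (y t) (yx t x) x)
      (cy : Continuous (Function.uncurry y)) => (Lpow_le_of_dq dy cy.measurable 2 fun k hk =>
    (R.Lpow_dq_combination_le hα hβ hy R.cz R.gw.cont R.dw R.cwx hk.ne').trans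
      (mul_le_mul_right (add_le_add_left (hX' k hk) _) _)).trans_lt fin
  have hvxx := grad R.cαv R.cβv R.vx_eq R.dvx R.gvx.cont
  have hSxx := grad R.cαs R.cβs R.Sx_eq R.dSx R.gSx.cont
  have hux := R.ux_lt hw
  have su : ∀ t > 0, lpow 2 (ux t) ≤ lpow 2 (ux 0) + (Lpow 2 ux + Lpow 2 wx) := fun t ht =>
    lpow_deriv_le_of_time_deriv R.gu.cont R.gw.cont R.du R.dw R.gux.slice R.cwx R.tu
      (le_of_lt ht)
  exact ⟨hvx, hvxx, hux, R.uxx_lt_of_wx (ENNReal.add_lt_top.2 ⟨R.gux.lt_top 0,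
    ENNReal.add_lt_top.2 ⟨hux, h_wx⟩⟩) su hvx hvxx hSx hSxx h_wx, hSx, hSxx⟩

end Reduced

/-- A solution of the system with all derivatives given explicitly, with bounded stress and
uniformly positive `μ + 2aτS`. -/
structure Sol (a μ γ τ B m : ℝ) (v u S vx ux Sx w vxx uxx Sxx wx : ℝ → ℝ → ℝ) : Prop where
  τpos : 0 < τ
  one_lt : 1 < γ
  mpos : 0 < m
  m_le : m ≤ μ
  v_mem : ∀ t x, v t x ∈ Icc (3 / 4 : ℝ) (5 / 4)
  S_le : ∀ t x, |S t x| ≤ B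
  M_ge : ∀ t x, m ≤ μ + 2 * a * τ * S t x
  gv : Good fun t x => v t x - 1
  gu : Good u
  gS : Good S
  gvx : Good vx
  gux : Good ux
  gSx : Good Sx
  dv : ∀ t x, HasDerivAt (v t) (vx t x) x
  du : ∀ t x, HasDerivAt (u t) (ux t x) x
  dS : ∀ t x, HasDerivAt (S t) (Sx t x) x
  dvx : ∀ t x, HasDerivAt (vx t) (vxx t x) x
  dux : ∀ t x, HasDerivAt (ux t) (uxx t x) x
  dSx : ∀ t x, HasDerivAt (Sx t) (Sxx t x) x
  dw : ∀ t x, HasDerivAt (w t) (wx t x) x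
  cvxx : ∀ t, Continuous (vxx t)
  cuxx : ∀ t, Continuous (uxx t)
  cSxx : ∀ t, Continuous (Sxx t)
  cwx : ∀ t, Continuous (wx t)
  bvxx : SliceBdd vxx
  buxx : SliceBdd uxx
  bSxx : SliceBdd Sxx
  bwx : SliceBdd wx
  w_eq : ∀ t x, w t x = Sx t x + γ * v t x ^ (-γ) / v t x * vx t x
  tv : ∀ t > 0, ∀ x, HasDerivAt (fun s => v s x) (ux t x) t
  tu : ∀ t > 0, ∀ x, HasDerivAt (fun s => u s x) (w t x) t
  tS : ∀ t > 0, ∀ x, HasDerivAt (fun s => S s x)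
    (((μ + 2 * a * τ * S t x) * ux t x / v t x - S t x) / τ) t

lemma HasDerivAt.rpow_neg_const {f : ℝ → ℝ} {f' x γ : ℝ} (hf : HasDerivAt f f' x) (h0 : 0 < f x) :
    HasDerivAt (fun y => f y ^ (-γ)) (-(γ * f x ^ (-γ) / f x * f')) x := by
  refine (hf.rpow_const (p := -γ) (Or.inl h0.ne')).congr_deriv ?_
  rw [Real.rpow_sub_one h0.ne']; ring

lemma exists_abs_rpow_sub_one_le (γ : ℝ) :
    ∃ C, ∀ v ∈ Icc (3 / 4 : ℝ) (5 / 4), |v ^ (-γ) - 1| ≤ C * |v - 1| := by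
  have hc : ContinuousOn (fun v : ℝ => -(γ * v ^ (-γ) / v * 1)) (Icc (3 / 4 : ℝ) (5 / 4)) := by
    have h0 : ∀ v ∈ Icc (3 / 4 : ℝ) (5 / 4), v ≠ 0 := fun v hv => by linarith [hv.1]
    refine (((continuousOn_const.mul (continuousOn_id.rpow_const fun v hv =>
      Or.inl (h0 v hv))).div continuousOn_id h0).mul continuousOn_const).neg
  obtain ⟨C, hC⟩ := isCompact_Icc.exists_bound_of_continuousOn hc
  refine ⟨C, fun v hv => ?_⟩
  have hsub : uIcc 1 v ⊆ Icc (3 / 4 : ℝ) (5 / 4) := uIcc_subset_Icc ⟨by norm_num, by norm_num⟩ hv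
  obtain ⟨θ, hθ, h⟩ := exists_sub_eq_deriv_mul (f := fun v : ℝ => v ^ (-γ)) (a := 1) (b := v)
    (fun r hr => (hasDerivAt_id r).rpow_neg_const (by simp only [id]; linarith [(hsub hr).1]))
  simp only [Real.one_rpow] at h
  rw [h, abs_mul]
  gcongr
  exact hC θ (hsub hθ)

namespace Sol

variable {a μ γ τ B m : ℝ} {v u S vx ux Sx w vxx uxx Sxx wx : ℝ → ℝ → ℝ}
  (H : Sol a μ γ τ B m v u S vx ux Sx w vxx uxx Sxx wx)
include H

lemma vpos (t x : ℝ) : 0 < v t x := by linarith [(H.v_mem t x).1]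

lemma cv : Continuous (Function.uncurry v) :=
  (H.gv.cont.add (continuous_const (y := (1 : ℝ)))).congr fun q => by
    simp only [Function.uncurry, Pi.add_apply]; ring

lemma cb : Continuous (Function.uncurry fun t x => v t x ^ (-γ)) :=
  H.cv.rpow_const fun q => Or.inl (H.vpos q.1 q.2).ne'

lemma gw : Good w := by
  have hc : Continuous (Function.uncurry fun t x => γ * v t x ^ (-γ) / v t x) :=
    (continuous_const.mul H.cb).div H.cv fun q => (H.vpos q.1 q.2).ne'
  have hc' : ContinuousOn (fun v : ℝ => γ * v ^ (-γ) / v) (Icc (3 / 4 : ℝ) (5 / 4)) := by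
    have h0 : ∀ v ∈ Icc (3 / 4 : ℝ) (5 / 4), v ≠ 0 := fun v hv => by linarith [hv.1]
    exact (continuousOn_const.mul (continuousOn_id.rpow_const fun v hv =>
      Or.inl (h0 v hv))).div continuousOn_id h0
  obtain ⟨C, hC⟩ := isCompact_Icc.exists_bound_of_continuousOn hc'
  have := H.gSx.add (H.gvx.mul_bdd hc C fun t x => hC _ (H.v_mem t x))
  rwa [show w = fun t x => Sx t x + γ * v t x ^ (-γ) / v t x * vx t x from
    funext fun t => funext fun x => H.w_eq t x]

lemma gQ : Good fun t x => v t x ^ (-γ) - S t x - 1 := by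
  obtain ⟨C, hC⟩ := exists_abs_rpow_sub_one_le γ
  have h1 : Good fun t x => v t x ^ (-γ) - 1 :=
    H.gv.of_cont_le (H.cb.sub continuous_const) C fun t x => hC _ (H.v_mem t x)
  have := h1.sub H.gS
  convert this using 3
  ring

lemma dQ (t x : ℝ) : HasDerivAt (fun x => v t x ^ (-γ) - S t x - 1) (-w t x) x := by
  refine ((((H.dv t x).rpow_neg_const (H.vpos t x)).sub (H.dS t x)).sub_const 1).congr_deriv ?_
  rw [H.w_eq]; ring

lemma entropy_bounds : (∃ Bd, ∀ t ≥ 0, ∫ x, u t x ^ 2 ≤ Bd) ∧ Lpow 2 S < ⊤ := by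
  have hτ := H.τpos
  obtain ⟨k, h, c, hc, C, hC, hS⟩ := exists_stress_entropy (B := B) (a := a) hτ H.mpos H.m_le
  obtain ⟨Φ, D, hΦ⟩ := exists_volume_entropy H.one_lt
  have hS' := fun t x => hS (S t x) (H.S_le t x) (H.M_ge t x)
  have hΦ' := fun t x => hΦ (v t x) (H.v_mem t x)
  have cv := H.cv
  have cS := H.gS.cont
  have ck : Continuous (Function.uncurry fun t x => k (S t x)) :=
    continuous_iff_continuousAt.2 fun q =>
      (hS' q.1 q.2).2.1.comp_of_eq cS.continuousAt rfl
  have ch : Continuous (Function.uncurry fun t x => h (S t x)) :=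
    continuous_iff_continuousAt.2 fun q =>
      (hS' q.1 q.2).1.continuousAt.comp_of_eq cS.continuousAt rfl
  have cΦ : Continuous (Function.uncurry fun t x => Φ (v t x)) :=
    continuous_iff_continuousAt.2 fun q =>
      (hΦ' q.1 q.2).1.continuousAt.comp_of_eq cv.continuousAt rfl
  set e : ℝ → ℝ → ℝ := fun t x => u t x ^ 2 / 2 + (Φ (v t x) + v t x * h (S t x)) with he
  have ce : Continuous (Function.uncurry e) := by
    exact ((H.gu.cont.pow 2).div_const 2).add (cΦ.add (cv.mul ch))
  have gvk : Good fun t x => v t x * k (S t x) / τ := by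
    refine H.gS.of_cont_le (by exact (cv.mul ck).div_const τ) (5 / 4 * C / τ) fun t x => ?_
    rw [abs_div, abs_mul, abs_of_pos (H.vpos t x), abs_of_pos hτ, div_mul_eq_mul_div, mul_assoc]
    gcongr
    · exact (H.v_mem t x).2
    · exact (hS' t x).2.2.2.2.2.2
  set e' : ℝ → ℝ → ℝ := fun t x => (u t x * w t x - ux t x * (v t x ^ (-γ) - S t x - 1)) -
    v t x * k (S t x) / τ * S t x with he'
  have gQ := H.gQ
  have gw := H.gw
  have ce' : Continuous (Function.uncurry e') := by
    exact ((H.gu.cont.mul gw.cont).sub (H.gux.cont.mul gQ.cont)).sub (gvk.cont.mul cS)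
  have de : ∀ t > 0, ∀ x, HasDerivAt (fun s => e s x) (e' t x) t := fun t ht x => by
    have d1 := (H.tu t ht x).fun_pow 2 |>.div_const 2
    have d2 := (hΦ' t x).1.comp t (H.tv t ht x)
    have d3 := (H.tv t ht x).fun_mul ((hS' t x).1.comp t (H.tS t ht x))
    refine (d1.add (d2.add d3)).congr_deriv ?_
    have r := (hS' t x).2.2.1
    have hv := (H.vpos t x).ne'
    simp only [he', Function.comp]
    have : v t x * (k (S t x) * (((μ + 2 * a * τ * S t x) * ux t x / v t x - S t x) / τ)) =
        k (S t x) * (μ + 2 * a * τ * S t x) / τ * ux t x - v t x * k (S t x) / τ * S t x := by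
      field_simp
    rw [this, eq_sub_of_add_eq' r]
    push_cast
    ring
  have ie : ∀ t, Integrable (e t) := fun t => by
    have i1 := integrable_sq_of_lpow (H.gu.slice t) (H.gu.lt_top t)
    have i2 := integrable_sq_of_lpow (H.gv.slice t) (H.gv.lt_top t)
    have i3 := integrable_sq_of_lpow (H.gS.slice t) (H.gS.lt_top t)
    refine (((i1.div_const 2).add (i2.const_mul D)).add (i3.const_mul (5 / 4 * C))).mono'
      (continuous_slice_right ce t).aestronglyMeasurable (Eventually.of_forall fun x => ?_)
    have n1 := (hΦ' t x).2
    have n2 := (hS' t x).2.2.2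
    have n3 := H.v_mem t x
    have n4 := mul_nonneg (H.vpos t x).le n2.1
    have n5 : v t x * h (S t x) ≤ 5 / 4 * (C * S t x ^ 2) :=
      mul_le_mul n3.2 n2.2.1 n2.1 (by norm_num)
    simp only [he, Pi.add_apply]
    rw [Real.norm_of_nonneg (by nlinarith [sq_nonneg (u t x)])]
    linarith
  have key : ∀ T ≥ 0, (∫ x, e T x) + ∫ q, v q.1 q.2 * k (S q.1 q.2) / τ * S q.1 q.2 ∂(slab T) =
      ∫ x, e 0 x := fun T hT => by
    have j1 := H.gu.integrable_mul gw T
    have j2 := H.gux.integrable_mul gQ T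
    have j3 := gvk.integrable_mul H.gS T
    have bal := balance ce ce' de hT (ie 0) (ie T) ((j1.sub j2).sub j3)
    have s1 : ∫ q, Function.uncurry e' q ∂(slab T) =
        (∫ q, (u q.1 q.2 * w q.1 q.2 - ux q.1 q.2 * (v q.1 q.2 ^ (-γ) - S q.1 q.2 - 1)) ∂(slab T)) -
        ∫ q, v q.1 q.2 * k (S q.1 q.2) / τ * S q.1 q.2 ∂(slab T) :=
      MeasureTheory.integral_sub (j1.sub j2) j3
    have s2 : ∫ q, (u q.1 q.2 * w q.1 q.2 - ux q.1 q.2 * (v q.1 q.2 ^ (-γ) - S q.1 q.2 - 1))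
        ∂(slab T) = 0 := by
      have l1 := integral_prod _ (j1.sub j2)
      refine l1.trans ?_
      refine (MeasureTheory.integral_congr_ae (g := fun _ => (0 : ℝ))
        (Eventually.of_forall fun t => ?_)).trans
        (by simp)
      have p := integral_mul_deriv_eq_neg (H.du t) (H.dQ t) (H.gu.memLp_slice t)
        (gQ.memLp_slice t) (H.gux.memLp_slice t) (gw.neg.memLp_slice t)
      simp only [mul_neg, MeasureTheory.integral_neg, neg_inj] at p
      simp only [Pi.sub_apply, Function.uncurry_apply_pair]
      rw [MeasureTheory.integral_sub (H.gu.integrable_slice_mul gw t)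
        (H.gux.integrable_slice_mul gQ t), p, sub_self]
    rw [s1, s2] at bal
    linarith
  have epos : ∀ t x, u t x ^ 2 / 2 ≤ e t x := fun t x => by
    have n1 := (hΦ' t x).2.1
    have n4 := mul_nonneg (H.vpos t x).le (hS' t x).2.2.2.1
    simp only [he]; linarith
  have kpos : ∀ t x, 3 / 4 * c / τ * S t x ^ 2 ≤ v t x * k (S t x) / τ * S t x := fun t x => by
    have n1 := (hS' t x).2.2.2.2.2.1
    have n2 : 0 ≤ c * S t x ^ 2 := by positivity
    have n3 := mul_le_mul (H.v_mem t x).1 n1 n2 (H.vpos t x).le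
    rw [div_mul_eq_mul_div, show v t x * k (S t x) / τ * S t x = v t x * (k (S t x) * S t x) / τ by
      ring]
    exact div_le_div_of_nonneg_right (by linarith) hτ.le
  have i2 : ∀ T, 0 ≤ ∫ q, v q.1 q.2 * k (S q.1 q.2) / τ * S q.1 q.2 ∂(slab T) := fun T =>
    integral_nonneg fun q => (by positivity : 0 ≤ 3 / 4 * c / τ * S q.1 q.2 ^ 2).trans (kpos _ _)
  have i1 : ∀ T, ∫ x, u T x ^ 2 / 2 ≤ ∫ x, e T x := fun T =>
    integral_mono ((integrable_sq_of_lpow (H.gu.slice T) (H.gu.lt_top T)).div_const 2) (ie T)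
      (epos T)
  refine ⟨⟨2 * ∫ x, e 0 x, fun T hT => ?_⟩, ?_⟩
  · have := i1 T
    rw [MeasureTheory.integral_div] at this
    linarith [key T hT, i2 T]
  · refine (setLIntegral_Ioi_le (C := ENNReal.ofReal ((∫ x, e 0 x) / (3 / 4 * c / τ))) 0
      fun T hT => ?_).trans_lt ENNReal.ofReal_lt_top
    have j3 := gvk.integrable_mul H.gS T
    have jS : Integrable (fun q : ℝ × ℝ => S q.1 q.2 ^ 2) (slab T) := (H.gS.memLp T).integrable_sq
    have e1 := lintegral_slab (f := fun t x => S t x ^ 2) (by exact (cS.pow 2).measurable) T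
    refine e1.symm.le.trans ?_
    change ∫⁻ q, ENNReal.ofReal (S q.1 q.2 ^ 2) ∂(slab T) ≤ _
    rw [← ofReal_integral_eq_lintegral_ofReal jS (Eventually.of_forall fun q => sq_nonneg _)]
    refine ENNReal.ofReal_le_ofReal ?_
    rw [le_div_iff₀ (by positivity), mul_comm, ← MeasureTheory.integral_const_mul]
    have := integral_mono (jS.const_mul (3 / 4 * c / τ)) j3 fun q => kpos q.1 q.2
    have i0 : 0 ≤ ∫ x, e T x := (integral_nonneg fun x => by positivity).trans (i1 T)
    refine this.trans ?_
    have := key T hT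
    simp only [Function.uncurry] at this ⊢
    linarith

end Sol

lemma exists_forall_pos_le {Ω : Set (ℝ × ℝ)} (hΩ : IsCompact Ω) {φ : ℝ × ℝ → ℝ}
    (hφ : ContinuousOn φ Ω) (hpos : ∀ p ∈ Ω, 0 < φ p) : ∃ c₀ > 0, ∀ p ∈ Ω, c₀ ≤ φ p :=
  hΩ.exists_forall_le' hφ hpos

lemma exists_stress_primitive {a μ τ m : ℝ} (hm : 0 < m) : ∃ ξ : ℝ → ℝ,
    ∀ s, m ≤ μ + 2 * a * τ * s → HasDerivAt ξ (τ / (μ + 2 * a * τ * s)) s := by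
  have hc : Continuous fun y : ℝ => τ / max m (μ + 2 * a * τ * y) :=
    continuous_const.div (by fun_prop) fun y => (lt_max_of_lt_left hm).ne'
  refine ⟨fun s => ∫ y in (0 : ℝ)..s, τ / max m (μ + 2 * a * τ * y), fun s hs => ?_⟩
  have := (hc.integral_hasStrictDerivAt 0 s).hasDerivAt
  rwa [max_eq_right hs] at this

namespace Sol

variable {a μ γ τ B m : ℝ} {v u S vx ux Sx w vxx uxx Sxx wx : ℝ → ℝ → ℝ}
  (H : Sol a μ γ τ B m v u S vx ux Sx w vxx uxx Sxx wx)
include H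

lemma Mpos (t x : ℝ) : 0 < μ + 2 * a * τ * S t x := H.mpos.trans_le (H.M_ge t x)

lemma cM : Continuous (Function.uncurry fun t x => μ + 2 * a * τ * S t x) :=
  continuous_const.add (continuous_const.mul H.gS.cont)

lemma hasDerivAt_z {t : ℝ} (ht : 0 < t) (x : ℝ) :
    HasDerivAt (fun s => Sx s x / (μ + 2 * a * τ * S s x) - vx s x / (τ * v s x))
      (-(μ * Sx t x / (τ * (μ + 2 * a * τ * S t x) ^ 2))) t := by
  have hτ := H.τpos
  obtain ⟨ξ, hξ⟩ := exists_stress_primitive (a := a) (μ := μ) (τ := τ) H.mpos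
  have hξ' := fun t x => hξ (S t x) (H.M_ge t x)
  have hM := fun t x => (H.Mpos t x).ne'
  have hv := fun t x => (H.vpos t x).ne'
  have cS := H.gS.cont
  have cv := H.cv
  have cM := H.cM
  have cξ : Continuous (Function.uncurry fun t x => ξ (S t x)) :=
    continuous_iff_continuousAt.2 fun q =>
      (hξ' q.1 q.2).continuousAt.comp_of_eq cS.continuousAt rfl
  have cl : Continuous (Function.uncurry fun t x => Real.log (v t x)) :=
    cv.log fun q => hv q.1 q.2
  have c1 := H.gSx.cont.div cM fun q => hM q.1 q.2
  have c2 := H.gvx.cont.div ((continuous_const (y := τ)).mul cv) fun q =>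
    mul_ne_zero hτ.ne' (hv q.1 q.2)
  have c3 := ((continuous_const (y := μ)).mul H.gSx.cont).div
    ((continuous_const (y := τ)).mul (cM.pow 2)) fun q =>
    mul_ne_zero hτ.ne' (pow_ne_zero 2 (hM q.1 q.2))
  refine hasDerivAt_time_of_mixed (Z := fun t x => (ξ (S t x) - Real.log (v t x)) / τ)
    (Y := fun t x => -(S t x / (τ * (μ + 2 * a * τ * S t x))))
    (Zx := fun t x => Sx t x / (μ + 2 * a * τ * S t x) - vx t x / (τ * v t x))
    (Yx := fun t x => -(μ * Sx t x / (τ * (μ + 2 * a * τ * S t x) ^ 2)))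
    (by exact (cξ.sub cl).div_const τ)
    (by exact (cS.div (continuous_const.mul cM) fun q => mul_ne_zero hτ.ne' (hM q.1 q.2)).neg)
    (by exact c1.sub c2) (by exact c3.neg)
    (fun t x => ?_) (fun t x => ?_) (fun t ht x => ?_) ht x
  · refine ((((hξ' t x).comp x (H.dS t x)).sub
      ((H.dv t x).log (hv t x))).div_const τ).congr_deriv ?_
    have := hM t x
    have := hv t x
    field_simp
  · refine ((H.dS t x).div ((((H.dS t x).const_mul (2 * a * τ)).const_add μ).const_mul τ)
      (mul_ne_zero hτ.ne' (hM t x))).neg.congr_deriv ?_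
    have := hM t x
    field_simp
    ring
  · refine ((((hξ' t x).comp t (H.tS t ht x)).sub
      ((H.tv t ht x).log (hv t x))).div_const τ).congr_deriv ?_
    have h1 := hM t x
    have h2 := hv t x
    generalize μ + 2 * a * τ * S t x = M at *
    field_simp
    ring

theorem exists_reduced : ∃ z αv βv αs βs ζv ζs c e K : ℝ → ℝ → ℝ, ∃ C c₀ : ℝ,
    Reduced v u S vx ux Sx w vxx uxx Sxx wx z (fun t x => v t x ^ (-γ) - S t x - 1)
      αv βv αs βs ζv ζs c e K τ C c₀ := by
  have hτ := H.τpos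
  have hγ : 0 < γ := by linarith [H.one_lt]
  have hμ : 0 < μ := H.mpos.trans_le H.m_le
  set Ω : Set (ℝ × ℝ) := (Icc (3 / 4) (5 / 4) ×ˢ Icc (-B) B) ∩ {p | m ≤ μ + 2 * a * τ * p.2} with hΩ
  have Ωcl : IsClosed {p : ℝ × ℝ | m ≤ μ + 2 * a * τ * p.2} :=
    isClosed_le continuous_const (by fun_prop)
  have Ωc : IsCompact Ω := (isCompact_Icc.prod isCompact_Icc).inter_right Ωcl
  have Ωconv : Convex ℝ Ω := by
    refine ((convex_Icc _ _).prod (convex_Icc _ _)).inter ?_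
    intro p hp q hq s r hs hr hsr
    simp only [mem_ofPred_eq, Prod.snd_add, Prod.smul_snd, smul_eq_mul] at hp hq ⊢
    have : μ + 2 * a * τ * (s * p.2 + r * q.2) =
        s * (μ + 2 * a * τ * p.2) + r * (μ + 2 * a * τ * q.2) := by
      linear_combination -μ * hsr
    rw [this]
    calc m = s * m + r * m := by linear_combination -m * hsr
      _ ≤ _ := by gcongr
  have mem : ∀ t x, (v t x, S t x) ∈ Ω := fun t x =>
    ⟨⟨H.v_mem t x, abs_le.1 (H.S_le t x)⟩, H.M_ge t x⟩
  have nv : ∀ p ∈ Ω, 0 < p.1 := fun p hp => by linarith [hp.1.1.1]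
  have nM : ∀ p ∈ Ω, 0 < μ + 2 * a * τ * p.2 := fun p hp => H.mpos.trans_le hp.2
  have nb : ∀ p ∈ Ω, 0 < p.1 ^ (-γ) := fun p hp => Real.rpow_pos_of_pos (nv p hp) _
  have nD : ∀ p ∈ Ω, 0 < τ * γ * p.1 ^ (-γ) + (μ + 2 * a * τ * p.2) := fun p hp =>
    add_pos (mul_pos (mul_pos hτ hγ) (nb p hp)) (nM p hp)
  have sv : ContDiffOn ℝ 1 (fun p : ℝ × ℝ => p.1) Ω := contDiffOn_fst
  have sS : ContDiffOn ℝ 1 (fun p : ℝ × ℝ => p.2) Ω := contDiffOn_snd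
  have sb : ContDiffOn ℝ 1 (fun p : ℝ × ℝ => p.1 ^ (-γ)) Ω :=
    sv.rpow_const_of_ne fun p hp => (nv p hp).ne'
  have sc : ∀ r : ℝ, ContDiffOn ℝ 1 (fun _ : ℝ × ℝ => r) Ω := fun _ => contDiffOn_const
  have sM : ContDiffOn ℝ 1 (fun p : ℝ × ℝ => μ + 2 * a * τ * p.2) Ω := (sc _).add ((sc _).mul sS)
  have sD : ContDiffOn ℝ 1 (fun p : ℝ × ℝ => τ * γ * p.1 ^ (-γ) + (μ + 2 * a * τ * p.2)) Ω :=
    ((sc _).mul sb).add sM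
  have mk := fun {φ : ℝ × ℝ → ℝ} (hφ : ContDiffOn ℝ 1 φ Ω) =>
    Coeff.of_contDiffOn Ωconv Ωc hφ H.cv H.gS.cont mem
  have sc' : ContDiffOn ℝ 1 (fun p : ℝ × ℝ => γ * μ * p.1 ^ (-γ) / ((μ + 2 * a * τ * p.2) *
      (τ * γ * p.1 ^ (-γ) + (μ + 2 * a * τ * p.2)))) Ω :=
    ((sc _).mul sb).div (sM.mul sD) fun p hp => (mul_pos (nM p hp) (nD p hp)).ne'
  have sK : ContDiffOn ℝ 1 (fun p : ℝ × ℝ => γ * p.1 ^ (-γ) / p.1 +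
      (μ + 2 * a * τ * p.2) / (τ * p.1)) Ω :=
    (((sc _).mul sb).div sv fun p hp => (nv p hp).ne').add
      (sM.div ((sc _).mul sv) fun p hp => (mul_pos hτ (nv p hp)).ne')
  have sζs : ContDiffOn ℝ 1 (fun p : ℝ × ℝ => 1 / (μ + 2 * a * τ * p.2)) Ω :=
    (sc _).div sM fun p hp => (nM p hp).ne'
  obtain ⟨C1, h1⟩ := mk (((((sc τ).mul sv).mul sM).div sD fun p hp => (nD p hp).ne').neg)
  obtain ⟨C2, h2⟩ := mk (((sc τ).mul sv).div sD fun p hp => (nD p hp).ne')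
  obtain ⟨C3, h3⟩ := mk (((sM.mul (sc (τ * γ))).mul sb).div sD fun p hp => (nD p hp).ne')
  obtain ⟨C4, h4⟩ := mk (sM.div sD fun p hp => (nD p hp).ne')
  obtain ⟨C5, h5⟩ := mk ((((sc 1).div ((sc τ).mul sv)
    fun p hp => (mul_pos hτ (nv p hp)).ne')).neg)
  obtain ⟨C6, h6⟩ := mk sζs
  obtain ⟨C7, h7⟩ := mk sc'
  obtain ⟨C8, h8⟩ := mk ((sc μ).div (((sc τ).mul sM).mul sD)
    fun p hp => (mul_pos (mul_pos hτ (nM p hp)) (nD p hp)).ne')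
  obtain ⟨C9, h9⟩ := mk sK
  obtain ⟨C0, h0⟩ := mk ((sb.sub sS).sub (sc 1))
  obtain ⟨d1, d1pos, hd1⟩ := exists_forall_pos_le Ωc sc'.continuousOn fun p hp =>
    div_pos (mul_pos (mul_pos hγ hμ) (nb p hp)) (mul_pos (nM p hp) (nD p hp))
  obtain ⟨d2, d2pos, hd2⟩ := exists_forall_pos_le Ωc sK.continuousOn fun p hp =>
    add_pos (div_pos (mul_pos hγ (nb p hp)) (nv p hp)) (div_pos (nM p hp) (mul_pos hτ (nv p hp)))
  obtain ⟨d3, d3pos, hd3⟩ := exists_forall_pos_le Ωc sζs.continuousOn fun p hp =>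
    div_pos one_pos (nM p hp)
  have p0 := h0.pos; have p1 := h1.pos; have p2 := h2.pos; have p3 := h3.pos; have p4 := h4.pos
  have p5 := h5.pos; have p6 := h6.pos; have p7 := h7.pos; have p8 := h8.pos; have p9 := h9.pos
  set C := C0 + C1 + C2 + C3 + C4 + C5 + C6 + C7 + C8 + C9
  have rel : ∀ t x, v t x ≠ 0 ∧ μ + 2 * a * τ * S t x ≠ 0 ∧
      τ * γ * v t x ^ (-γ) + (μ + 2 * a * τ * S t x) ≠ 0 := fun t x =>
    ⟨(nv _ (mem t x)).ne', (nM _ (mem t x)).ne', (nD _ (mem t x)).ne'⟩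
  refine ⟨fun t x => Sx t x / (μ + 2 * a * τ * S t x) - vx t x / (τ * v t x), _, _, _, _, _, _, _,
    _, _, C, min d1 (min d2 d3),
    { τpos := hτ
      c₀pos := lt_min d1pos (lt_min d2pos d3pos)
      cαv := h1.mono (by simp only [C]; linarith)
      cβv := h2.mono (by simp only [C]; linarith)
      cαs := h3.mono (by simp only [C]; linarith)
      cβs := h4.mono (by simp only [C]; linarith)
      cζv := h5.mono (by simp only [C]; linarith)
      cζs := h6.mono (by simp only [C]; linarith)
      cc := h7.mono (by simp only [C]; linarith)
      ce := h8.mono (by simp only [C]; linarith)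
      cK := h9.mono (by simp only [C]; linarith)
      c_ge := fun t x => (min_le_left _ _).trans (hd1 _ (mem t x))
      K_ge := fun t x => ((min_le_right _ _).trans (min_le_left _ _)).trans (hd2 _ (mem t x))
      ζs_ge := fun t x => ((min_le_right _ _).trans (min_le_right _ _)).trans (hd3 _ (mem t x))
      cv := H.cv, gu := H.gu, gS := H.gS, gvx := H.gvx, gux := H.gux, gSx := H.gSx, gw := H.gw
      gQ := H.gQ, dv := H.dv, du := H.du, dS := H.dS, dvx := H.dvx, dux := H.dux, dSx := H.dSx
      dw := H.dw, dQ := H.dQ, cvxx := H.cvxx, cuxx := H.cuxx, cSxx := H.cSxx, cwx := H.cwx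
      bvxx := H.bvxx, buxx := H.buxx, bSxx := H.bSxx, bwx := H.bwx, tv := H.tv, tu := H.tu
      tQ := fun t ht x => ?_
      tz := fun t ht x => ?_
      vx_eq := fun t x => ?_
      Sx_eq := fun t x => ?_
      z_eq := fun t x => ?_
      Q_le := fun t x => (h0.bdd t x).trans (by simp only [C]; linarith)
      u_le := H.entropy_bounds.1
      S_lt := H.entropy_bounds.2 }⟩
  · obtain ⟨n1, n2, n3⟩ := rel t x
    refine ((((H.tv t ht x).rpow_neg_const (H.vpos t x)).sub (H.tS t ht x)).sub_const
      1).congr_deriv ?_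
    simp only
    field_simp
    ring
  · obtain ⟨n1, n2, n3⟩ := rel t x
    refine (H.hasDerivAt_z ht x).congr_deriv ?_
    rw [H.w_eq]
    simp only [Pi.div_apply]
    generalize v t x ^ (-γ) = b at *
    generalize μ + 2 * a * τ * S t x = M at *
    generalize v t x = y at *
    field_simp
    ring
  · obtain ⟨n1, n2, n3⟩ := rel t x
    rw [H.w_eq]
    simp only [Pi.div_apply]
    generalize v t x ^ (-γ) = b at *
    generalize μ + 2 * a * τ * S t x = M at *
    generalize v t x = y at *
    field_simp
    ring
  · obtain ⟨n1, n2, n3⟩ := rel t x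
    rw [H.w_eq]
    simp only [Pi.div_apply]
    generalize v t x ^ (-γ) = b at *
    generalize μ + 2 * a * τ * S t x = M at *
    generalize v t x = y at *
    field_simp
    ring
  · simp only [Pi.div_apply]
    ring

end Sol

lemma HSq_one (f : ℝ → ℝ) : HSq 1 f = (∫ x, f x ^ 2) + ∫ x, deriv f x ^ 2 := by
  simp [HSq, Finset.sum_range_succ]

lemma HSq_two (f : ℝ → ℝ) : HSq 2 f = (∫ x, f x ^ 2) + HSq 1 (deriv f) := by
  simp only [HSq, Finset.sum_range_succ _ 2, Finset.sum_range_succ _ 1, Finset.sum_range_one,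
    iteratedDeriv_zero, iteratedDeriv_succ', add_assoc]

lemma HSq_nonneg (k : ℕ) (f : ℝ → ℝ) : 0 ≤ HSq k f :=
  Finset.sum_nonneg fun _ _ => integral_nonneg fun _ => sq_nonneg _

lemma integral_sq_le_HSq_one (f : ℝ → ℝ) : ∫ x, f x ^ 2 ≤ HSq 1 f := by
  rw [HSq_one]
  exact le_add_of_nonneg_right (integral_nonneg fun _ => sq_nonneg _)

lemma integral_deriv_sq_le_HSq_one (f : ℝ → ℝ) : ∫ x, deriv f x ^ 2 ≤ HSq 1 f := by
  rw [HSq_one]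
  exact le_add_of_nonneg_left (integral_nonneg fun _ => sq_nonneg _)

lemma HSq_one_le_HSq_two (f : ℝ → ℝ) : HSq 1 f ≤ HSq 2 f := by
  rw [HSq_two, HSq_one f]
  gcongr
  exact integral_sq_le_HSq_one _

lemma HSq_one_deriv_le_HSq_two (f : ℝ → ℝ) : HSq 1 (deriv f) ≤ HSq 2 f := by
  rw [HSq_two]
  exact le_add_of_nonneg_left (integral_nonneg fun _ => sq_nonneg _)

lemma lpow_two_lt_top_of_integrable {f : ℝ → ℝ} (hf : Integrable fun x => f x ^ 2) :
    lpow 2 f < ⊤ := hf.lintegral_lt_top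

namespace MemH

variable {f g : ℝ → ℝ}

lemma hasDerivAt (hf : MemH 1 f) (x : ℝ) : HasDerivAt f (deriv f x) x :=
  ((hf.1.differentiable (by simp)) x).hasDerivAt

lemma continuous (hf : MemH 1 f) : Continuous f := hf.1.continuous

lemma continuous_deriv (hf : MemH 1 f) : Continuous (deriv f) := hf.1.continuous_deriv (by simp)

lemma lt_top (hf : MemH 1 f) : lpow 2 f < ⊤ :=
  lpow_two_lt_top_of_integrable (by simpa using hf.2 0 (by simp))

lemma deriv_lt_top (hf : MemH 1 f) : lpow 2 (deriv f) < ⊤ :=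
  lpow_two_lt_top_of_integrable (by simpa using hf.2 1 le_rfl)

lemma one (hf : MemH 2 f) : MemH 1 f :=
  ⟨hf.1.of_le (by norm_num), fun j hj => hf.2 j (by omega)⟩

lemma deriv (hf : MemH 2 f) : MemH 1 (deriv f) := by
  refine ⟨((contDiff_succ_iff_deriv (n := 1)).1 (by exact_mod_cast hf.1)).2.2, fun j hj => ?_⟩
  rw [← iteratedDeriv_succ']
  exact hf.2 (j + 1) (by omega)

end MemH

/-- `t ↦ g t` is a continuous map from `[0, ∞)` to `L²`, with continuous slices. -/
structure ContL2 (g : ℝ → ℝ → ℝ) : Prop where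
  cont : ∀ t ≥ 0, Continuous (g t)
  lt_top : ∀ t ≥ 0, lpow 2 (g t) < ⊤
  tendsto : ∀ s ≥ 0,
    Tendsto (fun t => lpow 2 fun x => g t x - g s x) (nhdsWithin s (Ici 0)) (nhds 0)

lemma lpow_sub_lt_top {f g : ℝ → ℝ} (hf : Continuous f) (hg : Continuous g) (h1 : lpow 2 f < ⊤)
    (h2 : lpow 2 g < ⊤) : lpow 2 (fun x => f x - g x) < ⊤ :=
  lpow_two_lt_top_of_integrable ((memLp_of_lpow hf h1).sub (memLp_of_lpow hg h2)).integrable_sq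

lemma ContL2.of_integral {g : ℝ → ℝ → ℝ} (h1 : ∀ t ≥ 0, Continuous (g t))
    (h2 : ∀ t ≥ 0, lpow 2 (g t) < ⊤) (F : ℝ → ℝ → ℝ)
    (hF : ∀ s ≥ 0, Tendsto (fun t => F t s) (nhdsWithin s (Ici 0)) (nhds 0))
    (hle : ∀ t ≥ 0, ∀ s ≥ 0, ∫ x, (g t x - g s x) ^ 2 ≤ F t s) : ContL2 g := by
  refine ⟨h1, h2, fun s hs => ?_⟩
  have := ENNReal.tendsto_ofReal (hF s hs)
  rw [ENNReal.ofReal_zero] at this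
  refine tendsto_of_tendsto_of_tendsto_of_le_of_le' tendsto_const_nhds this
    (Eventually.of_forall fun _ => zero_le) ?_
  filter_upwards [self_mem_nhdsWithin] with t ht
  rw [← ofReal_integral_sq (f := fun x => g t x - g s x) ((h1 t ht).sub (h1 s hs))
    (lpow_sub_lt_top (h1 t ht) (h1 s hs) (h2 t ht) (h2 s hs))]
  exact ENNReal.ofReal_le_ofReal (hle t ht s hs)

lemma deriv_sub_slice {f : ℝ → ℝ → ℝ} (hf : ∀ t ∈ Ici (0 : ℝ), MemH 1 (f t)) {t s : ℝ}
    (ht : 0 ≤ t) (hs : 0 ≤ s) : deriv (fun x => f t x - f s x) = fun x => px f t x - px f s x := by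
  ext x
  exact deriv_fun_sub ((hf t ht).hasDerivAt x).differentiableAt
    ((hf s hs).hasDerivAt x).differentiableAt

namespace ContH

variable {f : ℝ → ℝ → ℝ}

lemma contL2 (h : ContH 1 (Ici 0) f) (hf : ∀ t ∈ Ici (0 : ℝ), MemH 1 (f t)) : ContL2 f :=
  .of_integral (fun t ht => (hf t ht).continuous) (fun t ht => (hf t ht).lt_top) _ h
    fun _ _ _ _ => integral_sq_le_HSq_one _

lemma contL2_px (h : ContH 1 (Ici 0) f) (hf : ∀ t ∈ Ici (0 : ℝ), MemH 1 (f t)) :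
    ContL2 (px f) :=
  .of_integral (fun t ht => (hf t ht).continuous_deriv) (fun t ht => (hf t ht).deriv_lt_top) _ h
    fun t ht s hs => by
      have := integral_deriv_sq_le_HSq_one fun x => f t x - f s x
      rwa [deriv_sub_slice hf ht hs] at this

lemma one (h : ContH 2 (Ici 0) f) : ContH 1 (Ici 0) f := fun s hs =>
  squeeze_zero (fun _ => HSq_nonneg _ _) (fun _ => HSq_one_le_HSq_two _) (h s hs)

lemma px (h : ContH 2 (Ici 0) f) (hf : ∀ t ∈ Ici (0 : ℝ), MemH 1 (f t)) :
    ContH 1 (Ici 0) (px f) := fun s hs => by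
  refine squeeze_zero' (Eventually.of_forall fun _ => HSq_nonneg _ _) ?_ (h s hs)
  filter_upwards [self_mem_nhdsWithin] with t ht
  rw [← deriv_sub_slice hf ht hs]
  exact HSq_one_deriv_le_HSq_two _

end ContH

/-- Restart at time `T`, frozen for negative times. -/
def restart (T : ℝ) (g : ℝ → ℝ → ℝ) (t x : ℝ) : ℝ := g (T + max t 0) x

lemma ContL2.sliceBdd {g : ℝ → ℝ → ℝ} (hg : ContL2 g) {T : ℝ} (hT : 0 ≤ T) :
    SliceBdd (restart T g) := by
  have key : ∀ b, ∃ B : NNReal, ∀ t ∈ Icc (0 : ℝ) b, lpow 2 (g t) ≤ B := by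
    intro b
    refine (isCompact_Icc (a := (0 : ℝ)) (b := b)).induction_on
      (p := fun s => ∃ B : NNReal, ∀ t ∈ s, lpow 2 (g t) ≤ B) ⟨0, by simp⟩ ?_ ?_ ?_
    · rintro s t hst ⟨B, hB⟩
      exact ⟨B, fun r hr => hB r (hst hr)⟩
    · rintro s t ⟨B, hB⟩ ⟨D, hD⟩
      refine ⟨max B D, fun r hr => ?_⟩
      rcases hr with hr | hr
      · exact (hB r hr).trans (by exact_mod_cast le_max_left _ _)
      · exact (hD r hr).trans (by exact_mod_cast le_max_right _ _)
    · intro s hs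
      have hfin : (2 * (1 + lpow 2 (g s)) : ENNReal) < ⊤ :=
        ENNReal.mul_lt_top (by simp) (ENNReal.add_lt_top.2 ⟨by simp, hg.lt_top s hs.1⟩)
      have h1 := (hg.tendsto s hs.1).eventually_lt_const (u := 1) (by simp)
      refine ⟨{t | t ∈ Icc 0 b ∧ lpow 2 (fun x => g t x - g s x) < 1}, ?_,
        (2 * (1 + lpow 2 (g s)) : ENNReal).toNNReal, ?_⟩
      · exact inter_mem self_mem_nhdsWithin (nhdsWithin_mono s Icc_subset_Ici_self h1)
      · rintro t ⟨ht, ht1⟩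
        rw [ENNReal.coe_toNNReal hfin.ne]
        have ha : lpow 2 (g t) ≤ 2 * (lpow 2 (fun x => g t x - g s x) + lpow 2 (g s)) := by
          unfold lpow
          rw [← lintegral_add_right _ (by
            exact ((hg.cont s hs.1).pow 2).measurable.ennreal_ofReal),
          ← lintegral_const_mul' _ _ (by simp)]
          refine lintegral_mono fun x => ?_
          rw [← ENNReal.ofReal_add (sq_nonneg _) (sq_nonneg _), ← ENNReal.ofReal_ofNat,
            ← ENNReal.ofReal_mul (by norm_num)]
          exact ENNReal.ofReal_le_ofReal (by nlinarith [sq_nonneg (g t x - 2 * g s x)])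
        exact ha.trans (by gcongr)
  intro t
  obtain ⟨B, hB⟩ := key (T + max t 0)
  exact ⟨B, fun s hs => hB _ ⟨by positivity, by gcongr⟩⟩

lemma ContL2.good {f f' : ℝ → ℝ → ℝ} (hf : ContL2 f) (hf' : ContL2 f')
    (hd : ∀ t ≥ 0, ∀ x, HasDerivAt (f t) (f' t x) x) {T : ℝ} (hT : 0 ≤ T) :
    Good (restart T f) := by
  refine ⟨?_, hf.sliceBdd hT⟩
  have key : ContinuousOn (Function.uncurry f) (Ici 0 ×ˢ univ) := by
    rintro ⟨s, y⟩ ⟨hs, -⟩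
    have hs : 0 ≤ s := hs
    have h1 : Tendsto (fun q : ℝ × ℝ => f q.1 q.2 - f s q.2)
        (nhdsWithin (s, y) (Ici 0 ×ˢ univ)) (nhds 0) := by
      have hsq : Tendsto (fun q : ℝ × ℝ => ENNReal.ofReal ((f q.1 q.2 - f s q.2) ^ 2))
          (nhdsWithin (s, y) (Ici 0 ×ˢ univ)) (nhds 0) := by
        have l1 := ((ENNReal.Tendsto.const_mul (a := 2) (hf.tendsto s hs) (by simp)).add
          (hf'.tendsto s hs))
        rw [mul_zero, add_zero] at l1
        have hfst : Tendsto Prod.fst (nhdsWithin (s, y) (Ici 0 ×ˢ univ)) (nhdsWithin s (Ici 0)) :=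
          tendsto_nhdsWithin_of_tendsto_nhds_of_eventually_within _
            continuous_fst.continuousWithinAt (by
              filter_upwards [self_mem_nhdsWithin] with q hq using hq.1)
        refine tendsto_of_tendsto_of_tendsto_of_le_of_le' tendsto_const_nhds (l1.comp hfst)
          (Eventually.of_forall fun _ => zero_le) ?_
        filter_upwards [self_mem_nhdsWithin] with q hq
        exact sq_le_lpow (f := fun x => f q.1 x - f s x) (f' := fun x => f' q.1 x - f' s x)
          (fun x => (hd q.1 hq.1 x).sub (hd s hs x)) ((hf'.cont q.1 hq.1).sub (hf'.cont s hs)) q.2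
      have h2 := (ENNReal.tendsto_toReal ENNReal.zero_ne_top).comp hsq
      have h3 := (Real.continuous_sqrt.tendsto _).comp h2
      simp only [ENNReal.toReal_zero, Real.sqrt_zero] at h3
      refine (tendsto_zero_iff_abs_tendsto_zero _).2 (h3.congr fun q => ?_)
      simp [ENNReal.toReal_ofReal (sq_nonneg _), Real.sqrt_sq_eq_abs]
    have h2 : Tendsto (fun q : ℝ × ℝ => f s q.2) (nhdsWithin (s, y) (Ici 0 ×ˢ univ))
        (nhds (f s y)) :=
      ((hf.cont s hs).comp continuous_snd).continuousAt.continuousWithinAt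
    have := h1.add h2
    simpa [ContinuousWithinAt, Function.uncurry_def] using this
  exact key.comp_continuous (f := fun q : ℝ × ℝ => (T + max q.1 0, q.2)) (by fun_prop)
    fun q => ⟨show (0 : ℝ) ≤ T + max q.1 0 by positivity, trivial⟩

namespace RegH

variable {f : ℝ → ℝ → ℝ} (h : RegH 2 (Ici 0) f)
include h

lemma contL2 : ContL2 f := h.2.1.one.contL2 fun t ht => (h.1 t ht).one

lemma contH_px : ContH 1 (Ici 0) (px f) := h.2.1.px fun t ht => (h.1 t ht).one

lemma contL2_px : ContL2 (px f) := h.contH_px.contL2 fun t ht => (h.1 t ht).deriv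

lemma contL2_pxx : ContL2 (px (px f)) := h.contH_px.contL2_px fun t ht => (h.1 t ht).deriv

lemma contL2_pt : ContL2 (pt f) := h.2.2.2.2.contL2 h.2.2.2.1

lemma contL2_px_pt : ContL2 (px (pt f)) := h.2.2.2.2.contL2_px h.2.2.2.1

lemma hasDerivAt {t : ℝ} (ht : 0 ≤ t) (x : ℝ) : HasDerivAt (f t) (px f t x) x :=
  (h.1 t ht).one.hasDerivAt x

lemma hasDerivAt_px {t : ℝ} (ht : 0 ≤ t) (x : ℝ) : HasDerivAt (px f t) (px (px f) t x) x :=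
  (h.1 t ht).deriv.hasDerivAt x

lemma hasDerivAt_pt {t : ℝ} (ht : 0 ≤ t) (x : ℝ) : HasDerivAt (pt f t) (px (pt f) t x) x :=
  (h.2.2.2.1 t ht).hasDerivAt x

lemma hasDerivAt_time {t : ℝ} (ht : 0 ≤ t) (x : ℝ) : HasDerivAt (fun s => f s x) (pt f t x) t :=
  (h.2.2.1 x t ht).hasDerivAt

end RegH

lemma le_of_relaxation {y g : ℝ → ℝ} {τ k : ℝ} (hτ : 0 < τ)
    (hy : ∀ t ≥ 0, HasDerivAt y ((g t - y t) / τ) t) (hg : ∀ t ≥ 0, k ≤ g t) {t : ℝ} (ht : 0 ≤ t) :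
    k + (y 0 - k) * Real.exp (-(t / τ)) ≤ y t := by
  have hd : ∀ s ≥ 0, HasDerivAt (fun s => (y s - k) * Real.exp (s / τ))
      ((g s - k) / τ * Real.exp (s / τ)) s := fun s hs => by
    refine (((hy s hs).sub_const k).fun_mul ((hasDerivAt_id s).div_const τ).exp).congr_deriv ?_
    simp only [id]
    ring
  have hmono : MonotoneOn (fun s => (y s - k) * Real.exp (s / τ)) (Ici 0) := by
    refine monotoneOn_of_deriv_nonneg (convex_Ici 0)
      (fun s hs => (hd s hs).continuousAt.continuousWithinAt) ?_ ?_
    · exact fun s hs => (hd s (interior_subset hs)).differentiableAt.differentiableWithinAt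
    · intro s hs
      rw [(hd s (interior_subset hs)).deriv]
      have := hg s (interior_subset hs)
      have : 0 ≤ g s - k := by linarith
      positivity
  have h1 := hmono (mem_Ici.2 le_rfl) (mem_Ici.2 ht) ht
  simp only [zero_div, Real.exp_zero, mul_one] at h1
  have h2 := mul_le_mul_of_nonneg_right h1 (Real.exp_pos (-(t / τ))).le
  rw [mul_assoc, ← Real.exp_add, add_neg_cancel, Real.exp_zero, mul_one] at h2
  linarith

lemma abs_le_of_relaxation {y g : ℝ → ℝ} {τ G : ℝ} (hτ : 0 < τ)
    (hy : ∀ t ≥ 0, HasDerivAt y ((g t - y t) / τ) t) (hg : ∀ t ≥ 0, |g t| ≤ G) {t : ℝ}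
    (ht : 0 ≤ t) : |y t| ≤ G + |y 0| := by
  have h1 := le_of_relaxation hτ hy (fun s hs => (abs_le.1 (hg s hs)).1) ht
  have h2 := le_of_relaxation (y := fun s => -y s) (g := fun s => -g s) hτ
    (fun s hs => (hy s hs).neg.congr_deriv (by ring))
    (fun s hs => neg_le_neg (abs_le.1 (hg s hs)).2) ht
  have e0 := Real.exp_pos (-(t / τ))
  have e1 : Real.exp (-(t / τ)) ≤ 1 :=
    Real.exp_le_one_iff.2 (by have := div_nonneg ht hτ.le; linarith)
  have hG : 0 ≤ G := (abs_nonneg _).trans (hg 0 le_rfl)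
  have := neg_abs_le (y 0)
  have := le_abs_self (y 0)
  have := abs_nonneg (y 0)
  rw [abs_le]
  constructor <;> nlinarith

lemma exists_volume_primitive (a : ℝ) : ∃ L : ℝ → ℝ, ∃ Λ : ℝ, ∀ y ∈ Icc (3 / 4 : ℝ) (5 / 4),
    HasDerivAt L (y ^ (-(2 * a)) / y) y ∧ |L y| ≤ Λ := by
  have hp : ∀ y : ℝ, max (3 / 4) y ≠ 0 := fun y => (lt_max_of_lt_left (by norm_num)).ne'
  have hm : Continuous fun y : ℝ => max (3 / 4) y := by fun_prop
  have hc : Continuous fun y : ℝ => (max (3 / 4) y) ^ (-(2 * a)) / max (3 / 4) y :=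
    (hm.rpow_const fun y => Or.inl (hp y)).div hm hp
  have hd := fun y => (hc.integral_hasStrictDerivAt 0 y).hasDerivAt
  obtain ⟨Λ, hΛ⟩ := (isCompact_Icc (a := (3 / 4 : ℝ)) (b := 5 / 4)).exists_bound_of_continuousOn
    fun y _ => (hd y).continuousAt.continuousWithinAt
  refine ⟨_, Λ, fun y hy => ⟨?_, hΛ y hy⟩⟩
  have := hd y
  rwa [max_eq_right hy.1] at this

lemma exists_rpow_bounds (r : ℝ) : ∃ κ K : ℝ, 0 < κ ∧ ∀ y ∈ Icc (3 / 4 : ℝ) (5 / 4),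
    κ ≤ y ^ r ∧ y ^ r ≤ K := by
  have hp : ∀ y ∈ Icc (3 / 4 : ℝ) (5 / 4), 0 < y := fun y hy => by linarith [hy.1]
  have hc : ContinuousOn (fun y : ℝ => y ^ r) (Icc (3 / 4) (5 / 4)) :=
    continuousOn_id.rpow_const fun y hy => Or.inl (hp y hy).ne'
  obtain ⟨κ, hκ, h1⟩ := isCompact_Icc.exists_forall_le' hc fun y hy =>
    Real.rpow_pos_of_pos (hp y hy) r
  obtain ⟨K, hK⟩ := isCompact_Icc.exists_bound_of_continuousOn hc
  exact ⟨κ, K, hκ, fun y hy => ⟨h1 y hy, (le_abs_self _).trans (hK y hy)⟩⟩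

lemma exists_stress_bounds {a μ τ B₀ : ℝ} {v S q : ℝ → ℝ → ℝ} (hμ : 0 < μ) (hτ : 0 < τ)
    (hv : ∀ t ≥ 0, ∀ x, v t x ∈ Icc (3 / 4 : ℝ) (5 / 4)) (h0 : ∀ x, |S 0 x| ≤ B₀)
    (tv : ∀ t ≥ 0, ∀ x, HasDerivAt (fun s => v s x) (q t x) t)
    (tS : ∀ t ≥ 0, ∀ x, HasDerivAt (fun s => S s x)
      (((μ + 2 * a * τ * S t x) * q t x / v t x - S t x) / τ) t) :
    ∃ T ≥ 0, ∃ B m, 0 < m ∧ m ≤ μ ∧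
      ∀ t ≥ T, ∀ x, |S t x| ≤ B ∧ m ≤ μ + 2 * a * τ * S t x := by
  obtain ⟨L, Λ, hL⟩ := exists_volume_primitive a
  obtain ⟨κ, K, hκ, hP⟩ := exists_rpow_bounds (-(2 * a))
  have v0 : ∀ t ≥ 0, ∀ x, 0 < v t x := fun t ht x => by linarith [(hv t ht x).1]
  have tP : ∀ t ≥ 0, ∀ x, HasDerivAt (fun s => v s x ^ (-(2 * a)))
      (-(2 * a * v t x ^ (-(2 * a)) / v t x * q t x)) t := fun t ht x =>
    (tv t ht x).rpow_neg_const (v0 t ht x)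
  have hK : κ ≤ K := (hP 1 (by norm_num)).1.trans (hP 1 (by norm_num)).2
  have hB₀ : 0 ≤ B₀ := (abs_nonneg _).trans (h0 0)
  have hΛ : 0 ≤ Λ := (abs_nonneg _).trans (hL 1 (by norm_num)).2
  have absP : ∀ t ≥ 0, ∀ x, |v t x ^ (-(2 * a))| ≤ K := fun t ht x => by
    rw [abs_of_pos (hκ.trans_le (hP _ (hv t ht x)).1)]
    exact (hP _ (hv t ht x)).2
  have SP0 : ∀ x, |S 0 x * v 0 x ^ (-(2 * a))| ≤ B₀ * K := fun x => by
    rw [abs_mul]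
    exact mul_le_mul (h0 x) (absP 0 le_rfl x) (abs_nonneg _) hB₀
  have hL' : ∀ t ≥ 0, ∀ x, |μ / τ * L (v t x)| ≤ μ / τ * Λ := fun t ht x => by
    rw [abs_mul, abs_of_pos (div_pos hμ hτ)]
    gcongr
    exact (hL _ (hv t ht x)).2
  have hR : ∀ t ≥ 0, ∀ x, |S t x| ≤ (3 * (μ / τ * Λ) + B₀ * K) / κ := fun t ht x => by
    have hd : ∀ t ≥ 0, HasDerivAt (fun s => S s x * v s x ^ (-(2 * a)) - μ / τ * L (v s x))
        ((-(μ / τ * L (v t x)) - (S t x * v t x ^ (-(2 * a)) - μ / τ * L (v t x))) / τ) t :=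
      fun t ht => by
        refine (((tS t ht x).fun_mul (tP t ht x)).sub ((((hL _ (hv t ht x)).1.comp t
          (tv t ht x))).const_mul (μ / τ))).congr_deriv ?_
        have := (v0 t ht x).ne'
        field_simp
        ring
    have h1 := abs_le_of_relaxation hτ hd (G := μ / τ * Λ)
      (fun s hs => by rw [abs_neg]; exact hL' s hs x) ht
    have h2 := abs_sub (S 0 x * v 0 x ^ (-(2 * a))) (μ / τ * L (v 0 x))
    have h3 := SP0 x
    have h4 := hL' 0 le_rfl x
    have h5 := hL' t ht x
    have h6 : |S t x * v t x ^ (-(2 * a))| ≤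
        |S t x * v t x ^ (-(2 * a)) - μ / τ * L (v t x)| + |μ / τ * L (v t x)| := by
      simpa using abs_add_le (S t x * v t x ^ (-(2 * a)) - μ / τ * L (v t x)) (μ / τ * L (v t x))
    rw [le_div_iff₀ hκ]
    have h7 : |S t x| * κ ≤ |S t x * v t x ^ (-(2 * a))| := by
      rw [abs_mul]
      gcongr
      exact (hP _ (hv t ht x)).1.trans (le_abs_self _)
    linarith
  have hW : ∀ t ≥ 0, ∀ x, μ * κ + ((μ + 2 * a * τ * S 0 x) * v 0 x ^ (-(2 * a)) - μ * κ) *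
      Real.exp (-(t / τ)) ≤ (μ + 2 * a * τ * S t x) * v t x ^ (-(2 * a)) := fun t ht x => by
    refine le_of_relaxation (g := fun t => μ * v t x ^ (-(2 * a))) hτ (fun t ht => ?_)
      (fun s hs => ?_) ht (y := fun t => (μ + 2 * a * τ * S t x) * v t x ^ (-(2 * a)))
    · refine ((((tS t ht x).const_mul (2 * a * τ)).const_add μ).fun_mul (tP t ht x)).congr_deriv ?_
      have := (v0 t ht x).ne'
      field_simp
      ring
    · gcongr
      exact (hP _ (hv s hs x)).1
  set D := 2 * |a| * τ * (B₀ * K) + μ * κ with hD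
  have hlim : Tendsto (fun t : ℝ => D * Real.exp (-(t / τ))) atTop (nhds 0) := by
    have := (Real.tendsto_exp_neg_atTop_nhds_zero.comp
      (tendsto_id.atTop_div_const hτ)).const_mul D
    simpa using this
  obtain ⟨T, hT⟩ :=
    (hlim.eventually_le_const (u := μ * κ / 2) (by positivity)).exists_forall_of_atTop
  have hK0 : 0 < K := hκ.trans_le hK
  refine ⟨max T 0, le_max_right _ _, (3 * (μ / τ * Λ) + B₀ * K) / κ, min μ (μ * κ / 2 / K),
    lt_min hμ (by positivity),
    min_le_left _ _, fun t ht x => ?_⟩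
  have ht0 : 0 ≤ t := (le_max_right _ _).trans ht
  refine ⟨hR t ht0 x, (min_le_right _ _).trans ?_⟩
  have h1 := hW t ht0 x
  have h2 := hT t ((le_max_left _ _).trans ht)
  have h3 : -D ≤ (μ + 2 * a * τ * S 0 x) * v 0 x ^ (-(2 * a)) - μ * κ := by
    have h4 : |2 * a * τ * (S 0 x * v 0 x ^ (-(2 * a)))| ≤ 2 * |a| * τ * (B₀ * K) := by
      rw [abs_mul, abs_mul, abs_mul, abs_of_pos hτ, abs_two]
      gcongr
      exact SP0 x
    have h5 := neg_le_of_abs_le h4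
    have h6 : 0 ≤ μ * v 0 x ^ (-(2 * a)) := (mul_pos hμ (hκ.trans_le (hP _ (hv 0 le_rfl x)).1)).le
    linarith
  have h4 := mul_le_mul_of_nonneg_right h3 (Real.exp_pos (-(t / τ))).le
  have h5 : μ * κ / 2 ≤ (μ + 2 * a * τ * S t x) * v t x ^ (-(2 * a)) := by linarith
  have h6 := (hP _ (hv t ht0 x)).1
  have h7 := (hP _ (hv t ht0 x)).2
  have h8 : 0 < μ + 2 * a * τ * S t x :=
    pos_of_mul_pos_left (lt_of_lt_of_le (by positivity) h5) (hκ.trans_le h6).le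
  rw [div_le_iff₀ hK0]
  exact h5.trans (by gcongr)

lemma restart_nonneg {T : ℝ} (hT : 0 ≤ T) (t : ℝ) : 0 ≤ T + max t 0 := by positivity

lemma hasDerivAt_restart {f : ℝ → ℝ → ℝ} {T t d x : ℝ} (ht : 0 < t)
    (h : HasDerivAt (fun s => f s x) d (T + max t 0)) :
    HasDerivAt (fun s => restart T f s x) d t := by
  rw [max_eq_left ht.le] at h
  refine (h.comp_const_add T t).congr_of_eventuallyEq ?_
  filter_upwards [eventually_gt_nhds ht] with s hs
  simp only [restart, max_eq_left hs.le]

lemma px_sub_const (f : ℝ → ℝ → ℝ) (c : ℝ) : px (fun t x => f t x - c) = px f := by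
  ext t x; simp [px, deriv_sub_const]

lemma pt_sub_const (f : ℝ → ℝ → ℝ) (c : ℝ) : pt (fun t x => f t x - c) = pt f := by
  ext t x; simp [pt, deriv_sub_const]

section

variable {a μ γ τ : ℝ} {v u S : ℝ → ℝ → ℝ}
  (hv : RegH 2 (Ici 0) fun t x => v t x - 1) (hu : RegH 2 (Ici 0) u) (hS : RegH 2 (Ici 0) S)
  (hsys : ∀ t ∈ Ici (0 : ℝ), ∀ x : ℝ,
    v t x ∈ Icc (3 / 4 : ℝ) (5 / 4) ∧ RelaxedSystem a μ γ τ v u S t x)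

include hv hsys in
lemma pt_velocity_eq {t : ℝ} (ht : 0 ≤ t) (x : ℝ) :
    pt u t x = px S t x + γ * v t x ^ (-γ) / v t x * px v t x := by
  have h1 := (hsys t ht x).2.2.1
  have hd : HasDerivAt (v t) (px v t x) x := by
    have := (hv.hasDerivAt ht x).add_const 1
    simpa only [px_sub_const, sub_add_cancel] using this
  rw [(hd.rpow_neg_const (γ := γ) (by linarith [(hsys t ht x).1.1])).deriv] at h1
  linarith

include hv hu hS hsys in
theorem exists_sol (hγ : 1 < γ) (hμ : 0 < μ) (hτ : 0 < τ) : ∃ T ≥ 0, ∃ B m : ℝ,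
    Sol a μ γ τ B m (restart T v) (restart T u) (restart T S) (restart T (px v))
      (restart T (px u)) (restart T (px S)) (restart T (pt u)) (restart T (px (px v)))
      (restart T (px (px u))) (restart T (px (px S))) (restart T (px (pt u))) := by
  have cvx := hv.contL2_px
  have cvxx := hv.contL2_pxx
  have dv : ∀ t ≥ 0, ∀ x, HasDerivAt (fun x => v t x - 1) (px v t x) x := fun t ht x => by
    simpa only [px_sub_const] using hv.hasDerivAt ht x
  have dv' : ∀ t ≥ 0, ∀ x, HasDerivAt (v t) (px v t x) x := fun t ht x => by
    simpa only [sub_add_cancel] using (dv t ht x).add_const 1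
  have dvx : ∀ t ≥ 0, ∀ x, HasDerivAt (px v t) (px (px v) t x) x := fun t ht x => by
    simpa only [px_sub_const] using hv.hasDerivAt_px ht x
  have tv : ∀ t ≥ 0, ∀ x, HasDerivAt (fun s => v s x) (px u t x) t := fun t ht x => by
    have := (hv.hasDerivAt_time ht x).add_const 1
    rw [pt_sub_const, (hsys t ht x).2.1] at this
    simpa only [sub_add_cancel] using this
  rw [px_sub_const] at cvx cvxx
  have vpos : ∀ t ≥ 0, ∀ x, 0 < v t x := fun t ht x => by linarith [(hsys t ht x).1.1]
  have tS : ∀ t ≥ 0, ∀ x, HasDerivAt (fun s => S s x)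
      (((μ + 2 * a * τ * S t x) * px u t x / v t x - S t x) / τ) t := fun t ht x => by
    refine (hS.hasDerivAt_time ht x).congr_deriv ?_
    have h1 := (hsys t ht x).2.2.2
    have h2 := (vpos t ht x).ne'
    rw [eq_div_iff hτ.ne']
    field_simp at h1 ⊢
    linarith
  have hS0 : ∀ x, |S 0 x| ≤ √(2 * lpow 2 (S 0) + lpow 2 (px S 0)).toReal := fun x => by
    have hfin : 2 * lpow 2 (S 0) + lpow 2 (px S 0) < ⊤ :=
      ENNReal.add_lt_top.2 ⟨ENNReal.mul_lt_top (by simp) (hS.contL2.lt_top 0 le_rfl),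
        hS.contL2_px.lt_top 0 le_rfl⟩
    refine Real.abs_le_sqrt ((ENNReal.ofReal_le_iff_le_toReal hfin.ne).1 ?_)
    exact sq_le_lpow (fun x => hS.hasDerivAt le_rfl x) (hS.contL2_px.cont 0 le_rfl) x
  obtain ⟨T, hT, B, m, hm, hmμ, hB⟩ := exists_stress_bounds hμ hτ
    (fun t ht x => (hsys t ht x).1) hS0 tv tS
  have n := restart_nonneg hT
  have nT : ∀ t, T ≤ T + max t 0 := fun t => le_add_of_nonneg_right (le_max_right _ _)
  exact ⟨T, hT, B, m,
    { τpos := hτ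
      one_lt := hγ
      mpos := hm
      m_le := hmμ
      v_mem := fun t x => (hsys _ (n t) x).1
      S_le := fun t x => (hB _ (nT t) x).1
      M_ge := fun t x => (hB _ (nT t) x).2
      gv := hv.contL2.good cvx dv hT
      gu := hu.contL2.good hu.contL2_px (fun t ht => hu.hasDerivAt ht) hT
      gS := hS.contL2.good hS.contL2_px (fun t ht => hS.hasDerivAt ht) hT
      gvx := cvx.good cvxx dvx hT
      gux := hu.contL2_px.good hu.contL2_pxx (fun t ht => hu.hasDerivAt_px ht) hT
      gSx := hS.contL2_px.good hS.contL2_pxx (fun t ht => hS.hasDerivAt_px ht) hT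
      dv := fun t => dv' _ (n t)
      du := fun t => hu.hasDerivAt (n t)
      dS := fun t => hS.hasDerivAt (n t)
      dvx := fun t => dvx _ (n t)
      dux := fun t => hu.hasDerivAt_px (n t)
      dSx := fun t => hS.hasDerivAt_px (n t)
      dw := fun t => hu.hasDerivAt_pt (n t)
      cvxx := fun t => cvxx.cont _ (n t)
      cuxx := fun t => hu.contL2_pxx.cont _ (n t)
      cSxx := fun t => hS.contL2_pxx.cont _ (n t)
      cwx := fun t => hu.contL2_px_pt.cont _ (n t)
      bvxx := cvxx.sliceBdd hT
      buxx := hu.contL2_pxx.sliceBdd hT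
      bSxx := hS.contL2_pxx.sliceBdd hT
      bwx := hu.contL2_px_pt.sliceBdd hT
      w_eq := fun t => pt_velocity_eq hv hsys (n t)
      tv := fun t ht x => hasDerivAt_restart ht (tv _ (n t) x)
      tu := fun t ht x => hasDerivAt_restart ht (hu.hasDerivAt_time (n t) x)
      tS := fun t ht x => hasDerivAt_restart ht (tS _ (n t) x) }⟩

end

lemma Lpow_restart (p : ℕ) (T : ℝ) (g : ℝ → ℝ → ℝ) :
    Lpow p (restart T g) = ∫⁻ t in Ioi T, lpow p (g t) := by
  have h := lintegral_add_left_eq_self (μ := volume) ((Ioi T).indicator fun t => lpow p (g t)) T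
  rw [lintegral_indicator measurableSet_Ioi] at h
  rw [Lpow, ← h, ← lintegral_indicator measurableSet_Ioi]
  refine lintegral_congr fun t => ?_
  by_cases ht : 0 < t
  · have e : restart T g t = g (T + t) := by ext x; simp only [restart, max_eq_left ht.le]
    simp [ht, e]
  · simp [ht]

lemma Lpow_restart_le (p : ℕ) {T : ℝ} (hT : 0 ≤ T) (g : ℝ → ℝ → ℝ) :
    Lpow p (restart T g) ≤ Lpow p g := by
  rw [Lpow_restart]
  exact lintegral_mono_set (Ioi_subset_Ioi hT)

lemma ContL2.Lpow_lt_top {g : ℝ → ℝ → ℝ} (hg : ContL2 g) {T : ℝ} (hT : 0 ≤ T)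
    (h : Lpow 2 (restart T g) < ⊤) : Lpow 2 g < ⊤ := by
  rw [Lpow, ← Ioc_union_Ioi_eq_Ioi hT]
  refine (lintegral_union_le _ _ _).trans_lt (ENNReal.add_lt_top.2 ⟨?_, Lpow_restart 2 T g ▸ h⟩)
  refine lt_of_eq_of_lt ?_ (Good.lintegral_slab_lt_top (hg.sliceBdd le_rfl) T)
  refine setLIntegral_congr_fun measurableSet_Ioc fun t ht => ?_
  have e : restart 0 g t = g t := by ext x; simp only [restart, max_eq_left ht.1.le, zero_add]
  simp only [e]

lemma ContL2.integrableOn {g : ℝ → ℝ → ℝ} (hg : ContL2 g)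
    (hm : Measurable (Function.uncurry (restart 0 g))) (h : Lpow 2 g < ⊤) :
    IntegrableOn (fun t => ∫ x, g t x ^ 2) (Ioi 0) := by
  have h1 : Integrable (fun t => (lpow 2 (restart 0 g t)).toReal) (volume.restrict (Ioi 0)) :=
    integrable_toReal_of_lintegral_ne_top (measurable_lpow hm 2).aemeasurable
      ((Lpow_restart_le 2 le_rfl g).trans_lt h).ne
  refine h1.congr ?_
  filter_upwards [ae_restrict_mem measurableSet_Ioi] with t ht
  have ht : 0 < t := ht
  have e : restart 0 g t = g t := by ext x; simp only [restart, max_eq_left ht.le, zero_add]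
  rw [e, ← ofReal_integral_sq (hg.cont t ht.le) (hg.lt_top t ht.le),
    ENNReal.toReal_ofReal (integral_nonneg fun _ => sq_nonneg _)]

lemma measurable_restart_of_deriv {f f' : ℝ → ℝ → ℝ} {T : ℝ} (hT : 0 ≤ T)
    (hf : Good (restart T f)) (hd : ∀ t ≥ 0, ∀ x, HasDerivAt (f t) (f' t x) x) :
    Measurable (Function.uncurry (restart T f')) := by
  convert measurable_deriv_with_param hf.cont using 1
  ext q
  exact (hd _ (restart_nonneg hT q.1) q.2).deriv.symm

lemma ContL2.Lpow_lt_top_of_integrableOn {g : ℝ → ℝ → ℝ} (hg : ContL2 g) {F : ℝ → ℝ}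
    (hF : IntegrableOn F (Ioi 0)) (hle : ∀ t > 0, ∫ x, g t x ^ 2 ≤ F t) : Lpow 2 g < ⊤ := by
  refine lt_of_le_of_lt ?_ (Integrable.lintegral_lt_top hF)
  refine setLIntegral_mono' measurableSet_Ioi fun t (ht : 0 < t) => ?_
  rw [← ofReal_integral_sq (hg.cont t ht.le) (hg.lt_top t ht.le)]
  exact ENNReal.ofReal_le_ofReal (hle t ht)

lemma integral_four_le {f g g' : ℝ → ℝ} {B : ℝ} (hf : ∀ x, HasDerivAt f (g x) x)
    (hg : ∀ x, HasDerivAt g (g' x) x) (hc : Continuous g') (hB : ∀ x, |f x| ≤ B)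
    (h1 : lpow 2 g < ⊤) (h2 : lpow 2 g' < ⊤) :
    Integrable (fun x => g x ^ 4) ∧ ∫ x, g x ^ 4 ≤ 9 * B ^ 2 * ∫ x, g' x ^ 2 := by
  have h := lpow_four_le hf hg hc hB h1 h2
  have hgc : Continuous g := continuous_iff_continuousAt.2 fun x => (hg x).continuousAt
  have h0 : ∀ x, 0 ≤ g x ^ 4 := fun x => by positivity
  have hi : Integrable fun x => g x ^ 4 := by
    refine (lintegral_ofReal_ne_top_iff_integrable (by fun_prop) (Eventually.of_forall h0)).1 ?_
    exact (h.trans_lt (ENNReal.mul_lt_top ENNReal.ofReal_lt_top h2)).ne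
  refine ⟨hi, ?_⟩
  rw [← ofReal_integral_sq hc h2, ← ENNReal.ofReal_mul (by positivity), lpow,
    ← ofReal_integral_eq_lintegral_ofReal hi (Eventually.of_forall h0)] at h
  exact (ENNReal.ofReal_le_ofReal_iff (mul_nonneg (by positivity)
    (integral_nonneg fun _ => sq_nonneg _))).1 h

lemma exists_pressure_bounds (γ : ℝ) : ∃ φ' : ℝ → ℝ, ∃ c₁ c₂ : ℝ, ∀ y ∈ Icc (3 / 4 : ℝ) (5 / 4),
    HasDerivAt (fun y => γ * y ^ (-γ) / y) (φ' y) y ∧ |γ * y ^ (-γ) / y| ≤ c₁ ∧ |φ' y| ≤ c₂ := by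
  have hp : ∀ y ∈ Icc (3 / 4 : ℝ) (5 / 4), y ≠ 0 := fun y hy => by linarith [hy.1]
  have hr : ContinuousOn (fun y : ℝ => y ^ (-γ)) (Icc (3 / 4) (5 / 4)) :=
    continuousOn_id.rpow_const fun y hy => Or.inl (hp y hy)
  have h1 : ContinuousOn (fun y : ℝ => γ * y ^ (-γ) / y) (Icc (3 / 4) (5 / 4)) :=
    (continuousOn_const.mul hr).div continuousOn_id hp
  have h2 : ContinuousOn (fun y : ℝ => -(γ * (γ + 1)) * y ^ (-γ) / y ^ 2) (Icc (3 / 4) (5 / 4)) :=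
    (continuousOn_const.mul hr).div (continuousOn_id.pow 2) fun y hy => pow_ne_zero 2 (hp y hy)
  obtain ⟨c₁, hc₁⟩ := isCompact_Icc.exists_bound_of_continuousOn h1
  obtain ⟨c₂, hc₂⟩ := isCompact_Icc.exists_bound_of_continuousOn h2
  refine ⟨_, c₁, c₂, fun y hy => ⟨?_, hc₁ y hy, hc₂ y hy⟩⟩
  have hy0 : 0 < y := by linarith [hy.1]
  refine ((((hasDerivAt_id y).rpow_neg_const (γ := γ) hy0).const_mul γ).div (hasDerivAt_id y)
    hy0.ne').congr_deriv ?_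
  simp only [id]
  field_simp
  ring

lemma exists_acceleration_le (γ : ℝ) : ∃ K ≥ 1, ∀ a μ τ : ℝ, ∀ v u S : ℝ → ℝ → ℝ,
    RegH 2 (Ici 0) (fun t x => v t x - 1) → RegH 2 (Ici 0) u → RegH 2 (Ici 0) S →
    (∀ t ∈ Ici (0 : ℝ), ∀ x : ℝ,
      v t x ∈ Icc (3 / 4 : ℝ) (5 / 4) ∧ RelaxedSystem a μ γ τ v u S t x) →
    ∀ t ≥ 0, HSq 1 (pt u t) ≤ K * Dn v u S t := by
  obtain ⟨φ', c₁, c₂, hφ⟩ := exists_pressure_bounds γ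
  refine ⟨3 + 3 * c₁ ^ 2 + 2 * c₂ ^ 2, by nlinarith [sq_nonneg c₁, sq_nonneg c₂],
    fun a μ τ v u S hv hu hS hsys t ht => ?_⟩
  have cvx := hv.contL2_px
  have cvxx := hv.contL2_pxx
  have dv : ∀ x, HasDerivAt (fun x => v t x - 1) (px v t x) x := fun x => by
    simpa only [px_sub_const] using hv.hasDerivAt ht x
  have dv' : ∀ x, HasDerivAt (v t) (px v t x) x := fun x => by
    simpa only [sub_add_cancel] using (dv x).add_const 1
  have dvx : ∀ x, HasDerivAt (px v t) (px (px v) t x) x := fun x => by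
    simpa only [px_sub_const] using hv.hasDerivAt_px ht x
  rw [px_sub_const] at cvx cvxx
  have hv1 : ∀ x, |v t x - 1| ≤ 1 / 4 := fun x => by
    have := (hsys t ht x).1
    rw [abs_le]; constructor <;> linarith [this.1, this.2]
  obtain ⟨i4, h4⟩ := integral_four_le dv dvx (cvxx.cont t ht) hv1 (cvx.lt_top t ht)
    (cvxx.lt_top t ht)
  have w_eq : ∀ x, pt u t x = px S t x + γ * v t x ^ (-γ) / v t x * px v t x :=
    pt_velocity_eq hv hsys ht
  have wx_eq : ∀ x, px (pt u) t x = px (px S) t x +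
      (γ * v t x ^ (-γ) / v t x * px (px v) t x + φ' (v t x) * px v t x ^ 2) := fun x => by
    have := (hS.hasDerivAt_px ht x).add
      ((((hφ _ (hsys t ht x).1).1.comp x (dv' x))).fun_mul (dvx x))
    refine (hu.hasDerivAt_pt ht x).unique ((this.congr_deriv ?_).congr_of_eventuallyEq
      (Eventually.of_forall w_eq))
    simp only [Function.comp_apply]
    ring
  have int : ∀ {g : ℝ → ℝ → ℝ}, ContL2 g → Integrable fun x => g t x ^ 2 := fun hg =>
    integrable_sq_of_lpow (hg.cont t ht) (hg.lt_top t ht)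
  have b1 : ∀ x, (γ * v t x ^ (-γ) / v t x) ^ 2 ≤ c₁ ^ 2 := fun x =>
    sq_le_sq' (abs_le.1 (hφ _ (hsys t ht x).1).2.1).1 (abs_le.1 (hφ _ (hsys t ht x).1).2.1).2
  have b2 : ∀ x, φ' (v t x) ^ 2 ≤ c₂ ^ 2 := fun x =>
    sq_le_sq' (abs_le.1 (hφ _ (hsys t ht x).1).2.2).1 (abs_le.1 (hφ _ (hsys t ht x).1).2.2).2
  have e1 : ∫ x, pt u t x ^ 2 ≤ 2 * (∫ x, px S t x ^ 2) + 2 * c₁ ^ 2 * ∫ x, px v t x ^ 2 := by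
    rw [← MeasureTheory.integral_const_mul, ← MeasureTheory.integral_const_mul,
      ← MeasureTheory.integral_add ((int hS.contL2_px).const_mul _) ((int cvx).const_mul _)]
    refine integral_mono (int hu.contL2_pt)
      (((int hS.contL2_px).const_mul _).add ((int cvx).const_mul _)) fun x => ?_
    have h1 := mul_le_mul_of_nonneg_right (b1 x) (sq_nonneg (px v t x))
    rw [← mul_pow] at h1
    simp only [w_eq]
    nlinarith [sq_nonneg (px S t x - γ * v t x ^ (-γ) / v t x * px v t x)]
  have e2 : ∫ x, px (pt u) t x ^ 2 ≤ 3 * (∫ x, px (px S) t x ^ 2) +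
      3 * c₁ ^ 2 * (∫ x, px (px v) t x ^ 2) + 3 * c₂ ^ 2 * ∫ x, px v t x ^ 4 := by
    have i3 : Integrable fun x => 3 * px (px S) t x ^ 2 + 3 * c₁ ^ 2 * px (px v) t x ^ 2 :=
      ((int hS.contL2_pxx).const_mul _).add ((int cvxx).const_mul _)
    rw [← MeasureTheory.integral_const_mul, ← MeasureTheory.integral_const_mul,
      ← MeasureTheory.integral_const_mul,
      ← MeasureTheory.integral_add ((int hS.contL2_pxx).const_mul _) ((int cvxx).const_mul _),
      ← MeasureTheory.integral_add i3 (i4.const_mul _)]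
    refine integral_mono (int hu.contL2_px_pt) (i3.add (i4.const_mul _)) fun x => ?_
    have h1 := mul_le_mul_of_nonneg_right (b1 x) (sq_nonneg (px (px v) t x))
    have h2 := mul_le_mul_of_nonneg_right (b2 x) (sq_nonneg (px v t x ^ 2))
    rw [← mul_pow] at h1 h2
    have h3 : (px v t x ^ 2) ^ 2 = px v t x ^ 4 := by ring
    rw [h3] at h2
    simp only [wx_eq]
    generalize γ * v t x ^ (-γ) / v t x * px (px v) t x = p at *
    generalize φ' (v t x) * px v t x ^ 2 = q at *
    nlinarith [sq_nonneg (px (px S) t x - p), sq_nonneg (px (px S) t x - q), sq_nonneg (p - q)]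
  have n : ∀ g : ℝ → ℝ, 0 ≤ ∫ x, g x ^ 2 := fun g => integral_nonneg fun _ => sq_nonneg _
  have hD : (∫ x, px v t x ^ 2) + (∫ x, px (px v) t x ^ 2) + (∫ x, px S t x ^ 2) +
      (∫ x, px (px S) t x ^ 2) ≤ Dn v u S t := by
    have h1 : Dn v u S t = ((∫ x, px v t x ^ 2) + ∫ x, px (px v) t x ^ 2) + HSq 1 (px u t) +
        ((∫ x, S t x ^ 2) + ((∫ x, px S t x ^ 2) + ∫ x, px (px S) t x ^ 2)) := by
      rw [Dn, HSq_two, HSq_one (deriv (S t)), HSq_one fun x => px v t x]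
      rfl
    rw [h1]
    linarith [n (S t), HSq_nonneg 1 (px u t)]
  have h5 : HSq 1 (pt u t) = (∫ x, pt u t x ^ 2) + ∫ x, px (pt u) t x ^ 2 := HSq_one _
  rw [h5]
  refine le_trans ?_ (mul_le_mul_of_nonneg_left hD (by positivity))
  have n1 := n (px v t)
  have n2 := n (px (px v) t)
  have n3 := n (px S t)
  have n4 := n (px (px S) t)
  have s1 := sq_nonneg c₁
  have s2 := sq_nonneg c₂
  have h6 := mul_le_mul_of_nonneg_left h4 s2
  nlinarith [mul_nonneg s1 n1, mul_nonneg s1 n2, mul_nonneg s1 n3, mul_nonneg s1 n4,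
    mul_nonneg s2 n1, mul_nonneg s2 n2, mul_nonneg s2 n3, mul_nonneg s2 n4]

lemma RegH.integrableOn_sq {f : ℝ → ℝ → ℝ} (hf : RegH 2 (Ici 0) f) (h : Lpow 2 f < ⊤) :
    IntegrableOn (fun t => ∫ x, f t x ^ 2) (Ioi 0) :=
  hf.contL2.integrableOn (hf.contL2.good hf.contL2_px (fun _ ht => hf.hasDerivAt ht)
    le_rfl).cont.measurable h

lemma RegH.integrableOn_HSq_px {f : ℝ → ℝ → ℝ} (hf : RegH 2 (Ici 0) f) (h1 : Lpow 2 (px f) < ⊤)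
    (h2 : Lpow 2 (px (px f)) < ⊤) : IntegrableOn (fun t => HSq 1 (px f t)) (Ioi 0) := by
  have hg := hf.contL2_px.good hf.contL2_pxx (fun _ ht => hf.hasDerivAt_px ht) le_rfl
  refine ((hf.contL2_px.integrableOn hg.cont.measurable h1).add (hf.contL2_pxx.integrableOn
    (measurable_restart_of_deriv le_rfl hg fun _ ht => hf.hasDerivAt_px ht) h2)).congr ?_
  exact Eventually.of_forall fun t => (HSq_one (px f t)).symm

lemma integrableOn_Dn {a μ γ τ : ℝ} {v u S : ℝ → ℝ → ℝ}
    (hv : RegH 2 (Ici 0) (fun t x => v t x - 1)) (hu : RegH 2 (Ici 0) u) (hS : RegH 2 (Ici 0) S)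
    (hsys : ∀ t ∈ Ici (0 : ℝ), ∀ x : ℝ,
      v t x ∈ Icc (3 / 4 : ℝ) (5 / 4) ∧ RelaxedSystem a μ γ τ v u S t x)
    (hγ : 1 < γ) (hμ : 0 < μ) (hτ : 0 < τ)
    (h : IntegrableOn (fun t => HSq 1 (px u t)) (Ioi 0) ∨
      IntegrableOn (fun t => HSq 1 (pt u t)) (Ioi 0)) :
    IntegrableOn (Dn v u S) (Ioi 0) := by
  obtain ⟨T, hT, B, m, hsol⟩ := exists_sol hv hu hS hsys hγ hμ hτ
  obtain ⟨z, αv, βv, αs, βs, ζv, ζs, c, e, K, C, c₀, R⟩ := hsol.exists_reduced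
  have hacc : Lpow 2 (restart T (pt u)) < ⊤ ∧ Lpow 2 (restart T (px (pt u))) < ⊤ := by
    rcases h with h | h
    · exact R.acceleration_lt
        ((Lpow_restart_le 2 hT _).trans_lt (hu.contL2_px.Lpow_lt_top_of_integrableOn h
          fun t _ => integral_sq_le_HSq_one _))
        ((Lpow_restart_le 2 hT _).trans_lt (hu.contL2_pxx.Lpow_lt_top_of_integrableOn h
          fun t _ => integral_deriv_sq_le_HSq_one _))
    · exact ⟨(Lpow_restart_le 2 hT _).trans_lt (hu.contL2_pt.Lpow_lt_top_of_integrableOn h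
          fun t _ => integral_sq_le_HSq_one _),
        (Lpow_restart_le 2 hT _).trans_lt (hu.contL2_px_pt.Lpow_lt_top_of_integrableOn h
          fun t _ => integral_deriv_sq_le_HSq_one _)⟩
  obtain ⟨hvx, hvxx, hux, huxx, hSx, hSxx⟩ := R.gradients_lt hacc.1 hacc.2
  have cvx := hv.contL2_px
  have cvxx := hv.contL2_pxx
  have iv := hv.integrableOn_HSq_px
  rw [px_sub_const] at cvx cvxx iv
  refine (((iv (cvx.Lpow_lt_top hT hvx) (cvxx.Lpow_lt_top hT hvxx)).add
    (hu.integrableOn_HSq_px (hu.contL2_px.Lpow_lt_top hT hux)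
      (hu.contL2_pxx.Lpow_lt_top hT huxx))).add
    ((hS.integrableOn_sq (hS.contL2.Lpow_lt_top hT R.S_lt)).add
    (hS.integrableOn_HSq_px (hS.contL2_px.Lpow_lt_top hT hSx)
      (hS.contL2_pxx.Lpow_lt_top hT hSxx)))).congr ?_
  refine Eventually.of_forall fun t => ?_
  rw [Dn, HSq_two]
  rfl

/-- Uniform bound on the time derivatives: for any global solution of the relaxed
system in the class of Theorem 1.1, with `3/4 ≤ v ≤ 5/4` and the uniform bound
`sup_{t≥0}(‖(v-1)(t)‖²_{H²} + ‖u(t)‖²_{H²} + τ‖S(t)‖²_{H²}) + ∫₀^∞ D(t) dt ≤ C₀E₀`,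
there is `C > 0` depending only on `γ` and `C₀` (in particular independent of `τ`,
`a` and `μ`) such that `∫₀^∞ ‖∂ₜv(t)‖²_{H¹} dt ≤ C E₀` and
`∫₀^∞ ‖∂ₜu(t)‖²_{H¹} dt ≤ C E₀`. -/
theorem time_derivative_bounds (γ : ℝ) (hγ : 1 < γ) (C₀ : ℝ) :
    ∃ C > (0 : ℝ), ∀ a μ τ : ℝ, a ∈ Icc (-1 : ℝ) 1 → 0 < μ → τ ∈ Ioo (0 : ℝ) 1 →
      ∀ v u S : ℝ → ℝ → ℝ,
        RegH 2 (Ici 0) (fun t x => v t x - 1) → RegH 2 (Ici 0) u → RegH 2 (Ici 0) S →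
        (∀ t ∈ Ici (0 : ℝ), ∀ x : ℝ,
          v t x ∈ Icc (3 / 4 : ℝ) (5 / 4) ∧ RelaxedSystem a μ γ τ v u S t x) →
        ∀ E₀ : ℝ, E₀ = HSq 2 (fun x => v 0 x - 1) + HSq 2 (u 0) + τ * HSq 2 (S 0) →
        sSup ((fun t => HSq 2 (fun x => v t x - 1) + HSq 2 (u t) + τ * HSq 2 (S t))
            '' Ici 0) + (∫ t in Ioi (0 : ℝ), Dn v u S t) ≤ C₀ * E₀ →
        (∫ t in Ioi (0 : ℝ), HSq 1 (fun x => pt v t x)) ≤ C * E₀ ∧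
          (∫ t in Ioi (0 : ℝ), HSq 1 (fun x => pt u t x)) ≤ C * E₀ := by
  obtain ⟨K, hK, hacc⟩ := exists_acceleration_le γ
  refine ⟨K * |C₀| + 1, by positivity, ?_⟩
  intro a μ τ _ hμ hτ v u S hv hu hS hsys E₀ hE₀ hbound
  have hE : ∀ t, 0 ≤ HSq 2 (fun x => v t x - 1) + HSq 2 (u t) + τ * HSq 2 (S t) := fun t =>
    add_nonneg (add_nonneg (HSq_nonneg _ _) (HSq_nonneg _ _))
      (mul_nonneg hτ.1.le (HSq_nonneg _ _))
  have hE₀n : 0 ≤ E₀ := hE₀ ▸ hE 0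
  have hDn : ∀ t, HSq 1 (px u t) ≤ Dn v u S t := fun t =>
    (le_add_of_nonneg_left (HSq_nonneg _ _)).trans (le_add_of_nonneg_right (HSq_nonneg _ _))
  have hsup := Real.sSup_nonneg (forall_mem_image.2 fun t (_ : t ∈ Ici (0 : ℝ)) => hE t)
  have hv_eq : (∫ t in Ioi (0 : ℝ), HSq 1 (fun x => pt v t x)) =
      ∫ t in Ioi (0 : ℝ), HSq 1 (px u t) :=
    setIntegral_congr_fun measurableSet_Ioi fun t (ht : 0 < t) =>
      congrArg (HSq 1) (funext fun x => (hsys t ht.le x).2.1)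
  rw [hv_eq]
  by_cases hint : IntegrableOn (Dn v u S) (Ioi 0)
  · have hD : ∫ t in Ioi (0 : ℝ), Dn v u S t ≤ |C₀| * E₀ := by
      nlinarith [mul_le_mul_of_nonneg_right (le_abs_self C₀) hE₀n]
    have hn : 0 ≤ |C₀| * E₀ := by positivity
    constructor
    · refine (integral_mono_of_nonneg (Eventually.of_forall fun t => HSq_nonneg _ _) hint
        (Eventually.of_forall hDn)).trans ?_
      nlinarith
    · refine (integral_mono_of_nonneg (Eventually.of_forall fun t => HSq_nonneg _ _)
        (hint.const_mul K) ((ae_restrict_mem measurableSet_Ioi).mono fun t (ht : 0 < t) =>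
          hacc a μ τ v u S hv hu hS hsys t ht.le)).trans ?_
      rw [MeasureTheory.integral_const_mul]
      nlinarith
  · have h := fun h => hint (integrableOn_Dn hv hu hS hsys hγ hμ hτ.1 h)
    have hC : 0 ≤ (K * |C₀| + 1) * E₀ := by positivity
    rw [integral_undef fun h' => h (Or.inl h'), integral_undef fun h' => h (Or.inr h')]
    exact ⟨hC, hC⟩
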